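/- Let f ∈ ℬ be convenient and Newton nondegenerate. For 1 ≤ p ≤ n−1 and indices 1 ≤ i₁ < ⋯ < i_p ≤ n, let f_{(i₁,…,i_p)} be the polynomial in the remaining n−p variables obtained from f by setting u_{i₁} = ⋯ = u_{i_p} = 0; it is again convenient and Newton nondegenerate, and its toric Newton graded pieces gr^𝒩_α are formed with its own Newton polytope, Newton function and ideal ℒ(f_{(i₁,…,i_p)}) generated by the u_j ∂f_{(i₁,…,i_p)}/∂u_j. Then for every α ∈ ℚ the following equality holds in ℤ: dim_ℂ gr^W_α(ℬ/ℐ) = dim_ℂ gr^𝒩_α(ℬ/ℒ(f)) + Σ_{p=1}^{n−1} (−1)^p Σ_{1 ≤ i₁ < ⋯ < i_p ≤ n} dim_ℂ gr^𝒩_α(ℂ[u_j : j ∉ {i₁,…,i_p}]/ℒ(f_{(i₁,…,i_p)})) + (−1)^n·[α = 0], where [α = 0] equals 1 if α = 0 and 0 otherwise. -/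

import Mathlib

open MvPolynomial

namespace ToricNewton

section
variable {σ : Type*} [Fintype σ] [DecidableEq σ]

/-- Coercion of a lattice point of `ℕ^σ` into `ℝ^σ`. -/
def natToR (v : σ → ℕ) : σ → ℝ := fun i => (v i : ℝ)

/-- Coercion of an exponent (finitely supported) into `ℝ^σ`. -/
def toR (m : σ →₀ ℕ) : σ → ℝ := fun i => (m i : ℝ)

/-- The Newton polytope of a polynomial: the convex hull of `{0} ∪ supp f`. -/
noncomputable def newtonPolytope (f : MvPolynomial σ ℂ) : Set (σ → ℝ) :=
  convexHull ℝ ({0} ∪ (toR '' (f.support : Set (σ →₀ ℕ))))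

/-- The Newton function `ν`, which for a convenient polynomial is the gauge
(Minkowski functional) of the Newton polytope. -/
noncomputable def nu (f : MvPolynomial σ ℂ) (x : σ → ℝ) : ℝ :=
  gauge (newtonPolytope f) x

/-- `f` is convenient if for each variable `i` some pure power `uᵢ^k`, `k ≥ 1`,
occurs in `f` with nonzero coefficient. -/
def Convenient (f : MvPolynomial σ ℂ) : Prop :=
  ∀ i : σ, ∃ k : ℕ, 1 ≤ k ∧ f.coeff (Finsupp.single i k) ≠ 0

/-- `Δ` is a (nonempty exposed) closed face of `P`. -/
def IsFace (P Δ : Set (σ → ℝ)) : Prop :=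
  Δ.Nonempty ∧ ∃ (l : (σ → ℝ) →ₗ[ℝ] ℝ) (c : ℝ),
    (∀ x ∈ P, l x ≤ c) ∧ Δ = {x ∈ P | l x = c}

/-- A face of the Newton boundary: a closed face of the Newton polytope not
containing the origin. -/
def NBFace (f : MvPolynomial σ ℂ) (Δ : Set (σ → ℝ)) : Prop :=
  IsFace (newtonPolytope f) Δ ∧ (0 : σ → ℝ) ∉ Δ

open Classical in
/-- The truncation `g_Δ` of `g` to the monomials whose exponents lie in `Δ`. -/
noncomputable def faceRestrict (Δ : Set (σ → ℝ)) (g : MvPolynomial σ ℂ) : MvPolynomial σ ℂ :=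
  ∑ m ∈ g.support, if toR m ∈ Δ then monomial m (g.coeff m) else 0

/-- `f` is Newton nondegenerate: for every closed face `Δ` of the Newton boundary
the system `(u₁ ∂f/∂u₁)_Δ = ⋯ = (uₙ ∂f/∂uₙ)_Δ = 0` has no solution in `(ℂ*)ⁿ`. -/
def Nondegenerate (f : MvPolynomial σ ℂ) : Prop :=
  ∀ Δ : Set (σ → ℝ), NBFace f Δ →
    ¬ ∃ x : σ → ℂ, (∀ i, x i ≠ 0) ∧
        ∀ i, eval x (faceRestrict Δ (X i * pderiv i f)) = 0

/-- The ideal `ℒ` generated by the `uᵢ ∂f/∂uᵢ`. -/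
noncomputable def LIdeal (f : MvPolynomial σ ℂ) : Ideal (MvPolynomial σ ℂ) :=
  Ideal.span (Set.range fun i => X i * pderiv i f)

/-- The Jacobian ideal `ℐ` generated by the `∂f/∂uᵢ`. -/
noncomputable def IIdeal (f : MvPolynomial σ ℂ) : Ideal (MvPolynomial σ ℂ) :=
  Ideal.span (Set.range fun i => pderiv i f)

/-- The Newton filtration `𝒩_α ℬ`: the span of the monomials `u^m` with `ν(m) ≤ α`. -/
noncomputable def Nle (f : MvPolynomial σ ℂ) (α : ℝ) : Submodule ℂ (MvPolynomial σ ℂ) where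
  carrier := {g | ∀ m ∈ g.support, nu f (toR m) ≤ α}
  zero_mem' := by simp
  add_mem' := by
    intro a b ha hb m hm
    rcases Finset.mem_union.mp (MvPolynomial.support_add hm) with h | h
    · exact ha m h
    · exact hb m h
  smul_mem' := by
    intro c a ha m hm
    exact ha m (MvPolynomial.support_smul hm)

/-- The filtration `𝒩_{<α} ℬ`. -/
noncomputable def Nlt (f : MvPolynomial σ ℂ) (α : ℝ) : Submodule ℂ (MvPolynomial σ ℂ) where
  carrier := {g | ∀ m ∈ g.support, nu f (toR m) < α}
  zero_mem' := by simp
  add_mem' := by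
    intro a b ha hb m hm
    rcases Finset.mem_union.mp (MvPolynomial.support_add hm) with h | h
    · exact ha m h
    · exact hb m h
  smul_mem' := by
    intro c a ha m hm
    exact ha m (MvPolynomial.support_smul hm)

/-- The twisted filtration `W_α ℬ`: the span of the monomials `u^m` with
`ν(m + (1,…,1)) ≤ α`. -/
noncomputable def Wle (f : MvPolynomial σ ℂ) (α : ℝ) : Submodule ℂ (MvPolynomial σ ℂ) where
  carrier := {g | ∀ m ∈ g.support, nu f (toR m + 1) ≤ α}
  zero_mem' := by simp
  add_mem' := by
    intro a b ha hb m hm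
    rcases Finset.mem_union.mp (MvPolynomial.support_add hm) with h | h
    · exact ha m h
    · exact hb m h
  smul_mem' := by
    intro c a ha m hm
    exact ha m (MvPolynomial.support_smul hm)

/-- The twisted filtration `W_{<α} ℬ`. -/
noncomputable def Wlt (f : MvPolynomial σ ℂ) (α : ℝ) : Submodule ℂ (MvPolynomial σ ℂ) where
  carrier := {g | ∀ m ∈ g.support, nu f (toR m + 1) < α}
  zero_mem' := by simp
  add_mem' := by
    intro a b ha hb m hm
    rcases Finset.mem_union.mp (MvPolynomial.support_add hm) with h | h
    · exact ha m h
    · exact hb m h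
  smul_mem' := by
    intro c a ha m hm
    exact ha m (MvPolynomial.support_smul hm)

/-- The graded piece `gr^𝒩_α(ℬ/ℒ) = (𝒩_α ℬ + ℒ)/(𝒩_{<α} ℬ + ℒ)`, realized as the
image of `𝒩_α ℬ + ℒ` in `ℬ/(𝒩_{<α} ℬ + ℒ)`. -/
noncomputable def grN (f : MvPolynomial σ ℂ) (α : ℝ) :
    Submodule ℂ (MvPolynomial σ ℂ ⧸ (Nlt f α ⊔ (LIdeal f).restrictScalars ℂ)) :=
  Submodule.map (Nlt f α ⊔ (LIdeal f).restrictScalars ℂ).mkQ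
    (Nle f α ⊔ (LIdeal f).restrictScalars ℂ)

/-- `dim_ℂ gr^𝒩_α(ℬ/ℒ)`. -/
noncomputable def grDim (f : MvPolynomial σ ℂ) (α : ℝ) : ℕ :=
  Module.finrank ℂ (grN f α)

/-- The graded piece `gr^W_α(ℬ/ℐ) = (W_α ℬ + ℐ)/(W_{<α} ℬ + ℐ)`. -/
noncomputable def grW (f : MvPolynomial σ ℂ) (α : ℝ) :
    Submodule ℂ (MvPolynomial σ ℂ ⧸ (Wlt f α ⊔ (IIdeal f).restrictScalars ℂ)) :=
  Submodule.map (Wlt f α ⊔ (IIdeal f).restrictScalars ℂ).mkQ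
    (Wle f α ⊔ (IIdeal f).restrictScalars ℂ)

/-- `dim_ℂ gr^W_α(ℬ/ℐ)`. -/
noncomputable def grWDim (f : MvPolynomial σ ℂ) (α : ℝ) : ℕ :=
  Module.finrank ℂ (grW f α)

/-- The dimension of a face, i.e. of the direction of its affine span. -/
noncomputable def faceDim (Δ : Set (σ → ℝ)) : ℕ :=
  Module.finrank ℝ (affineSpan ℝ Δ).direction

/-- `Δ` is a simplex: the convex hull of an affinely independent family. -/
def IsSimplex (Δ : Set (σ → ℝ)) : Prop :=
  ∃ (k : ℕ) (p : Fin (k + 1) → (σ → ℝ)), AffineIndependent ℝ p ∧ Δ = convexHull ℝ (Set.range p)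

/-- The union of the coordinate hyperplanes. -/
def coordHyperplanes (σ : Type*) : Set (σ → ℝ) := ⋃ i : σ, {x : σ → ℝ | x i = 0}

/-- `Box(Δ)`: the set of combinations `Σ q_ℓ b_ℓ`, `q_ℓ ∈ [0,1)`, of the vertices
(extreme points) of `Δ`. -/
def Box (Δ : Set (σ → ℝ)) : Set (σ → ℝ) :=
  {x | ∃ s : Finset (σ → ℝ), ↑s ⊆ Δ.extremePoints ℝ ∧
      ∃ q : (σ → ℝ) → ℝ, (∀ b ∈ s, 0 ≤ q b ∧ q b < 1) ∧ x = ∑ b ∈ s, q b • b}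

/-- `Δ ∈ ℱ(P)`: a closed face of the Newton polytope of `f` not contained in the
union of the coordinate hyperplanes. -/
def FcalMem (f : MvPolynomial σ ℂ) (Δ : Set (σ → ℝ)) : Prop :=
  IsFace (newtonPolytope f) Δ ∧ ¬ Δ ⊆ coordHyperplanes σ

/-- `Box(P)`: the union of `Box(Δ)` over the closed faces of the Newton boundary
not contained in the union of the coordinate hyperplanes. -/
def BoxP (f : MvPolynomial σ ℂ) : Set (σ → ℝ) :=
  ⋃ Δ ∈ {Δ : Set (σ → ℝ) | NBFace f Δ ∧ ¬ Δ ⊆ coordHyperplanes σ}, Box Δ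

/-- The cone `ℝ₊·Δ` over `Δ`. -/
def cone0 (Δ : Set (σ → ℝ)) : Set (σ → ℝ) :=
  {x | ∃ t : ℝ, 0 ≤ t ∧ ∃ y ∈ Δ, x = t • y}

/-- The restriction of `f` obtained by setting the variables in `S` to zero. -/
noncomputable def restrictZero (S : Finset σ) (f : MvPolynomial σ ℂ) :
    MvPolynomial {j : σ // j ∉ S} ℂ :=
  aeval (fun j : σ => if h : j ∉ S then X (⟨j, h⟩ : {j : σ // j ∉ S}) else 0) f

end

end ToricNewton

set_option linter.all false
set_option linter.unusedSectionVars false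
set_option linter.unusedVariables false

namespace ToricNewton
namespace Kz

open Finset

section Res
variable {M : Type*} [AddCommGroup M]

open Classical in
/-- Restriction of an element of the group algebra to the exponents in `S`. -/
noncomputable def res (S : Set M) (a : AddMonoidAlgebra ℂ M) : AddMonoidAlgebra ℂ M :=
  AddMonoidAlgebra.ofCoeff (a.coeff.filter (fun m => m ∈ S))

/-- `a` is supported in `S`. -/
def SIn (S : Set M) (a : AddMonoidAlgebra ℂ M) : Prop := ∀ m, a.coeff m ≠ 0 → m ∈ S

open Classical in
lemma res_coeff (S : Set M) (a : AddMonoidAlgebra ℂ M) (m : M) :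
    (res S a).coeff m = if m ∈ S then a.coeff m else 0 := by
  simp [res, Finsupp.filter_apply]

lemma alg_ext {a b : AddMonoidAlgebra ℂ M} (h : ∀ m, a.coeff m = b.coeff m) : a = b :=
  AddMonoidAlgebra.ext (Finsupp.ext h)

lemma res_add (S : Set M) (a b : AddMonoidAlgebra ℂ M) : res S (a + b) = res S a + res S b := by
  classical
  apply alg_ext; intro m
  simp only [res_coeff, AddMonoidAlgebra.coeff_add, Finsupp.add_apply]
  split_ifs <;> simp

lemma res_smul (S : Set M) (z : ℂ) (b : AddMonoidAlgebra ℂ M) : res S (z • b) = z • res S b := by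
  classical
  apply alg_ext; intro m
  simp only [res_coeff, AddMonoidAlgebra.coeff_smul, Finsupp.smul_apply]
  split_ifs <;> simp

/-- `res` as a linear map. -/
noncomputable def resL (S : Set M) : AddMonoidAlgebra ℂ M →ₗ[ℂ] AddMonoidAlgebra ℂ M where
  toFun := res S
  map_add' := res_add S
  map_smul' := res_smul S

lemma res_zero (S : Set M) : res S (0 : AddMonoidAlgebra ℂ M) = 0 := (resL S).map_zero
lemma res_sub (S : Set M) (a b : AddMonoidAlgebra ℂ M) : res S (a - b) = res S a - res S b :=
  (resL S).map_sub a b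
lemma res_sum (S : Set M) {ι : Type*} (s : Finset ι) (a : ι → AddMonoidAlgebra ℂ M) :
    res S (∑ i ∈ s, a i) = ∑ i ∈ s, res S (a i) := map_sum (resL S) a s

lemma res_sin (S : Set M) (a : AddMonoidAlgebra ℂ M) : SIn S (res S a) := by
  classical
  intro m hm
  rw [res_coeff] at hm
  by_contra h
  simp [h] at hm

lemma SIn.mono {S S' : Set M} (h : S ⊆ S') {a : AddMonoidAlgebra ℂ M} (ha : SIn S a) : SIn S' a :=
  fun m hm => h (ha m hm)

lemma SIn.zero (S : Set M) : SIn S (0 : AddMonoidAlgebra ℂ M) := fun m hm => by simp at hm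

lemma SIn.add {S : Set M} {a b : AddMonoidAlgebra ℂ M} (ha : SIn S a) (hb : SIn S b) :
    SIn S (a + b) := by
  intro m hm
  by_contra h
  have h1 : a.coeff m = 0 := by by_contra h'; exact h (ha m h')
  have h2 : b.coeff m = 0 := by by_contra h'; exact h (hb m h')
  simp [h1, h2] at hm

lemma SIn.smul {S : Set M} {a : AddMonoidAlgebra ℂ M} (z : ℂ) (ha : SIn S a) :
    SIn S (z • a) := by
  intro m hm
  apply ha
  intro h
  simp [h] at hm

lemma SIn.sub {S : Set M} {a b : AddMonoidAlgebra ℂ M} (ha : SIn S a) (hb : SIn S b) :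
    SIn S (a - b) := by
  have : a - b = a + (-1 : ℂ) • b := by simp [sub_eq_add_neg]
  rw [this]; exact ha.add (hb.smul _)

lemma SIn.sum {S : Set M} {ι : Type*} {s : Finset ι} {a : ι → AddMonoidAlgebra ℂ M}
    (h : ∀ i ∈ s, SIn S (a i)) : SIn S (∑ i ∈ s, a i) := by
  classical
  induction s using Finset.induction_on with
  | empty => simpa using SIn.zero S
  | insert i s hi ih =>
    rw [Finset.sum_insert hi]
    exact (h i (by simp)).add (ih fun j hj => h j (by simp [hj]))

lemma mul_coeff_ne {a b : AddMonoidAlgebra ℂ M} {m : M} (h : (a * b).coeff m ≠ 0) :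
    ∃ x y, a.coeff x ≠ 0 ∧ b.coeff y ≠ 0 ∧ y + x = m := by
  classical
  by_contra hcon
  push Not at hcon
  apply h
  rw [AddMonoidAlgebra.coeff_mul]
  apply Finset.sum_eq_zero
  intro x hx
  apply Finset.sum_eq_zero
  intro y hy
  change (if x + y = m then a.coeff x * b.coeff y else 0) = 0
  rw [if_neg]
  intro hxy
  exact hcon x y (by simpa using hx) (by simpa using hy) (by rw [add_comm]; exact hxy)

lemma SIn.mul {S S' S'' : Set M} {a b : AddMonoidAlgebra ℂ M} (ha : SIn S a) (hb : SIn S' b)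
    (h : ∀ g ∈ S, ∀ m ∈ S', m + g ∈ S'') : SIn S'' (a * b) := by
  intro m hm
  obtain ⟨x, y, hx, hy, rfl⟩ := mul_coeff_ne hm
  exact h x (ha x hx) y (hb y hy)

lemma res_eq_self {S : Set M} {a : AddMonoidAlgebra ℂ M} (h : SIn S a) : res S a = a := by
  classical
  apply alg_ext; intro m
  rw [res_coeff]
  split_ifs with hm
  · rfl
  · by_contra h'; exact hm (h m (Ne.symm h'))

lemma res_eq_zero {S : Set M} {a : AddMonoidAlgebra ℂ M} (h : ∀ m, a.coeff m ≠ 0 → m ∉ S) :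
    res S a = 0 := by
  classical
  apply alg_ext; intro m
  rw [res_coeff]
  split_ifs with hm
  · by_contra h'; exact h m (by simpa using h') hm
  · simp

lemma res_res {S S' : Set M} (h : S ⊆ S') (a : AddMonoidAlgebra ℂ M) :
    res S (res S' a) = res S a := by
  classical
  apply alg_ext; intro m
  simp only [res_coeff]
  split_ifs with h1 h2 <;> try rfl
  exact absurd (h h1) h2

lemma sin_sub_res (S : Set M) (a : AddMonoidAlgebra ℂ M) :
    ∀ m, (a - res S a).coeff m ≠ 0 → a.coeff m ≠ 0 ∧ m ∉ S := by
  classical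
  intro m hm
  have : (a - res S a).coeff m = a.coeff m - (res S a).coeff m := by
    rw [AddMonoidAlgebra.coeff_sub]; rfl
  rw [this, res_coeff] at hm
  by_cases h : m ∈ S
  · simp [h] at hm
  · simp [h] at hm; exact ⟨hm, h⟩

/-- The key fact about truncated products. -/
lemma res_mul_res {S S' : Set M} {φ a : AddMonoidAlgebra ℂ M}
    (h : ∀ m, a.coeff m ≠ 0 → m ∉ S → ∀ g, φ.coeff g ≠ 0 → m + g ∉ S') :
    res S' (φ * res S a) = res S' (φ * a) := by
  have h1 : res S' (φ * (a - res S a)) = 0 := by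
    apply res_eq_zero
    intro m hm
    obtain ⟨x, y, hx, hy, rfl⟩ := mul_coeff_ne hm
    obtain ⟨h1, h2⟩ := sin_sub_res S a y hy
    exact h y h1 h2 x hx
  rw [mul_sub, res_sub, sub_eq_zero] at h1
  exact h1.symm

end Res

section Koszul
variable {M : Type*} [AddCommGroup M] {T : Type*} [LinearOrder T] [Fintype T]

/-- Koszul sign. -/
def sg (i : T) (I : Finset T) : ℂ := (-1) ^ (I.filter (· < i)).card

lemma sg_mul_self (i : T) (I : Finset T) : sg i I * sg i I = 1 := by
  simp [sg, ← pow_add, ← two_mul]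

lemma sg_insert_lt {i j : T} {I : Finset T} (hj : j ∉ I) (h : j < i) :
    sg i (insert j I) = - sg i I := by
  unfold sg
  rw [Finset.filter_insert, if_pos h, Finset.card_insert_of_notMem (by simp [hj]), pow_succ]
  ring

lemma sg_insert_not_lt {i j : T} {I : Finset T} (h : ¬ j < i) :
    sg i (insert j I) = sg i I := by
  unfold sg
  rw [Finset.filter_insert, if_neg h]

lemma sg_anti {i j : T} {I : Finset T} (hi : i ∉ I) (hj : j ∉ I) (hij : i ≠ j) :
    sg i I * sg j (insert i I) = - (sg j I * sg i (insert j I)) := by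
  rcases lt_or_gt_of_ne hij with h | h
  · rw [sg_insert_lt hi h, sg_insert_not_lt (not_lt.2 h.le)]; ring
  · rw [sg_insert_lt hj h, sg_insert_not_lt (not_lt.2 h.le)]; ring

variable (φ : T → AddMonoidAlgebra ℂ M)

/-- The Koszul differential. -/
noncomputable def kd (c : Finset T → AddMonoidAlgebra ℂ M) (I : Finset T) : AddMonoidAlgebra ℂ M :=
  ∑ i, if i ∈ I then 0 else sg i I • (φ i * c (insert i I))

/-- Restriction of a chain to a cube of exponents. -/
noncomputable def prB (B : Finset T → Set M) (c : Finset T → AddMonoidAlgebra ℂ M) :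
    Finset T → AddMonoidAlgebra ℂ M := fun I => res (B I) (c I)

/-- Chains supported in the cube `B`. -/
def InB (B : Finset T → Set M) (c : Finset T → AddMonoidAlgebra ℂ M) : Prop := ∀ I, SIn (B I) (c I)

/-- Homogeneous chains. -/
def Hom (p : ℕ) (c : Finset T → AddMonoidAlgebra ℂ M) : Prop := ∀ I, I.card ≠ p → c I = 0

/-- Truncated Koszul differential. -/
noncomputable def td (B : Finset T → Set M) (c : Finset T → AddMonoidAlgebra ℂ M) :
    Finset T → AddMonoidAlgebra ℂ M := prB B (kd φ c)

/-- Locally closed cubes. -/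
def LC (B : Finset T → Set M) : Prop :=
  ∀ I : Finset T, ∀ i j, i ∉ I → j ∉ I → i ≠ j → ∀ m ∈ B (insert j (insert i I)), ∀ g g' : M,
    (φ i).coeff g ≠ 0 → (φ j).coeff g' ≠ 0 → m + g' + g ∈ B I → m + g' ∈ B (insert i I)

/-- Relatively closed subcubes. -/
def Cl (B' B : Finset T → Set M) : Prop :=
  (∀ I, B' I ⊆ B I) ∧ ∀ I : Finset T, ∀ i, i ∉ I → ∀ m ∈ B' (insert i I), ∀ g : M,
    (φ i).coeff g ≠ 0 → m + g ∈ B I → m + g ∈ B' I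

/-- Exactness of the truncated Koszul complex in degree `p`. -/
def Ex (B : Finset T → Set M) (p : ℕ) : Prop :=
  ∀ c, InB B c → Hom p c → td φ B c = 0 → ∃ b, InB B b ∧ Hom (p + 1) b ∧ td φ B b = c

/-- Difference of cubes. -/
def dif (B B' : Finset T → Set M) : Finset T → Set M := fun I => B I \ B' I

lemma kd_add (c d : Finset T → AddMonoidAlgebra ℂ M) : kd φ (c + d) = kd φ c + kd φ d := by
  funext I
  simp only [kd, Pi.add_apply, ← Finset.sum_add_distrib]
  refine Finset.sum_congr rfl fun i _ => ?_
  split_ifs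
  · simp
  · rw [mul_add, smul_add]

lemma kd_smul (z : ℂ) (c : Finset T → AddMonoidAlgebra ℂ M) : kd φ (z • c) = z • kd φ c := by
  funext I
  simp only [kd, Pi.smul_apply, Finset.smul_sum]
  refine Finset.sum_congr rfl fun i _ => ?_
  split_ifs
  · simp
  · rw [mul_smul_comm, smul_comm]

/-- `kd` as a linear map. -/
noncomputable def kdL : (Finset T → AddMonoidAlgebra ℂ M) →ₗ[ℂ] (Finset T → AddMonoidAlgebra ℂ M) where
  toFun := kd φ
  map_add' := kd_add φ
  map_smul' := kd_smul φ

/-- `td` as a linear map. -/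
noncomputable def tdL (B : Finset T → Set M) :
    (Finset T → AddMonoidAlgebra ℂ M) →ₗ[ℂ] (Finset T → AddMonoidAlgebra ℂ M) where
  toFun := td φ B
  map_add' c d := by
    funext I; simp only [td, prB, kd_add, Pi.add_apply, res_add]
  map_smul' z c := by
    funext I; simp only [td, prB, kd_smul, Pi.smul_apply, res_smul, RingHom.id_apply]

lemma td_add (B : Finset T → Set M) (c d) : td φ B (c + d) = td φ B c + td φ B d :=
  (tdL φ B).map_add c d
lemma td_sub (B : Finset T → Set M) (c d) : td φ B (c - d) = td φ B c - td φ B d :=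
  (tdL φ B).map_sub c d
lemma td_zero (B : Finset T → Set M) : td φ B 0 = 0 := (tdL φ B).map_zero

lemma td_inB (B : Finset T → Set M) (c) : InB B (td φ B c) := fun _ => res_sin _ _

lemma kd_hom {p : ℕ} {c : Finset T → AddMonoidAlgebra ℂ M} (h : Hom (p + 1) c) : Hom p (kd φ c) := by
  intro I hI
  apply Finset.sum_eq_zero
  intro i _
  split_ifs with hi
  · rfl
  · rw [h (insert i I) (by rw [Finset.card_insert_of_notMem hi]; omega)]; simp

lemma prB_hom {p : ℕ} {B : Finset T → Set M} {c : Finset T → AddMonoidAlgebra ℂ M} (h : Hom p c) :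
    Hom p (prB B c) := by
  intro I hI
  simp only [prB, h I hI, res_zero]

lemma td_hom {p : ℕ} {B : Finset T → Set M} {c : Finset T → AddMonoidAlgebra ℂ M}
    (h : Hom (p + 1) c) : Hom p (td φ B c) := prB_hom (kd_hom φ h)

lemma Hom.add {p : ℕ} {c d : Finset T → AddMonoidAlgebra ℂ M} (h : Hom p c) (h' : Hom p d) :
    Hom p (c + d) := fun I hI => by simp [h I hI, h' I hI]

lemma Hom.sub {p : ℕ} {c d : Finset T → AddMonoidAlgebra ℂ M} (h : Hom p c) (h' : Hom p d) :
    Hom p (c - d) := fun I hI => by simp [h I hI, h' I hI]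

lemma InB.add {B : Finset T → Set M} {c d : Finset T → AddMonoidAlgebra ℂ M} (h : InB B c)
    (h' : InB B d) : InB B (c + d) := fun I => (h I).add (h' I)

lemma InB.sub {B : Finset T → Set M} {c d : Finset T → AddMonoidAlgebra ℂ M} (h : InB B c)
    (h' : InB B d) : InB B (c - d) := fun I => (h I).sub (h' I)

/-- Square of the truncated differential vanishes. -/
lemma td_td {B : Finset T → Set M} (hB : LC φ B) {c : Finset T → AddMonoidAlgebra ℂ M}
    (hc : InB B c) : td φ B (td φ B c) = 0 := by
  funext I
  set F : T → T → AddMonoidAlgebra ℂ M := fun i j =>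
    if i ∈ I then 0 else if j ∈ I then 0 else if i = j then 0 else
      (sg i I * sg j (insert i I)) • res (B I) (φ i * (φ j * c (insert j (insert i I)))) with hF
  have h1 : td φ B (td φ B c) I = ∑ i, ∑ j, F i j := by
    change res (B I) (kd φ (td φ B c) I) = _
    simp only [kd, res_sum]
    refine Finset.sum_congr rfl fun i _ => ?_
    by_cases hi : i ∈ I
    · simp [hi, hF, res_zero]
    · rw [if_neg hi]
      change res (B I) (sg i I • (φ i * res (B (insert i I)) (kd φ c (insert i I)))) = _
      simp only [kd, res_sum, Finset.mul_sum, Finset.smul_sum]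
      refine Finset.sum_congr rfl fun j _ => ?_
      by_cases hj : j ∈ I
      · simp [hj, hF, res_zero]
      by_cases hij : i = j
      · simp [hij, hF, res_zero]
      · have : j ∉ insert i I := by simp [hj, Ne.symm hij]
        rw [if_neg this]
        simp only [hF, hi, hj, hij, if_false]
        rw [res_smul, res_smul (B (insert i I)), mul_smul_comm, res_smul, smul_smul]
        congr 1
        apply res_mul_res
        intro m hm hmB g hg hmem
        obtain ⟨x, y, hx, hy, rfl⟩ := mul_coeff_ne hm
        exact hmB (hB I i j hi hj hij y (hc _ y hy) g x hg hx hmem)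
  have hanti : ∀ i j, F i j = - F j i := by
    intro i j
    simp only [hF]
    by_cases hi : i ∈ I
    · simp [hi]
    by_cases hj : j ∈ I
    · simp [hj]
    by_cases hij : i = j
    · simp [hij]
    · simp only [hi, hj, hij, Ne.symm hij, if_false]
      rw [sg_anti hi hj hij, neg_smul, Finset.insert_comm, mul_left_comm]
  have h2 : ∑ i, ∑ j, F i j = - ∑ i, ∑ j, F i j := by
    conv_rhs => rw [Finset.sum_comm]
    rw [← Finset.sum_neg_distrib]
    refine Finset.sum_congr rfl fun i _ => ?_
    rw [← Finset.sum_neg_distrib]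
    exact Finset.sum_congr rfl fun j _ => hanti i j
  rw [h1]
  have h3 : (2 : ℂ) • ∑ i, ∑ j, F i j = 0 := by
    rw [two_smul]; nth_rewrite 1 [h2]; simp
  simpa using h3

lemma prB_prB {B' B : Finset T → Set M} (h : ∀ I, B' I ⊆ B I) (c : Finset T → AddMonoidAlgebra ℂ M) :
    prB B' (prB B c) = prB B' c := funext fun I => res_res (h I) _

lemma prB_self {B : Finset T → Set M} {c : Finset T → AddMonoidAlgebra ℂ M} (h : InB B c) :
    prB B c = c := funext fun I => res_eq_self (h I)

lemma prB_inB (B : Finset T → Set M) (c : Finset T → AddMonoidAlgebra ℂ M) :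
    InB B (prB B c) := fun _ => res_sin _ _

lemma prB_add {B : Finset T → Set M} (c d : Finset T → AddMonoidAlgebra ℂ M) :
    prB B (c + d) = prB B c + prB B d := funext fun I => res_add _ _ _

lemma prB_sub {B : Finset T → Set M} (c d : Finset T → AddMonoidAlgebra ℂ M) :
    prB B (c - d) = prB B c - prB B d := funext fun I => res_sub _ _ _

lemma inB_sub_dif {B B' : Finset T → Set M} {c : Finset T → AddMonoidAlgebra ℂ M} (h : InB B c)
    (h0 : prB (dif B B') c = 0) : InB B' c := by
  classical
  intro I m hm
  by_contra hB'
  have h1 : (prB (dif B B') c I).coeff m = 0 := by rw [h0]; rfl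
  rw [prB, res_coeff, if_pos ⟨h I m hm, hB'⟩] at h1
  exact hm h1

lemma prB_dif_self {B B' : Finset T → Set M} {c : Finset T → AddMonoidAlgebra ℂ M} (h : InB B' c) :
    prB (dif B B') c = 0 :=
  funext fun I => res_eq_zero fun m hm hm' => hm'.2 (h I m hm)

lemma InB.mono {B B' : Finset T → Set M} (hB : ∀ I, B' I ⊆ B I)
    {c : Finset T → AddMonoidAlgebra ℂ M} (h : InB B' c) : InB B c := fun I => (h I).mono (hB I)

lemma dif_sub (B B' : Finset T → Set M) : ∀ I, dif B B' I ⊆ B I := fun _ _ h => h.1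

/-- on a relatively closed subcube the truncated differentials agree -/
lemma td_eq_of_cl {B B' : Finset T → Set M} (h : Cl φ B' B) {c : Finset T → AddMonoidAlgebra ℂ M}
    (hc : InB B' c) : td φ B c = td φ B' c := by
  have h1 : InB B' (td φ B c) := by
    intro I m hm
    have hB := res_sin (B I) _ m hm
    classical
    have hm' : (kd φ c I).coeff m ≠ 0 := by
      intro h0
      apply hm
      change (res (B I) (kd φ c I)).coeff m = 0
      rw [res_coeff, if_pos hB, h0]
    have : SIn {m | m ∈ B I → m ∈ B' I} (kd φ c I) := by
      apply SIn.sum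
      intro i _
      split_ifs with hi
      · exact SIn.zero _
      · apply SIn.smul
        intro m hm
        obtain ⟨x, y, hx, hy, rfl⟩ := mul_coeff_ne hm
        exact h.2 I i hi y (hc _ y hy) x hx
    exact this m hm' hB
  rw [← prB_self h1]
  exact prB_prB h.1 _

/-- the quotient differential kills the relatively closed part -/
lemma td_dif {B B' : Finset T → Set M} (h : Cl φ B' B) {c : Finset T → AddMonoidAlgebra ℂ M}
    (hc : InB B c) : td φ (dif B B') (prB (dif B B') c) = prB (dif B B') (td φ B c) := by
  have h0 : InB B' (c - prB (dif B B') c) := by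
    apply inB_sub_dif (B := B) (hc.sub ((prB_inB _ _).mono (dif_sub B B')))
    rw [prB_sub, prB_prB (fun _ => subset_rfl), sub_self]
  have h1 : prB (dif B B') (td φ B (c - prB (dif B B') c)) = 0 := by
    rw [td_eq_of_cl φ h h0]
    exact prB_dif_self (td_inB φ _ _)
  rw [td_sub, prB_sub, sub_eq_zero] at h1
  rw [h1]
  exact (prB_prB (dif_sub B B') _).symm

lemma les1 {B B' : Finset T → Set M} (hB : LC φ B) (h : Cl φ B' B) {p : ℕ}
    (hE : Ex φ (dif B B') (p + 1)) {c b : Finset T → AddMonoidAlgebra ℂ M}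
    (hc : InB B' c) (hb : InB B b) (hb' : Hom (p + 1) b) (hcb : td φ B b = c) :
    ∃ b', InB B' b' ∧ Hom (p + 1) b' ∧ td φ B' b' = c := by
  obtain ⟨e, he, he', hed⟩ := hE (prB (dif B B') b) (prB_inB _ _) (prB_hom hb') (by
    rw [td_dif φ h hb, hcb]; exact prB_dif_self hc)
  have heB : InB B e := he.mono (dif_sub B B')
  have hin : InB B' (b - td φ B e) := by
    apply inB_sub_dif (B := B) (hb.sub (td_inB φ _ _))
    rw [prB_sub, ← td_dif φ h heB, prB_self he, hed, sub_self]
  refine ⟨b - td φ B e, hin, hb'.sub (td_hom φ he'), ?_⟩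
  rw [← td_eq_of_cl φ h hin, td_sub, td_td φ hB heB, hcb, sub_zero]

lemma ext_ex {B B' : Finset T → Set M} (hB : LC φ B) (h : Cl φ B' B) {p : ℕ}
    (hE' : Ex φ B' p) (hE : Ex φ (dif B B') p) : Ex φ B p := by
  intro c hc hcp hcz
  obtain ⟨e, he, he', hed⟩ := hE (prB (dif B B') c) (prB_inB _ _) (prB_hom hcp) (by
    rw [td_dif φ h hc, hcz]; funext I; exact res_zero _)
  have heB : InB B e := he.mono (dif_sub B B')
  have hin : InB B' (c - td φ B e) := by
    apply inB_sub_dif (B := B) (hc.sub (td_inB φ _ _))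
    rw [prB_sub, ← td_dif φ h heB, prB_self he, hed, sub_self]
  obtain ⟨e2, he2, he2', hed2⟩ := hE' _ hin (hcp.sub (td_hom φ he')) (by
    rw [← td_eq_of_cl φ h hin, td_sub, td_td φ hB heB, hcz, sub_zero])
  refine ⟨e2 + e, (he2.mono h.1).add heB, he2'.add he', ?_⟩
  rw [td_add, td_eq_of_cl φ h he2, hed2, sub_add_cancel]

lemma mix_ex {B B' : Finset T → Set M} (hB : LC φ B) (h : Cl φ B' B) {p : ℕ}
    (hE' : Ex φ B p) (hE : Ex φ (dif B B') (p + 1)) : Ex φ B' p := by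
  intro c hc hcp hcz
  obtain ⟨b, hb, hb', hbd⟩ := hE' c (hc.mono h.1) hcp (by rw [td_eq_of_cl φ h hc, hcz])
  exact les1 φ hB h hE hc hb hb' hbd

end Koszul

end Kz
end ToricNewton

set_option linter.all false
set_option linter.unusedSectionVars false
set_option linter.unusedVariables false
namespace ToricNewton
namespace Kz

open Finset

section Homotopy
variable {M : Type*} [AddCommGroup M] {T : Type*} [LinearOrder T] [Fintype T]
variable (φ : T → AddMonoidAlgebra ℂ M)

/-- Exterior multiplication by the `i`-th generator. -/
noncomputable def hh (i : T) (c : Finset T → AddMonoidAlgebra ℂ M) (I : Finset T) :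
    AddMonoidAlgebra ℂ M :=
  if i ∈ I then sg i (I.erase i) • c (I.erase i) else 0

lemma kd_hh (i : T) (c : Finset T → AddMonoidAlgebra ℂ M) (I : Finset T) :
    kd φ (hh i c) I = φ i * c I - hh i (kd φ c) I := by
  by_cases hi : i ∈ I
  · obtain ⟨K, hK, rfl⟩ : ∃ K, i ∉ K ∧ insert i K = I :=
      ⟨I.erase i, Finset.notMem_erase i I, Finset.insert_erase hi⟩
    have h1 : hh i (kd φ c) (insert i K) = sg i K • kd φ c K := by
      simp [hh, Finset.erase_insert hK]
    rw [h1, eq_sub_iff_add_eq]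
    simp only [kd, Finset.smul_sum, ← Finset.sum_add_distrib]
    rw [Finset.sum_eq_single i]
    · simp only [Finset.mem_insert_self, if_true, hK, if_false, smul_smul, sg_mul_self, one_smul,
        zero_add]
    · intro j _ hj
      by_cases hjK : j ∈ K
      · simp [hjK]
      · have h2 : j ∉ insert i K := by simp [hj, hjK]
        rw [if_neg h2, if_neg hjK]
        have h3 : hh i c (insert j (insert i K)) = sg i (insert j K) • c (insert j K) := by
          have h4 : (insert j (insert i K)).erase i = insert j K := by
            rw [Finset.insert_comm, Finset.erase_insert (by simp [Ne.symm hj, hK])]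
          simp [hh, h4]
        rw [h3, mul_smul_comm, smul_smul, smul_smul, ← add_smul]
        have h5 : sg j (insert i K) * sg i (insert j K) + sg i K * sg j K = 0 := by
          have h6 := sg_anti hK hjK (Ne.symm hj)
          have h7 := sg_mul_self i K
          have h8 := sg_mul_self i (insert j K)
          calc sg j (insert i K) * sg i (insert j K) + sg i K * sg j K
              = (sg i K * sg i K) * (sg j (insert i K) * sg i (insert j K)) + sg i K * sg j K := by
                rw [h7, one_mul]
            _ = sg i K * sg i (insert j K) * (sg i K * sg j (insert i K)) + sg i K * sg j K := by
                ring
            _ = - (sg i K * sg j K) * (sg i (insert j K) * sg i (insert j K))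
                  + sg i K * sg j K := by rw [h6]; ring
            _ = 0 := by rw [h8]; ring
        rw [h5, zero_smul]
    · simp
  · have h1 : hh i (kd φ c) I = 0 := by simp [hh, hi]
    rw [h1, sub_zero]
    simp only [kd]
    rw [Finset.sum_eq_single i]
    · simp [hi, hh, smul_smul, sg_mul_self]
    · intro j _ hj
      by_cases hjI : j ∈ I
      · simp [hjI]
      · have : i ∉ insert j I := by simp [hi, Ne.symm hj]
        simp [hh, this]
    · simp

lemma kd_mul (a : AddMonoidAlgebra ℂ M) (c : Finset T → AddMonoidAlgebra ℂ M) (I : Finset T) :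
    kd φ (fun I => a * c I) I = a * kd φ c I := by
  simp only [kd, Finset.mul_sum]
  refine Finset.sum_congr rfl fun i _ => ?_
  split_ifs
  · simp
  · rw [mul_smul_comm, mul_left_comm]

lemma kd_sum {ι : Type*} (s : Finset ι) (c : ι → Finset T → AddMonoidAlgebra ℂ M) (I : Finset T) :
    kd φ (fun I => ∑ i ∈ s, c i I) I = ∑ i ∈ s, kd φ (c i) I := by
  have : (fun I => ∑ i ∈ s, c i I) = ∑ i ∈ s, c i := by funext I; simp
  rw [this]
  have h2 := congrFun (map_sum (kdL φ) c s) I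
  rw [Finset.sum_apply] at h2
  exact h2

lemma SIn.kd {S : Set M} {c : Finset T → AddMonoidAlgebra ℂ M} {I : Finset T}
    (h : ∀ i, i ∉ I → SIn S (φ i * c (insert i I))) : SIn S (kd φ c I) := by
  apply SIn.sum
  intro i _
  split_ifs with hi
  · exact SIn.zero _
  · exact (h i hi).smul _

/-- The cube which is `D` on subsets of `T'`, and empty elsewhere. -/
def cube (T' : Finset T) (D : Set M) : Finset T → Set M := fun I => {m | I ⊆ T' ∧ m ∈ D}

lemma single_mul_coeff (w : M) (a : AddMonoidAlgebra ℂ M) (m : M) :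
    (AddMonoidAlgebra.single w (1 : ℂ) * a).coeff m = a.coeff (m - w) := by
  rw [AddMonoidAlgebra.coeff_single_mul_eq_mul_coeff (m₂ := m - w)]
  · simp
  · intro m' _
    constructor
    · rintro rfl; simp
    · rintro rfl; simp

lemma single_mul_inj {w : M} {a b : AddMonoidAlgebra ℂ M}
    (h : AddMonoidAlgebra.single w (1 : ℂ) * a = AddMonoidAlgebra.single w (1 : ℂ) * b) : a = b := by
  apply alg_ext; intro m
  have := congrArg (fun x => x.coeff (m + w)) h
  simpa [single_mul_coeff] using this

lemma res_single_mul (S : Set M) (w : M) (a : AddMonoidAlgebra ℂ M) :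
    res {m | m - w ∈ S} (AddMonoidAlgebra.single w (1 : ℂ) * a)
      = AddMonoidAlgebra.single w (1 : ℂ) * res S a := by
  classical
  apply alg_ext; intro m
  simp only [res_coeff, single_mul_coeff, Set.mem_setOf_eq]

end Homotopy

section Sweep
variable {M : Type*} [AddCommGroup M] {T : Type*} [LinearOrder T] [Fintype T]
variable {V : Type*} [AddCommGroup V] [Module ℝ V] {J : Type*} [Fintype J] [DecidableEq J]

/-- Data for the sweep argument: cone given by functionals `u`. -/
structure SweepData (φ : T → AddMonoidAlgebra ℂ M) (ρ : M →+ V) (u : J → V →ₗ[ℝ] ℝ) : Prop where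
  hZval : ∀ j m, ∃ z : ℤ, u j (ρ m) = z
  hpt : ∀ x, (∀ j, u j x = 0) → x = 0
  hφ : ∀ i g, (φ i).coeff g ≠ 0 → ∀ j, 0 ≤ u j (ρ g)
  hGen : ∀ x, (∀ j, 0 ≤ u j x) → ∃ (s : Finset M) (lam : M → ℝ),
    (∀ m ∈ s, 0 ≤ lam m ∧ ∀ j, 0 ≤ u j (ρ m)) ∧ x = ∑ m ∈ s, lam m • ρ m
  hnil : ∀ w, (∀ j, 0 ≤ u j (ρ w)) → (∃ j, 0 < u j (ρ w)) → ∃ k : ℕ, 1 ≤ k ∧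
    ∃ a : T → AddMonoidAlgebra ℂ M, (∀ i, SIn {m | ∀ j, 0 ≤ u j (ρ m)} (a i)) ∧
      AddMonoidAlgebra.single (k • w) (1 : ℂ) = ∑ i, a i * φ i

variable {φ : T → AddMonoidAlgebra ℂ M} {ρ : M →+ V} {u : J → V →ₗ[ℝ] ℝ}

/-- Translated faces of the cone. -/
def DD (ρ : M →+ V) (u : J → V →ₗ[ℝ] ℝ) (v : V) (E : Finset J) : Set M :=
  {m | ∀ j, u j v ≤ u j (ρ m) ∧ (j ∈ E → u j (ρ m) = u j v)}

lemma lc_cube {T' : Finset T} {D : Set M} (hφ : ∀ i g, (φ i).coeff g ≠ 0 → ∀ j, 0 ≤ u j (ρ g))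
    (hD : ∀ m g g' : M, (∀ j, 0 ≤ u j (ρ g)) → (∀ j, 0 ≤ u j (ρ g')) → m ∈ D → m + g' + g ∈ D →
      m + g' ∈ D) : LC φ (cube T' D) := by
  intro I i j hi hj hij m hm g g' hg hg' h
  exact ⟨(Finset.subset_insert _ _).trans hm.1, hD m g g' (hφ i g hg) (hφ j g' hg') hm.2 h.2⟩

lemma DD_convex (v : V) (E : Finset J) (m g g' : M) (hg : ∀ j, 0 ≤ u j (ρ g))
    (hg' : ∀ j, 0 ≤ u j (ρ g')) (hm : m ∈ DD ρ u v E) (h : m + g' + g ∈ DD ρ u v E) :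
    m + g' ∈ DD ρ u v E := by
  intro j
  have h1 := hm j
  have h2 := h j
  have h3 := hg j
  have h4 := hg' j
  simp only [map_add] at h2 ⊢
  refine ⟨by linarith, fun hj => ?_⟩
  have := h1.2 hj
  have := h2.2 hj
  linarith

/-- Nilpotence on cycles. -/
lemma mul_boundary (hS : SweepData φ ρ u) {T' : Finset T} {E0 E : Finset J} (hE : E0 ⊆ E)
    (hE0 : ∀ i, i ∉ T' → ∀ g, (φ i).coeff g ≠ 0 → ∃ j ∈ E0, 0 < u j (ρ g))
    {w : M} (hw : ∀ j, 0 ≤ u j (ρ w)) (hwE : ∀ j ∈ E, u j (ρ w) = 0)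
    {a : T → AddMonoidAlgebra ℂ M} (ha : ∀ i, SIn {m | ∀ j, 0 ≤ u j (ρ m)} (a i))
    (haw : AddMonoidAlgebra.single w (1 : ℂ) = ∑ i, a i * φ i) (v : V) {p : ℕ}
    {c : Finset T → AddMonoidAlgebra ℂ M} (hc : InB (cube T' (DD ρ u v E)) c) (hcp : Hom p c)
    (hcz : td φ (cube T' (DD ρ u v E)) c = 0) :
    ∃ b, InB (cube T' (DD ρ u v E)) b ∧ Hom (p + 1) b ∧
      td φ (cube T' (DD ρ u v E)) b = fun I => AddMonoidAlgebra.single w (1 : ℂ) * c I := by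
  classical
  set B := cube T' (DD ρ u v E) with hB
  set U : Set M := {m | ∀ j, u j v ≤ u j (ρ m)} with hU
  set O : Set M := {m | (∀ j, u j v ≤ u j (ρ m)) ∧ ∃ j ∈ E, u j v < u j (ρ m)} with hO
  have hUO : ∀ m ∈ U, m ∉ DD ρ u v E → m ∈ O := by
    intro m hm hD
    refine ⟨hm, ?_⟩
    by_contra hcon
    push Not at hcon
    exact hD fun j => ⟨hm j, fun hj => le_antisymm (hcon j hj) (hm j)⟩
  have hOD : ∀ m ∈ O, m ∉ DD ρ u v E := by
    rintro m ⟨_, j, hj, hlt⟩ hD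
    exact hlt.ne' ((hD j).2 hj)
  have hOadd : ∀ g, (∀ j, 0 ≤ u j (ρ g)) → ∀ m ∈ O, m + g ∈ O := by
    rintro g hg m ⟨hm, j, hj, hlt⟩
    refine ⟨fun j => ?_, j, hj, ?_⟩
    · have := hm j; have := hg j; simp only [map_add]; linarith
    · have := hg j; simp only [map_add]; linarith
  have hUadd : ∀ g, (∀ j, 0 ≤ u j (ρ g)) → ∀ m ∈ U, m + g ∈ U := by
    intro g hg m hm j
    have := hm j; have := hg j; simp only [map_add]; linarith
  have hDU : ∀ m ∈ DD ρ u v E, m ∈ U := fun m hm j => (hm j).1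
  have hφC : ∀ i, SIn {g | ∀ j, 0 ≤ u j (ρ g)} (φ i) := fun i g hg => hS.hφ i g hg
  have hcU : ∀ I, SIn U (c I) := fun I m hm => hDU m (hc I m hm).2
  have hc0 : ∀ I, ¬ I ⊆ T' → c I = 0 := by
    intro I hI
    apply alg_ext; intro m
    by_contra h
    exact hI (hc I m (by simpa using h)).1
  -- kd c is in O on subsets of T'
  have hkdO : ∀ I, I ⊆ T' → SIn O (kd φ c I) := by
    intro I hI m hm
    have hmU : m ∈ U := by
      refine SIn.kd (S := U) φ (fun i hi => ?_) m hm
      exact (hφC i).mul (hcU _) fun g hg m hm => hUadd g hg m hm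
    apply hUO m hmU
    intro hD
    have h1 : (td φ B c I).coeff m = 0 := by rw [hcz]; rfl
    change (res (B I) (kd φ c I)).coeff m = 0 at h1
    have hmB : m ∈ B I := ⟨hI, hD⟩
    rw [res_coeff, if_pos hmB] at h1
    exact hm h1
  set e : Finset T → AddMonoidAlgebra ℂ M := fun I => ∑ i ∈ T', a i * hh i c I with he
  have heU : ∀ I, SIn U (e I) := by
    intro I
    apply SIn.sum
    intro i _
    refine (ha i).mul (S' := U) ?_ fun g hg m hm => hUadd g hg m hm
    unfold hh
    split_ifs
    · exact (hcU _).smul _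
    · exact SIn.zero _
  have he0 : ∀ I, ¬ I ⊆ T' → e I = 0 := by
    intro I hI
    apply Finset.sum_eq_zero
    intro i hi
    unfold hh
    split_ifs with hiI
    · rw [hc0]
      · simp
      · intro h
        apply hI
        intro x hx
        by_cases hxi : x = i
        · rwa [hxi]
        · exact h (Finset.mem_erase.2 ⟨hxi, hx⟩)
    · simp
  have hehom : Hom (p + 1) e := by
    intro I hI
    apply Finset.sum_eq_zero
    intro i hi
    unfold hh
    split_ifs with hiI
    · rw [hcp]
      · simp
      · rw [Finset.card_erase_of_mem hiI]
        have := Finset.card_pos.2 ⟨i, hiI⟩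
        omega
    · simp
  refine ⟨prB B e, prB_inB _ _, prB_hom hehom, ?_⟩
  funext I
  have step1 : td φ B (prB B e) I = res (B I) (kd φ e I) := by
    change res (B I) (kd φ (prB B e) I) = _
    simp only [kd, res_sum]
    refine Finset.sum_congr rfl fun j _ => ?_
    split_ifs with hj
    · rfl
    · rw [res_smul, res_smul]
      congr 1
      apply res_mul_res
      intro m hm hmB g hg hmem
      have hT' : insert j I ⊆ T' := by
        by_contra hcon
        rw [he0 _ hcon] at hm
        exact hm rfl
      have hmO : m ∈ O := hUO m (heU _ m hm) fun hD => hmB ⟨hT', hD⟩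
      exact hOD _ (hOadd g (hS.hφ j g hg) m hmO) hmem.2
  rw [step1]
  by_cases hI : I ⊆ T'
  · have step2 : kd φ e I = ∑ i ∈ T', (a i * φ i * c I - a i * hh i (kd φ c) I) := by
      rw [he, kd_sum]
      refine Finset.sum_congr rfl fun i _ => ?_
      rw [kd_mul, kd_hh, mul_sub, mul_assoc]
    have step3 : kd φ e I = AddMonoidAlgebra.single w (1 : ℂ) * c I
        - (∑ i ∈ T'ᶜ, a i * φ i * c I + ∑ i ∈ T', a i * hh i (kd φ c) I) := by
      rw [step2, haw, Finset.sum_sub_distrib, Finset.sum_mul, ← Finset.sum_add_sum_compl T']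
      abel
    have hO1 : SIn O (∑ i ∈ T'ᶜ, a i * φ i * c I + ∑ i ∈ T', a i * hh i (kd φ c) I) := by
      apply SIn.add
      · apply SIn.sum
        intro i hi
        rw [mul_assoc]
        refine (ha i).mul (S' := O) ?_ fun g hg m hm => hOadd g hg m hm
        intro m hm
        obtain ⟨g, y, hg, hy, rfl⟩ := mul_coeff_ne hm
        refine ⟨hUadd g (hS.hφ i g hg) y (hcU I y hy), ?_⟩
        obtain ⟨j, hj, hlt⟩ := hE0 i (by simpa using hi) g hg
        refine ⟨j, hE hj, ?_⟩
        have := hcU I y hy j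
        simp only [map_add]; linarith
      · apply SIn.sum
        intro i hi
        refine (ha i).mul (S' := O) ?_ fun g hg m hm => hOadd g hg m hm
        unfold hh
        split_ifs
        · exact (hkdO _ ((Finset.erase_subset _ _).trans hI)).smul _
        · exact SIn.zero _
    have hD1 : SIn (B I) (AddMonoidAlgebra.single w (1 : ℂ) * c I) := by
      intro m hm
      rw [single_mul_coeff] at hm
      refine ⟨hI, fun j => ?_⟩
      have h1 := (hc I _ hm).2 j
      simp only [map_sub] at h1
      refine ⟨by have := hw j; linarith, fun hj => ?_⟩
      have := hwE j hj
      have := h1.2 hj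
      linarith
    rw [step3, res_sub, res_eq_self hD1, res_eq_zero (fun m hm hm' => hOD m (hO1 m hm) hm'.2),
      sub_zero]
  · rw [hc0 I hI, mul_zero]
    exact res_eq_zero fun m _ hm => hI hm.1

end Sweep

end Kz
end ToricNewton

set_option linter.all false
set_option linter.unusedSectionVars false
set_option linter.unusedVariables false
namespace ToricNewton
namespace Kz

open Finset

section Sweep2
variable {M : Type*} [AddCommGroup M] {T : Type*} [LinearOrder T] [Fintype T]
variable {V : Type*} [AddCommGroup V] [Module ℝ V] {J : Type*} [Fintype J] [DecidableEq J]
variable {φ : T → AddMonoidAlgebra ℂ M} {ρ : M →+ V} {u : J → V →ₗ[ℝ] ℝ}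

/-- The common kernel of the functionals in `E`. -/
def VE (u : J → V →ₗ[ℝ] ℝ) (E : Finset J) : Submodule ℝ V := ⨅ j ∈ E, LinearMap.ker (u j)

lemma mem_VE {E : Finset J} {x : V} : x ∈ VE u E ↔ ∀ j ∈ E, u j x = 0 := by
  simp [VE, Submodule.mem_iInf]

lemma gen_exists (hZval : ∀ j m, ∃ z : ℤ, u j (ρ m) = z) {E : Finset J} {w : V}
    (hwE : ∀ j ∈ E, u j w = 0) (hw : ∀ j, j ∉ E → 0 < u j w) (v : V) :
    ∃ v', DD ρ u v' E = DD ρ u v E ∧ ∀ i j, i ∉ E → j ∉ E →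
      (∃ x ∈ VE u E, u j w * u i x ≠ u i w * u j x) → ∀ (t : ℝ) (a b : ℤ),
        ¬ (u i (v' + t • w) = a ∧ u j (v' + t • w) = b) := by
  classical
  set P : Type _ := {q : J × J // ∃ x ∈ VE u E, u q.2 w * u q.1 x ≠ u q.1 w * u q.2 x} with hP
  set ell : J × J → V →ₗ[ℝ] ℝ := fun q => u q.2 w • u q.1 - u q.1 w • u q.2 with hell
  have hellv : ∀ q x, ell q x = u q.2 w * u q.1 x - u q.1 w * u q.2 x := by
    intro q x; simp [hell]
  obtain ⟨z', hz'E, hz'⟩ := Module.Dual.exists_forall_mem_ne_zero_of_forall_exists (VE u E)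
    (fun q : P => (ell q.1 : Module.Dual ℝ V)) (by
      rintro ⟨q, x, hx, hne⟩
      exact ⟨x, hx, by rw [hellv]; exact sub_ne_zero.2 hne⟩)
  obtain ⟨R, hR⟩ : ∃ R : ℝ, ∀ j, j ∉ E → 0 < R * u j w + u j z' := by
    refine ⟨∑ j ∈ Eᶜ, (|u j z'| / u j w + 1), fun j hj => ?_⟩
    have hpos := hw j hj
    have h1 : |u j z'| / u j w + 1 ≤ ∑ j ∈ Eᶜ, (|u j z'| / u j w + 1) := by
      apply Finset.single_le_sum (f := fun j => |u j z'| / u j w + 1) (fun i hi => ?_) (by simpa using hj)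
      have := hw i (by simpa using hi)
      positivity
    have h2 : (|u j z'| / u j w + 1) * u j w ≤ (∑ j ∈ Eᶜ, (|u j z'| / u j w + 1)) * u j w :=
      mul_le_mul_of_nonneg_right h1 hpos.le
    have h3 : (|u j z'| / u j w + 1) * u j w = |u j z'| + u j w := by field_simp
    have h4 := neg_abs_le (u j z')
    linarith
  set z : V := R • w + z' with hz
  have hzE : ∀ j ∈ E, u j z = 0 := by
    intro j hj
    simp [hz, hwE j hj, mem_VE.1 hz'E j hj]
  have hzpos : ∀ j, j ∉ E → 0 < u j z := by
    intro j hj; simpa [hz] using hR j hj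
  have hzell : ∀ q : P, ell q.1 z ≠ 0 := by
    intro q
    have h1 := hz' q
    have h2 : ell q.1 z = ell q.1 z' := by
      simp only [hellv, hz, map_add, map_smul, smul_eq_mul]; ring
    rw [h2]; exact h1
  -- small epsilon
  have hev : ∀ᶠ ε in nhdsWithin (0 : ℝ) (Set.Ioi 0), ∀ j, ε * u j z < u j v - ⌈u j v⌉ + 1 := by
    rw [Filter.eventually_all]
    intro j
    have h1 : Filter.Tendsto (fun ε : ℝ => ε * u j z) (nhdsWithin 0 (Set.Ioi 0)) (nhds 0) := by
      have : Filter.Tendsto (fun ε : ℝ => ε * u j z) (nhds 0) (nhds (0 * u j z)) :=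
        (continuous_id.mul continuous_const).tendsto 0
      rw [zero_mul] at this
      exact this.mono_left nhdsWithin_le_nhds
    apply h1.eventually_lt_const
    have := Int.ceil_lt_add_one (u j v)
    linarith
  obtain ⟨ε0, hε0, hsub⟩ := mem_nhdsGT_iff_exists_Ioo_subset.1 hev
  set bad : Set ℝ := ⋃ q : P × ℤ × ℤ,
    {(ell q.1.1 v - (u q.1.1.2 w * q.2.1 - u q.1.1.1 w * q.2.2)) / ell q.1.1 z} with hbad
  have hbadc : bad.Countable := Set.countable_iUnion fun q => Set.countable_singleton _
  obtain ⟨ε, hε, hεb⟩ : ∃ ε ∈ Set.Ioo 0 ε0, ε ∉ bad := by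
    by_contra hcon
    push Not at hcon
    have : (Set.Ioo 0 ε0).Countable := hbadc.mono hcon
    rw [← Cardinal.le_aleph0_iff_set_countable, Cardinal.mk_Ioo_real hε0] at this
    exact absurd Cardinal.aleph0_lt_continuum (not_lt.2 this)
  have hεj := hsub hε
  refine ⟨v - ε • z, ?_, ?_⟩
  · ext m
    refine forall_congr' fun j => ?_
    obtain ⟨n, hn⟩ := hZval j m
    by_cases hj : j ∈ E
    · simp [hzE j hj]
    · simp only [hj, false_imp_iff, and_true, map_sub, map_smul, smul_eq_mul, hn]
      constructor
      · intro h
        have h1 := hεj j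
        have h2 : (⌈u j v⌉ - 1 : ℤ) < n := by
          have : ((⌈u j v⌉ - 1 : ℤ) : ℝ) < n := by push_cast; linarith
          exact_mod_cast this
        have h3 : ⌈u j v⌉ ≤ n := by omega
        exact (Int.le_ceil _).trans (by exact_mod_cast h3)
      · intro h
        have := mul_pos hε.1 (hzpos j hj)
        linarith
  · rintro i j hi hj hx t a b ⟨h1, h2⟩
    apply hεb
    rw [hbad, Set.mem_iUnion]
    refine ⟨(⟨(i, j), hx⟩, a, b), ?_⟩
    rw [Set.mem_singleton_iff, eq_div_iff (hzell ⟨(i, j), hx⟩)]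
    simp only [map_add, map_sub, map_smul, smul_eq_mul] at h1 h2
    simp only [hellv]
    rw [← h1, ← h2]
    ring

variable [FiniteDimensional ℝ V]

lemma finrank_inf_ker_le (W : Submodule ℝ V) (f : V →ₗ[ℝ] ℝ) :
    Module.finrank ℝ W ≤ Module.finrank ℝ (W ⊓ LinearMap.ker f : Submodule ℝ V) + 1 := by
  have h1 := Submodule.finrank_sup_add_finrank_inf_eq W (LinearMap.ker f)
  have h2 : Module.finrank ℝ (W ⊔ LinearMap.ker f : Submodule ℝ V) ≤ Module.finrank ℝ V :=
    Submodule.finrank_le _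
  have h3 := LinearMap.finrank_range_add_finrank_ker f
  have h4 : Module.finrank ℝ (LinearMap.range f) ≤ 1 := by
    have := Submodule.finrank_le (LinearMap.range f)
    simpa using this
  omega

lemma ex_of_empty {B : Finset T → Set M} {p : ℕ} (h : ∀ I, I.card = p → B I = ∅) : Ex φ B p := by
  intro c hc hcp _
  have : c = 0 := by
    funext I
    by_cases hI : I.card = p
    · apply alg_ext; intro m
      by_contra hne
      have := hc I m (by simpa using hne)
      rw [h I hI] at this
      exact this
    · exact hcp I hI
  subst this
  exact ⟨0, fun I => SIn.zero _, fun I _ => rfl, td_zero φ B⟩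

/-- One jump of the sweep. -/
lemma jump_face (hS : SweepData φ ρ u) {E : Finset J} {w : V} (hw : ∀ j, j ∉ E → 0 < u j w) (v : V)
    (hgen : ∀ i j, i ∉ E → j ∉ E →
      (∃ x ∈ VE u E, u j w * u i x ≠ u i w * u j x) → ∀ (a b : ℤ),
        ¬ (u i v = a ∧ u j v = b)) {m0 : M} (hm0 : m0 ∈ DD ρ u v E) {j0 : J} (hj0 : j0 ∉ E)
    (hm0j : u j0 (ρ m0) = u j0 v) :
    ∃ E' : Finset J, E ⊂ E' ∧ (∃ y : M, (∀ j ∈ E', u j (ρ y) = 0) ∧ ∀ j, j ∉ E' → 0 < u j (ρ y)) ∧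
      Module.finrank ℝ (VE u E) ≤ Module.finrank ℝ (VE u E') + 1 ∧
      {m | m ∈ DD ρ u v E ∧ ∃ j, j ∉ E ∧ u j (ρ m) = u j v} = DD ρ u v E' := by
  classical
  set x0 : V := ρ m0 - v with hx0
  have hx0nn : ∀ j, 0 ≤ u j x0 := fun j => by rw [hx0, map_sub]; linarith [(hm0 j).1]
  have hprop : ∀ m ∈ DD ρ u v E, ∀ i, i ∉ E → u i (ρ m) = u i v →
      ∀ m' ∈ DD ρ u v E, ∀ j, j ∉ E → u j (ρ m') = u j v →
      ∀ x ∈ VE u E, u j w * u i x = u i w * u j x := by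
    intro m hm i hi hmi m' hm' j hj hmj x hx
    by_contra hne
    obtain ⟨a, ha⟩ := hS.hZval i m
    obtain ⟨b, hb⟩ := hS.hZval j m'
    exact hgen i j hi hj ⟨x, hx, hne⟩ a b ⟨by rw [← hmi, ha], by rw [← hmj, hb]⟩
  have hdiff : ∀ m ∈ DD ρ u v E, ρ m - v ∈ VE u E := by
    intro m hm
    rw [mem_VE]
    intro j hj
    rw [map_sub, (hm j).2 hj, sub_self]
  set E' : Finset J := Finset.univ.filter (fun i => u i x0 = 0) with hE'
  have memE' : ∀ i, i ∈ E' ↔ u i (ρ m0) = u i v := by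
    intro i; simp [hE', hx0, sub_eq_zero]
  have hEE' : E ⊆ E' := fun i hi => (memE' i).2 ((hm0 i).2 hi)
  have hE'ker : ∀ x ∈ VE u E, u j0 x = 0 → ∀ i ∈ E', u i x = 0 := by
    intro x hx hxj i hi
    by_cases hiE : i ∈ E
    · exact mem_VE.1 hx i hiE
    · have := hprop m0 hm0 i hiE ((memE' i).1 hi) m0 hm0 j0 hj0 hm0j x hx
      rw [hxj, mul_zero] at this
      exact (mul_eq_zero.1 this).resolve_left (hw j0 hj0).ne'
  refine ⟨E', ⟨hEE', fun h => hj0 (h ((memE' j0).2 hm0j))⟩, ?_, ?_, ?_⟩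
  · obtain ⟨s, lam, hs, hsum⟩ := hS.hGen x0 hx0nn
    refine ⟨∑ m ∈ s.filter (fun m => 0 < lam m), m, ?_, ?_⟩
    · intro j hj
      have h1 : ∑ m ∈ s, lam m * u j (ρ m) = 0 := by
        have : u j x0 = 0 := by simpa [hE'] using hj
        rw [hsum] at this
        simpa using this
      rw [Finset.sum_eq_zero_iff_of_nonneg (fun m hm => mul_nonneg (hs m hm).1 ((hs m hm).2 j))] at h1
      rw [map_sum, map_sum]
      apply Finset.sum_eq_zero
      intro m hm
      rw [Finset.mem_filter] at hm
      exact (mul_eq_zero.1 (h1 m hm.1)).resolve_left hm.2.ne'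
    · intro j hj
      have h1 : u j x0 ≠ 0 := by simpa [hE'] using hj
      rw [map_sum, map_sum]
      refine lt_of_le_of_ne (Finset.sum_nonneg fun m hm => (hs m (Finset.mem_filter.1 hm).1).2 j) ?_
      intro h0
      apply h1
      rw [hsum, map_sum]
      apply Finset.sum_eq_zero
      intro m hm
      rw [map_smul, smul_eq_mul]
      by_cases hl : 0 < lam m
      · have h0' := h0.symm
        rw [Finset.sum_eq_zero_iff_of_nonneg
          (fun m hm => (hs m (Finset.mem_filter.1 hm).1).2 j)] at h0'
        rw [h0' m (Finset.mem_filter.2 ⟨hm, hl⟩), mul_zero]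
      · rw [le_antisymm (not_lt.1 hl) (hs m hm).1, zero_mul]
  · refine (finrank_inf_ker_le (VE u E) (u j0)).trans ?_
    gcongr
    apply Submodule.finrank_mono
    rintro x ⟨hx1, hx2⟩
    rw [mem_VE]
    exact hE'ker x hx1 hx2
  · ext m
    constructor
    · rintro ⟨hm, j, hj, hmj⟩ i
      refine ⟨(hm i).1, fun hi => ?_⟩
      have h1 := hprop m0 hm0 j0 hj0 hm0j m hm j hj hmj (ρ m - v) (hdiff m hm)
      have h2 : u j (ρ m - v) = 0 := by rw [map_sub, hmj, sub_self]
      rw [h2, mul_zero] at h1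
      have h3 := (mul_eq_zero.1 h1).resolve_left (hw j hj).ne'
      have h4 := hE'ker _ (hdiff m hm) h3 i hi
      rw [map_sub] at h4
      linarith
    · intro hm
      exact ⟨fun j => ⟨(hm j).1, fun hj => (hm j).2 (hEE' hj)⟩, j0, hj0,
        (hm j0).2 ((memE' j0).2 hm0j)⟩

lemma DD_sub {E : Finset J} {v w : V} (hwE : ∀ j ∈ E, u j w = 0) (hw : ∀ j, j ∉ E → 0 < u j w)
    {s t : ℝ} (hst : s ≤ t) : DD ρ u (v + t • w) E ⊆ DD ρ u (v + s • w) E := by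
  intro m hm j
  have h := hm j
  simp only [map_add, map_smul, smul_eq_mul] at h ⊢
  by_cases hj : j ∈ E
  · rw [hwE j hj] at h ⊢
    simpa using h
  · refine ⟨le_trans ?_ h.1, fun h => absurd h hj⟩
    have := mul_le_mul_of_nonneg_right hst (hw j hj).le
    linarith

/-- moving up from the difference -/
lemma DD_up {E : Finset J} {v w : V} (hwE : ∀ j ∈ E, u j w = 0) {t : ℝ} {m g : M}
    (hg : ∀ j, 0 ≤ u j (ρ g)) (hm : m ∈ DD ρ u (v + t • w) E) (hmg : m + g ∈ DD ρ u v E) :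
    m + g ∈ DD ρ u (v + t • w) E := by
  intro j
  have h1 := hm j
  have h2 := hmg j
  have h3 := hg j
  simp only [map_add, map_smul, smul_eq_mul] at h1 h2 ⊢
  refine ⟨by linarith, fun hj => ?_⟩
  have := h2.2 hj
  rw [hwE j hj] at *
  simpa using this

lemma cube_dif {T' : Finset T} {D D' : Set M} : dif (cube T' D) (cube T' D') = cube T' (D \ D') := by
  funext I
  ext m
  simp only [dif, cube, Set.mem_diff, Set.mem_setOf_eq]
  tauto

/-- The sweep. -/
theorem sweep_aux (hS : SweepData φ ρ u) {T' : Finset T} {p : ℕ} {E : Finset J} {w : V}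
    (hwE : ∀ j ∈ E, u j w = 0) (hw : ∀ j, j ∉ E → 0 < u j w) (v : V)
    (hgen : ∀ i j, i ∉ E → j ∉ E →
      (∃ x ∈ VE u E, u j w * u i x ≠ u i w * u j x) → ∀ (t : ℝ) (a b : ℤ),
        ¬ (u i (v + t • w) = a ∧ u j (v + t • w) = b))
    (IH : ∀ (E' : Finset J) (v' : V), E ⊂ E' →
      (∃ y : M, (∀ j ∈ E', u j (ρ y) = 0) ∧ ∀ j, j ∉ E' → 0 < u j (ρ y)) →
      Module.finrank ℝ (VE u E) ≤ Module.finrank ℝ (VE u E') + 1 →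
      Ex φ (cube T' (DD ρ u v' E')) p) :
    Ex φ (cube T' (DD ρ u v E \ DD ρ u (v + w) E)) p := by
  classical
  -- jump times
  set JT : Set ℝ := {t | 0 ≤ t ∧ t < 1 ∧ ∃ j, j ∉ E ∧ ∃ z : ℤ, u j v + t * u j w = z} with hJT
  have hfin : JT.Finite := by
    have : JT ⊆ ⋃ j ∈ (Eᶜ : Finset J), (fun z : ℤ => ((z : ℝ) - u j v) / u j w) ''
        (Set.Icc ⌊u j v⌋ ⌈u j v + u j w⌉) := by
      rintro t ⟨h0, h1, j, hj, z, hz⟩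
      simp only [Set.mem_iUnion]
      refine ⟨j, by simpa using hj, z, ?_, ?_⟩
      · have hp := hw j hj
        have h2 := mul_nonneg h0 hp.le
        have h3 := mul_le_mul_of_nonneg_right h1.le hp.le
        constructor
        · have : (⌊u j v⌋ : ℝ) ≤ z := (Int.floor_le _).trans (by linarith)
          exact_mod_cast this
        · have : (z : ℝ) ≤ ⌈u j v + u j w⌉ := le_trans (by linarith) (Int.le_ceil _)
          exact_mod_cast this
      · change ((z : ℝ) - u j v) / u j w = t
        rw [div_eq_iff (hw j hj).ne']; linarith
    refine Set.Finite.subset ?_ this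
    refine Set.Finite.biUnion (Finset.finite_toSet _) fun j _ => ?_
    exact (Set.finite_Icc _ _).image _
  have key : ∀ (k : ℕ) (t : ℝ), 0 ≤ t → t ≤ 1 → (hfin.toFinset.filter (· < t)).card = k →
      Ex φ (cube T' (DD ρ u v E \ DD ρ u (v + t • w) E)) p := by
    intro k
    induction k using Nat.strong_induction_on with
    | _ k ih =>
    intro t ht0 ht1 hk
    by_cases hne : (hfin.toFinset.filter (· < t)).Nonempty
    · set t0 := (hfin.toFinset.filter (· < t)).max' hne with ht0def
      have ht0mem := Finset.max'_mem _ hne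
      rw [← ht0def, Finset.mem_filter, Set.Finite.mem_toFinset] at ht0mem
      obtain ⟨ht0J, ht0t⟩ := ht0mem
      have hle : ∀ s ∈ JT, s < t → s ≤ t0 := fun s hs hst =>
        Finset.le_max' _ _ (by simp [hs, hst])
      have h1 : Ex φ (cube T' (DD ρ u v E \ DD ρ u (v + t0 • w) E)) p := by
        refine ih _ ?_ t0 ht0J.1 (by linarith) rfl
        rw [← hk]
        apply Finset.card_lt_card
        refine ⟨fun s hs => ?_, fun h => ?_⟩
        · simp only [Finset.mem_filter] at hs ⊢
          exact ⟨hs.1, hs.2.trans ht0t⟩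
        · have : t0 ∈ hfin.toFinset.filter (· < t) := by simp [ht0J, ht0t]
          have := h this
          simp at this
      have hDsub : DD ρ u (v + t • w) E ⊆ DD ρ u (v + t0 • w) E := DD_sub hwE hw ht0t.le
      have hDsub0 : DD ρ u (v + t0 • w) E ⊆ DD ρ u v E := by
        have := DD_sub (ρ := ρ) (v := v) hwE hw ht0J.1
        simpa using this
      have hQ : DD ρ u (v + t0 • w) E \ DD ρ u (v + t • w) E =
          {m | m ∈ DD ρ u (v + t0 • w) E ∧ ∃ j, j ∉ E ∧ u j (ρ m) = u j (v + t0 • w)} := by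
        ext m
        constructor
        · rintro ⟨hm, hm'⟩
          refine ⟨hm, ?_⟩
          by_contra hcon
          push Not at hcon
          apply hm'
          intro j
          by_cases hj : j ∈ E
          · have := hm j
            simpa [hwE j hj] using this
          · refine ⟨?_, fun h => absurd h hj⟩
            by_contra hlt
            push Not at hlt
            obtain ⟨z, hz⟩ := hS.hZval j m
            have h2 := (hm j).1
            have h3 := hcon j hj
            simp only [map_add, map_smul, smul_eq_mul] at hlt h2 h3
            have hp := hw j hj
            set s := (u j (ρ m) - u j v) / u j w with hs
            have hsw : s * u j w = u j (ρ m) - u j v := by rw [hs]; field_simp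
            have hs0 : t0 ≤ s := by
              rw [hs, le_div_iff₀ hp]; linarith
            have hst : s < t := by
              rw [hs, div_lt_iff₀ hp]; linarith
            have hsJ : s ∈ JT := ⟨ht0J.1.trans hs0, by linarith, j, hj, z, by linarith⟩
            have hseq : s = t0 := le_antisymm (hle s hsJ hst) hs0
            apply h3
            rw [← hseq, hsw]; ring
        · rintro ⟨hm, j, hj, hmj⟩
          refine ⟨hm, fun hm' => ?_⟩
          have h2 := (hm' j).1
          rw [hmj] at h2
          simp only [map_add, map_smul, smul_eq_mul] at h2
          have := mul_lt_mul_of_pos_right ht0t (hw j hj)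
          linarith
      have h2 : Ex φ (cube T' (DD ρ u (v + t0 • w) E \ DD ρ u (v + t • w) E)) p := by
        by_cases hQne : ∃ m, m ∈ DD ρ u (v + t0 • w) E ∧ ∃ j, j ∉ E ∧ u j (ρ m) = u j (v + t0 • w)
        · obtain ⟨m0, hm0, j0, hj0, hmj0⟩ := hQne
          obtain ⟨E', hEE', hgood, hdim, hset⟩ := jump_face hS hw (v + t0 • w)
            (fun i j hi hj hx a b => hgen i j hi hj hx t0 a b) hm0 hj0 hmj0
          rw [hQ, hset]
          exact IH E' _ hEE' hgood hdim
        · apply ex_of_empty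
          intro I _
          rw [hQ]
          ext m
          simp only [cube, Set.mem_setOf_eq, Set.mem_empty_iff_false, iff_false]
          rintro ⟨_, h⟩
          exact hQne ⟨m, h⟩
      have hdif : dif (cube T' (DD ρ u v E \ DD ρ u (v + t • w) E))
          (cube T' (DD ρ u (v + t0 • w) E \ DD ρ u (v + t • w) E)) =
          cube T' (DD ρ u v E \ DD ρ u (v + t0 • w) E) := by
        rw [cube_dif]
        congr 1
        ext m
        constructor
        · rintro ⟨⟨h1, h2⟩, h3⟩
          exact ⟨h1, fun h => h3 ⟨h, h2⟩⟩
        · rintro ⟨h1, h2⟩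
          exact ⟨⟨h1, fun h => h2 (hDsub h)⟩, fun h => h2 h.1⟩
      refine ext_ex φ (B' := cube T' (DD ρ u (v + t0 • w) E \ DD ρ u (v + t • w) E)) ?_ ?_ h2
        (by rw [hdif]; exact h1)
      · apply lc_cube hS.hφ
        rintro m g g' hg hg' ⟨hm1, hm2⟩ ⟨hm3, hm4⟩
        refine ⟨DD_convex v E m g g' hg hg' hm1 hm3, fun h => hm4 ?_⟩
        exact DD_up hwE hg h hm3
      · refine ⟨fun I m hm => ⟨hm.1, hDsub0 hm.2.1, hm.2.2⟩, ?_⟩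
        rintro I i hi m ⟨hI, hm1, hm2⟩ g hg ⟨hI', hm3, hm4⟩
        exact ⟨hI', DD_up hwE (hS.hφ i g hg) hm1 hm3, hm4⟩
    · have heq : DD ρ u v E \ DD ρ u (v + t • w) E = ∅ := by
        rw [Set.diff_eq_empty]
        intro m hm j
        by_cases hj : j ∈ E
        · have := hm j
          simpa [hwE j hj] using this
        · refine ⟨?_, fun h => absurd h hj⟩
          by_contra hlt
          push Not at hlt
          obtain ⟨z, hz⟩ := hS.hZval j m
          have h2 := (hm j).1
          simp only [map_add, map_smul, smul_eq_mul] at hlt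
          have hp := hw j hj
          set s := (u j (ρ m) - u j v) / u j w with hs
          have hsw : s * u j w = u j (ρ m) - u j v := by rw [hs]; field_simp
          have hs0 : 0 ≤ s := div_nonneg (by linarith) hp.le
          have hst : s < t := by
            rw [hs, div_lt_iff₀ hp]; linarith
          exact hne ⟨s, by
            simp only [Finset.mem_filter, Set.Finite.mem_toFinset]
            exact ⟨⟨hs0, by linarith, j, hj, z, by linarith⟩, hst⟩⟩
      apply ex_of_empty
      intro I _
      ext m
      simp [cube, heq]
  have := key _ 1 zero_le_one le_rfl rfl
  rwa [one_smul] at this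

/-- Hochster-type acyclicity. -/
theorem sweep (hS : SweepData φ ρ u) {T' : Finset T} {E0 : Finset J}
    (hE0 : ∀ i, i ∉ T' → ∀ g, (φ i).coeff g ≠ 0 → ∃ j ∈ E0, 0 < u j (ρ g)) :
    ∀ (k : ℕ) (E : Finset J) (p : ℕ) (v : V), (Eᶜ).card = k → E0 ⊆ E →
      (∃ y : M, (∀ j ∈ E, u j (ρ y) = 0) ∧ ∀ j, j ∉ E → 0 < u j (ρ y)) →
      T'.card < p + Module.finrank ℝ (VE u E) → Ex φ (cube T' (DD ρ u v E)) p := by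
  classical
  intro k
  induction k using Nat.strong_induction_on with
  | _ k ih =>
  intro E p v hk hEE ⟨y, hy0, hy1⟩ hp
  by_cases hne : ∃ j, j ∉ E
  · have hynn : ∀ j, 0 ≤ u j (ρ y) := by
      intro j
      by_cases hj : j ∈ E
      · rw [hy0 j hj]
      · exact (hy1 j hj).le
    obtain ⟨r, hr, a, ha, haw⟩ := hS.hnil y hynn (hne.imp fun j hj => hy1 j hj)
    set w : M := r • y with hwdef
    have hwv : ∀ j, u j (ρ w) = r * u j (ρ y) := by
      intro j; rw [hwdef, map_nsmul, map_nsmul, nsmul_eq_mul]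
    have hwE : ∀ j ∈ E, u j (ρ w) = 0 := fun j hj => by rw [hwv, hy0 j hj, mul_zero]
    have hw : ∀ j, j ∉ E → 0 < u j (ρ w) := fun j hj => by
      rw [hwv]
      exact mul_pos (by exact_mod_cast hr) (hy1 j hj)
    have hwnn : ∀ j, 0 ≤ u j (ρ w) := fun j => by
      rw [hwv]; exact mul_nonneg (Nat.cast_nonneg _) (hynn j)
    obtain ⟨v', hDv', hgen⟩ := gen_exists hS.hZval hwE hw v
    rw [← hDv']
    have hEx : Ex φ (cube T' (DD ρ u v' E \ DD ρ u (v' + ρ w) E)) (p + 1) := by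
      apply sweep_aux hS hwE hw v' hgen
      intro E' v'' hss hgood hdim
      refine ih (E'ᶜ).card ?_ E' (p + 1) v'' rfl (hEE.trans hss.1) hgood (by omega)
      rw [← hk]
      apply Finset.card_lt_card
      exact Finset.compl_ssubset_compl.2 hss
    intro c hc hcp hcz
    obtain ⟨b, hb, hbp, hbd⟩ := mul_boundary hS hEE hE0 hwnn hwE ha haw v' hc hcp hcz
    have hshift : ∀ m, m ∈ DD ρ u (v' + ρ w) E ↔ m - w ∈ DD ρ u v' E := by
      intro m
      refine forall_congr' fun j => ?_
      simp only [map_add, map_sub]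
      constructor
      · rintro ⟨h1, h2⟩
        exact ⟨by linarith, fun hj => by linarith [h2 hj]⟩
      · rintro ⟨h1, h2⟩
        exact ⟨by linarith, fun hj => by linarith [h2 hj]⟩
    have hcubeshift : ∀ I, cube T' (DD ρ u (v' + ρ w) E) I
        = {m | m - w ∈ cube T' (DD ρ u v' E) I} := by
      intro I; ext m
      simp only [cube, Set.mem_setOf_eq, hshift]
    have hlc : LC φ (cube T' (DD ρ u v' E)) :=
      lc_cube hS.hφ fun m g g' hg hg' => DD_convex v' E m g g' hg hg'
    have hsub : DD ρ u (v' + ρ w) E ⊆ DD ρ u v' E := by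
      have := DD_sub (ρ := ρ) (v := v') hwE hw (zero_le_one)
      simpa using this
    have hcl : Cl φ (cube T' (DD ρ u (v' + ρ w) E)) (cube T' (DD ρ u v' E)) := by
      refine ⟨fun I m hm => ⟨hm.1, hsub hm.2⟩, ?_⟩
      rintro I i hi m ⟨hI, hm1⟩ g hg ⟨hI', hm3⟩
      have := DD_up (ρ := ρ) (v := v') (t := 1) hwE (hS.hφ i g hg) (by simpa using hm1) hm3
      exact ⟨hI', by simpa using this⟩
    have hcw : InB (cube T' (DD ρ u (v' + ρ w) E))
        (fun I => AddMonoidAlgebra.single w (1 : ℂ) * c I) := by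
      intro I m hm
      rw [single_mul_coeff] at hm
      rw [hcubeshift]
      exact hc I _ hm
    obtain ⟨b', hb', hbp', hbd'⟩ := les1 φ hlc hcl (by rw [cube_dif]; exact hEx) hcw hb hbp hbd
    refine ⟨fun I => AddMonoidAlgebra.single (-w) (1 : ℂ) * b' I, ?_, ?_, ?_⟩
    · intro I m hm
      rw [single_mul_coeff] at hm
      have := hb' I _ hm
      rw [hcubeshift] at this
      simpa using this
    · intro I hI
      change _ * b' I = 0
      rw [hbp' I hI, mul_zero]
    · funext I
      apply single_mul_inj (w := w)
      have h1 := congrFun hbd' I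
      change res (cube T' (DD ρ u (v' + ρ w) E) I) (kd φ b' I) = _ at h1
      rw [← h1, hcubeshift]
      change AddMonoidAlgebra.single w 1 * res _ (kd φ (fun I => _) I) = _
      rw [← res_single_mul, kd_mul, ← mul_assoc, AddMonoidAlgebra.single_mul_single]
      simp [← AddMonoidAlgebra.one_def]
  · push Not at hne
    have hV : Module.finrank ℝ (VE u E) = 0 := by
      have : VE u E = ⊥ := by
        rw [eq_bot_iff]
        intro x hx
        exact hS.hpt x fun j => mem_VE.1 hx j (hne j)
      rw [this]; simp
    apply ex_of_empty
    intro I hI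
    ext m
    simp only [cube, Set.mem_setOf_eq, Set.mem_empty_iff_false, iff_false]
    rintro ⟨h, _⟩
    have := Finset.card_le_card h
    omega

end Sweep2

end Kz
end ToricNewton

set_option linter.all false
set_option linter.unusedSectionVars false
set_option linter.unusedVariables false
namespace ToricNewton
namespace Kz

open Finset
open scoped Pointwise

section Geom
variable {σ : Type*} [Fintype σ] [DecidableEq σ]

/-- moving a functional to a vertex -/
lemma vertex_improve {V : Type*} [AddCommGroup V] [Module ℝ V] (S : Finset V) (x : V)
    (hspan : Submodule.span ℝ (S : Set V) = ⊤)
    (hx : ∃ lam : V → ℝ, (∀ v, 0 ≤ lam v) ∧ x = ∑ v ∈ S, lam v • v)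
    (u0 : V →ₗ[ℝ] ℝ) (hu0 : ∀ v ∈ S, u0 v ≤ 1) :
    ∃ u : V →ₗ[ℝ] ℝ, (∀ v ∈ S, u v ≤ 1) ∧ Submodule.span ℝ {v | v ∈ S ∧ u v = 1} = ⊤ ∧ u0 x ≤ u x := by
  classical
  obtain ⟨lam, hlam, hxl⟩ := hx
  let act : (V →ₗ[ℝ] ℝ) → Finset V := fun u => S.filter (fun v => u v = 1)
  have key : ∀ k : ℕ, ∀ u : V →ₗ[ℝ] ℝ, (∀ v ∈ S, u v ≤ 1) → u0 x ≤ u x → S.card - (act u).card = k →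
    ∃ u : V →ₗ[ℝ] ℝ, (∀ v ∈ S, u v ≤ 1) ∧ Submodule.span ℝ {v | v ∈ S ∧ u v = 1} = ⊤ ∧ u0 x ≤ u x := by
    intro k
    induction k using Nat.strong_induction_on with
    | _ k ih =>
      intro u hu hux hk
      by_cases hs : Submodule.span ℝ {v | v ∈ S ∧ u v = 1} = ⊤
      · exact ⟨u, hu, hs, hux⟩
      obtain ⟨z0, hz0, hz0k⟩ := Submodule.exists_le_ker_of_lt_top _ (lt_top_iff_ne_top.2 hs)
      have hzv : ∃ v ∈ S, z0 v ≠ 0 := by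
        by_contra hcon
        push Not at hcon
        apply hz0
        have : (⊤ : Submodule ℝ V) ≤ LinearMap.ker z0 := by
          rw [← hspan, Submodule.span_le]
          intro v hv; exact hcon v hv
        ext v; exact this (Submodule.mem_top)
      obtain ⟨z, hzk, hzx, v0, hv0, hzv0⟩ : ∃ z : V →ₗ[ℝ] ℝ, (∀ v ∈ S, u v = 1 → z v = 0) ∧ 0 ≤ z x ∧ ∃ v ∈ S, 0 < z v := by
        have hk0 : ∀ v ∈ S, u v = 1 → z0 v = 0 := fun v hv h1 =>
          hz0k (Submodule.subset_span ⟨hv, h1⟩)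
        have hpos : ∀ z : V →ₗ[ℝ] ℝ, 0 < z x → ∃ v ∈ S, 0 < z v := by
          intro z hz
          by_contra hcon
          push Not at hcon
          have : z x ≤ 0 := by
            rw [hxl, map_sum]
            apply Finset.sum_nonpos
            intro v hv
            rw [map_smul, smul_eq_mul]
            exact mul_nonpos_of_nonneg_of_nonpos (hlam v) (hcon v hv)
          linarith
        rcases lt_trichotomy (z0 x) 0 with h | h | h
        · refine ⟨-z0, fun v hv h1 => by simp [hk0 v hv h1], by simp; linarith, hpos _ (by simpa using h)⟩
        · obtain ⟨v, hv, hne⟩ := hzv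
          rcases lt_or_gt_of_ne hne with h' | h'
          · exact ⟨-z0, fun v hv h1 => by simp [hk0 v hv h1], by simp [h], v, hv, by simpa using h'⟩
          · exact ⟨z0, hk0, h.ge, v, hv, h'⟩
        · exact ⟨z0, hk0, h.le, hpos _ h⟩
      obtain ⟨v1, hv1, hmin⟩ := Finset.exists_min_image (S.filter (fun v => 0 < z v)) (fun v => (1 - u v) / z v)
        ⟨v0, by simp [hv0, hzv0]⟩
      rw [Finset.mem_filter] at hv1
      set t := (1 - u v1) / z v1 with ht
      have ht0 : 0 ≤ t := div_nonneg (by linarith [hu v1 hv1.1]) hv1.2.le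
      have hfeas : ∀ v ∈ S, (u + t • z) v ≤ 1 := by
        intro v hv
        simp only [LinearMap.add_apply, LinearMap.smul_apply, smul_eq_mul]
        by_cases h : 0 < z v
        · have := hmin v (by simp [hv, h])
          rw [le_div_iff₀ h] at this
          linarith
        · have : t * z v ≤ 0 := mul_nonpos_of_nonneg_of_nonpos ht0 (not_lt.1 h)
          linarith [hu v hv]
      have hlt : (act u).card < (act (u + t • z)).card := by
        apply Finset.card_lt_card
        rw [Finset.ssubset_iff_of_subset]
        · refine ⟨v1, ?_, ?_⟩
          · simp only [act, Finset.mem_filter, LinearMap.add_apply, LinearMap.smul_apply, smul_eq_mul]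
            refine ⟨hv1.1, ?_⟩
            rw [ht, div_mul_cancel₀ _ hv1.2.ne']; ring
          · simp only [act, Finset.mem_filter, not_and]
            intro _ h1
            have := hzk v1 hv1.1 h1
            linarith [hv1.2]
        · intro v hv
          simp only [act, Finset.mem_filter] at hv ⊢
          refine ⟨hv.1, ?_⟩
          simp [hzk v hv.1 hv.2, hv.2]
      have hle : (act (u + t • z)).card ≤ S.card := Finset.card_filter_le _ _
      refine ih (S.card - (act (u + t • z)).card) (by omega) (u + t • z) hfeas ?_ rfl
      simp only [LinearMap.add_apply, LinearMap.smul_apply, smul_eq_mul]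
      have := mul_nonneg ht0 hzx
      linarith
  exact key _ u0 hu0 le_rfl rfl

/-- The `ℚ`-linear retraction argument: a functional determined by integral equations is rational. -/
lemma rational_of_span (S : Finset (σ →₀ ℕ)) (u : (σ → ℝ) →ₗ[ℝ] ℝ)
    (hu : ∀ m ∈ S, u (toR m) = 1) (hspan : Submodule.span ℝ (toR '' (S : Set (σ →₀ ℕ))) = ⊤) (i : σ) :
    ∃ q : ℚ, u (Pi.single i 1) = q := by
  classical
  obtain ⟨π, hπ⟩ : ∃ π : ℝ →ₗ[ℚ] ℚ, π 1 = 1 := by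
    obtain ⟨g, hg⟩ := LinearMap.exists_leftInverse_of_injective (Algebra.linearMap ℚ ℝ)
      (LinearMap.ker_eq_bot.2 (algebraMap ℚ ℝ).injective)
    refine ⟨g, ?_⟩
    have := LinearMap.congr_fun hg 1
    simpa using this
  have hexp : ∀ (l : (σ → ℝ) →ₗ[ℝ] ℝ) (x : σ → ℝ), l x = ∑ i, x i * l (Pi.single i 1) := by
    intro l x
    conv_lhs => rw [← Finset.univ_sum_single x]
    rw [map_sum]
    refine Finset.sum_congr rfl fun i _ => ?_
    have : Pi.single i (x i) = (x i) • (Pi.single i 1 : σ → ℝ) := by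
      rw [← Pi.single_smul]; simp
    rw [this, map_smul, smul_eq_mul]
  let u' : (σ → ℝ) →ₗ[ℝ] ℝ := ∑ i, ((π (u (Pi.single i 1)) : ℚ) : ℝ) • LinearMap.proj i
  have hu' : ∀ x, u' x = ∑ i, x i * ((π (u (Pi.single i 1)) : ℚ) : ℝ) := by
    intro x; simp [u', mul_comm]
  have heq : u' = u := by
    apply LinearMap.ext_on hspan
    rintro _ ⟨m, hm, rfl⟩
    rw [hu m hm, hu']
    have h1 := hu m hm
    rw [hexp] at h1
    have h2 := congrArg π h1
    rw [map_sum, hπ] at h2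
    have h3 : ∀ i, π (toR m i * u (Pi.single i 1)) = (m i : ℚ) * π (u (Pi.single i 1)) := by
      intro i
      have : toR m i * u (Pi.single i 1) = (m i : ℚ) • u (Pi.single i 1) := by
        simp [toR, Rat.smul_def]
      rw [this, map_smul, smul_eq_mul]
    simp only [h3] at h2
    have h4 := congrArg (fun q : ℚ => (q : ℝ)) h2
    push_cast at h4
    simpa [toR] using h4
  refine ⟨π (u (Pi.single i 1)), ?_⟩
  conv_lhs => rw [← heq, hu']
  simp [Pi.single_apply]

/-- LP form of membership in `r • P`. -/
def LP (f : MvPolynomial σ ℂ) (r : ℝ) (x : σ → ℝ) : Prop :=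
  ∃ lam : (σ →₀ ℕ) → ℝ, (∀ m, 0 ≤ lam m) ∧ ∑ m ∈ f.support, lam m ≤ r ∧ x = ∑ m ∈ f.support, lam m • toR m

lemma toR_mem_P {f : MvPolynomial σ ℂ} {m : σ →₀ ℕ} (hm : m ∈ f.support) : toR m ∈ newtonPolytope f :=
  subset_convexHull _ _ (Or.inr ⟨m, hm, rfl⟩)

lemma zero_mem_P (f : MvPolynomial σ ℂ) : (0 : σ → ℝ) ∈ newtonPolytope f :=
  subset_convexHull _ _ (Or.inl rfl)

lemma mem_P_iff {f : MvPolynomial σ ℂ} {x : σ → ℝ} : x ∈ newtonPolytope f ↔ LP f 1 x := by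
  constructor
  · intro h
    have : newtonPolytope f ⊆ {x | LP f 1 x} := by
      apply convexHull_min
      · rintro y (hy | ⟨m, hm, rfl⟩)
        · rw [Set.mem_singleton_iff] at hy
          exact ⟨0, fun _ => le_rfl, by simp, by simp [hy]⟩
        · classical
          refine ⟨fun m' => if m' = m then 1 else 0, fun m' => by dsimp; split_ifs <;> norm_num, ?_, ?_⟩
          · rw [Finset.sum_ite_eq']; split_ifs <;> norm_num
          · simp only [ite_smul, one_smul, zero_smul]
            rw [Finset.sum_ite_eq', if_pos (Finset.mem_coe.1 hm)]
      · rintro y ⟨l1, h1, h1', rfl⟩ z ⟨l2, h2, h2', rfl⟩ a b ha hb hab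
        refine ⟨fun m => a * l1 m + b * l2 m, fun m => add_nonneg (mul_nonneg ha (h1 m)) (mul_nonneg hb (h2 m)), ?_, ?_⟩
        · rw [Finset.sum_add_distrib, ← Finset.mul_sum, ← Finset.mul_sum]
          nlinarith
        · simp only [add_smul, mul_smul, Finset.sum_add_distrib, Finset.smul_sum]
    exact this h
  · rintro ⟨lam, h0, h1, rfl⟩
    have hconv : Convex ℝ (newtonPolytope f) := convex_convexHull _ _
    by_cases hs : ∑ m ∈ f.support, lam m = 0
    · have : ∀ m ∈ f.support, lam m = 0 := (Finset.sum_eq_zero_iff_of_nonneg (fun m _ => h0 m)).1 hs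
      rw [Finset.sum_eq_zero (fun m hm => by rw [this m hm, zero_smul])]
      exact zero_mem_P f
    · have hpos : 0 < ∑ m ∈ f.support, lam m := lt_of_le_of_ne (Finset.sum_nonneg fun m _ => h0 m) (Ne.symm hs)
      set s := ∑ m ∈ f.support, lam m with hsd
      have hmem : ∑ m ∈ f.support, (lam m / s) • toR m ∈ newtonPolytope f := by
        apply hconv.sum_mem (fun m _ => div_nonneg (h0 m) hpos.le)
        · rw [← Finset.sum_div, ← hsd, div_self hs]
        · intro m hm; exact toR_mem_P hm
      have := hconv.smul_mem_of_zero_mem (zero_mem_P f) hmem ⟨hpos.le, h1⟩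
      rw [Finset.smul_sum] at this
      convert this using 2 with m hm
      rw [smul_smul, mul_div_cancel₀ _ hs]

lemma mem_smul_P_iff {f : MvPolynomial σ ℂ} {x : σ → ℝ} {r : ℝ} (hr : 0 < r) :
    x ∈ r • newtonPolytope f ↔ LP f r x := by
  rw [Set.mem_smul_set_iff_inv_smul_mem₀ hr.ne', mem_P_iff]
  constructor
  · rintro ⟨lam, h0, h1, h2⟩
    refine ⟨fun m => r * lam m, fun m => mul_nonneg hr.le (h0 m), ?_, ?_⟩
    · rw [← Finset.mul_sum]; nlinarith
    · simp only [mul_smul]; rw [← Finset.smul_sum, ← h2, smul_inv_smul₀ hr.ne']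
  · rintro ⟨lam, h0, h1, h2⟩
    refine ⟨fun m => r⁻¹ * lam m, fun m => mul_nonneg (inv_nonneg.2 hr.le) (h0 m), ?_, ?_⟩
    · rw [← Finset.mul_sum, inv_mul_le_iff₀ hr]; linarith
    · simp only [mul_smul]; rw [← Finset.smul_sum, ← h2]

lemma closed_P (f : MvPolynomial σ ℂ) : IsClosed (newtonPolytope f) := by
  have : (({0} : Set (σ → ℝ)) ∪ (toR '' (f.support : Set (σ →₀ ℕ)))).Finite :=
    (Set.finite_singleton _).union (f.support.finite_toSet.image _)
  exact this.isClosed_convexHull ℝ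

lemma conv_span {f : MvPolynomial σ ℂ} (hf : Convenient f) :
    Submodule.span ℝ (toR '' (f.support : Set (σ →₀ ℕ))) = ⊤ := by
  classical
  rw [eq_top_iff]
  intro x _
  rw [← Finset.univ_sum_single x]
  apply Submodule.sum_mem
  intro i _
  obtain ⟨k, hk, hc⟩ := hf i
  have h1 : toR (Finsupp.single i k) ∈ Submodule.span ℝ (toR '' (f.support : Set (σ →₀ ℕ))) :=
    Submodule.subset_span ⟨_, by simpa using hc, rfl⟩
  have h2 : Pi.single i (x i) = (x i / k) • toR (Finsupp.single i k) := by
    ext j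
    by_cases h : j = i
    · subst h
      have : (k : ℝ) ≠ 0 := by positivity
      simp [toR, this]
    · have h' : i ≠ j := fun e => h e.symm
      simp [toR, h, Finsupp.single_apply, h']
  rw [h2]
  exact Submodule.smul_mem _ _ h1

lemma conv_LP {f : MvPolynomial σ ℂ} (hf : Convenient f) {x : σ → ℝ} (hx : ∀ i, 0 ≤ x i) :
    ∃ r, LP f r x := by
  classical
  choose k hk hc using hf
  have hne : ∀ i, (k i : ℝ) ≠ 0 := fun i => by have := hk i; positivity
  refine ⟨_, fun m => ∑ i, if m = Finsupp.single i (k i) then x i / k i else 0, fun m => ?_, le_rfl, ?_⟩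
  · apply Finset.sum_nonneg; intro i _
    split_ifs
    · exact div_nonneg (hx i) (by positivity)
    · exact le_rfl
  · simp only [Finset.sum_smul]
    rw [Finset.sum_comm]
    have : ∀ i, ∑ m ∈ f.support, (if m = Finsupp.single i (k i) then x i / k i else 0) • toR m
        = (x i / k i) • toR (Finsupp.single i (k i)) := by
      intro i
      rw [Finset.sum_eq_single (Finsupp.single i (k i))]
      · simp
      · intro m _ hm; simp [hm]
      · intro h; exact absurd (by simpa using hc i) h
    simp only [this]
    ext j
    simp only [Finset.sum_apply, Pi.smul_apply, smul_eq_mul, toR]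
    rw [Finset.sum_eq_single j]
    · simp [hne j]
    · intro i _ hij; simp [Finsupp.single_apply, hij]
    · simp

/-- Separation. -/
lemma sep_P {f : MvPolynomial σ ℂ} {x : σ → ℝ} {r : ℝ} (hr : 0 < r) (h : ¬ LP f r x) :
    ∃ u : (σ → ℝ) →ₗ[ℝ] ℝ, (∀ m ∈ f.support, u (toR m) ≤ 1) ∧ r < u x := by
  rw [← mem_smul_P_iff hr, Set.mem_smul_set_iff_inv_smul_mem₀ hr.ne'] at h
  obtain ⟨g, t, h1, h2⟩ := geometric_hahn_banach_closed_point (convex_convexHull ℝ _) (closed_P f) h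
  have ht : 0 < t := by simpa using h1 0 (zero_mem_P f)
  refine ⟨t⁻¹ • (g : (σ → ℝ) →ₗ[ℝ] ℝ), fun m hm => ?_, ?_⟩
  · have := h1 _ (toR_mem_P hm)
    simp only [LinearMap.smul_apply, ContinuousLinearMap.coe_coe, smul_eq_mul]
    rw [inv_mul_le_iff₀ ht]; linarith
  · simp only [LinearMap.smul_apply, ContinuousLinearMap.coe_coe, smul_eq_mul]
    rw [map_smul, smul_eq_mul, lt_inv_mul_iff₀ hr] at h2
    rw [lt_inv_mul_iff₀ ht]; linarith

lemma LP_bound {f : MvPolynomial σ ℂ} : ∃ K : ℝ, 0 ≤ K ∧ ∀ x r, LP f r x → ∑ i, x i ≤ r * K := by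
  refine ⟨∑ m ∈ f.support, ∑ i, (m i : ℝ), by positivity, ?_⟩
  rintro x r ⟨lam, h0, h1, rfl⟩
  have h2 : ∀ m ∈ f.support, ∑ i, (m i : ℝ) ≤ ∑ m ∈ f.support, ∑ i, (m i : ℝ) := fun m hm =>
    Finset.single_le_sum (f := fun m : σ →₀ ℕ => ∑ i, (m i : ℝ)) (fun m _ => by positivity) hm
  calc ∑ i, (∑ m ∈ f.support, lam m • toR m) i = ∑ m ∈ f.support, lam m * ∑ i, (m i : ℝ) := by
        simp only [Finset.sum_apply, Pi.smul_apply, smul_eq_mul, toR]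
        rw [Finset.sum_comm]; simp only [Finset.mul_sum]
    _ ≤ ∑ m ∈ f.support, lam m * (∑ m ∈ f.support, ∑ i, (m i : ℝ)) :=
        Finset.sum_le_sum fun m hm => mul_le_mul_of_nonneg_left (h2 m hm) (h0 m)
    _ = (∑ m ∈ f.support, lam m) * (∑ m ∈ f.support, ∑ i, (m i : ℝ)) := by rw [Finset.sum_mul]
    _ ≤ _ := mul_le_mul_of_nonneg_right h1 (by positivity)

/-- Facet description with integral data. -/
structure FacetData (f : MvPolynomial σ ℂ) (D : ℕ) (U : Finset (σ → ℤ)) : Prop where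
  hD : 1 ≤ D
  zero : 0 ∈ U
  iff : ∀ (x : σ → ℝ), (∀ i, 0 ≤ x i) → ∀ r : ℝ, LP f r x ↔ ∀ u ∈ U, ∑ i, (u i : ℝ) * x i ≤ D * r

lemma exists_facetData {f : MvPolynomial σ ℂ} (hf : Convenient f) : ∃ D U, FacetData f D U := by
  classical
  let Uset : Set ((σ → ℝ) →ₗ[ℝ] ℝ) := {u | (∀ m ∈ f.support, u (toR m) ≤ 1) ∧
    Submodule.span ℝ (toR '' ((f.support.filter (fun m => u (toR m) = 1) : Finset (σ →₀ ℕ)) : Set (σ →₀ ℕ))) = ⊤}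
  have hfin : Uset.Finite := by
    apply Set.Finite.of_finite_image (f := fun u => f.support.filter (fun m => u (toR m) = 1))
    · apply (f.support.powerset.finite_toSet).subset
      rintro _ ⟨u, hu, rfl⟩
      exact Finset.mem_coe.2 (Finset.mem_powerset.2 (Finset.filter_subset _ _))
    · intro u hu u' hu' h
      simp only at h
      apply LinearMap.ext_on hu.2
      rintro _ ⟨m, hm, rfl⟩
      have hm' := hm
      rw [h] at hm'
      simp only [Finset.coe_filter, Set.mem_setOf_eq] at hm hm'
      rw [hm.2, hm'.2]
  have hrat : ∀ u ∈ Uset, ∀ i, ∃ q : ℚ, u (Pi.single i 1) = q := by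
    intro u hu i
    refine rational_of_span _ u ?_ hu.2 i
    intro m hm; exact (Finset.mem_filter.1 hm).2
  have hrat' : ∀ (u : (σ → ℝ) →ₗ[ℝ] ℝ) i, ∃ q : ℚ, u ∈ Uset → u (Pi.single i 1) = q := by
    intro u i
    by_cases h : u ∈ Uset
    · obtain ⟨q, hq⟩ := hrat u h i; exact ⟨q, fun _ => hq⟩
    · exact ⟨0, fun h' => absurd h' h⟩
  choose q hq using hrat'
  let D : ℕ := ∏ u ∈ hfin.toFinset, ∏ i, (q u i).den
  have hD1 : 1 ≤ D := Nat.one_le_iff_ne_zero.2 (Finset.prod_ne_zero_iff.2 fun u _ =>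
    Finset.prod_ne_zero_iff.2 fun i _ => (q u i).den_nz)
  have hz : ∀ (u : (σ → ℝ) →ₗ[ℝ] ℝ) i, ∃ z : ℤ, u ∈ Uset → (D : ℝ) * u (Pi.single i 1) = z := by
    intro u i
    by_cases h : u ∈ Uset
    · have hdvd : (q u i).den ∣ D :=
        (Finset.dvd_prod_of_mem (fun i => (q u i).den) (Finset.mem_univ i)).trans
          (Finset.dvd_prod_of_mem (fun u => ∏ i, (q u i).den) (hfin.mem_toFinset.2 h))
      obtain ⟨e, he⟩ := hdvd
      refine ⟨e * (q u i).num, fun _ => ?_⟩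
      rw [hq u i h]
      have hden : ((q u i).den : ℝ) ≠ 0 := by exact_mod_cast (q u i).den_nz
      have h1 : ((q u i : ℚ) : ℝ) = (q u i).num / (q u i).den := by
        exact_mod_cast congrArg (fun q : ℚ => (q : ℝ)) (Rat.num_div_den (q u i)).symm
      rw [h1, he]; push_cast; field_simp
    · exact ⟨0, fun h' => absurd h' h⟩
  choose z hz using hz
  have hexp : ∀ (l : (σ → ℝ) →ₗ[ℝ] ℝ) (x : σ → ℝ), l x = ∑ i, x i * l (Pi.single i 1) := by
    intro l x
    conv_lhs => rw [← Finset.univ_sum_single x]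
    rw [map_sum]
    refine Finset.sum_congr rfl fun i _ => ?_
    have : Pi.single i (x i) = (x i) • (Pi.single i 1 : σ → ℝ) := by
      rw [← Pi.single_smul]; simp
    rw [this, map_smul, smul_eq_mul]
  have hzx : ∀ u ∈ Uset, ∀ x : σ → ℝ, ∑ i, (z u i : ℝ) * x i = D * u x := by
    intro u hu x
    rw [hexp u x, Finset.mul_sum]
    refine Finset.sum_congr rfl fun i _ => ?_
    rw [← hz u i hu]; ring
  have hDpos : (0 : ℝ) < D := by exact_mod_cast hD1
  refine ⟨D, insert 0 (hfin.toFinset.image z), hD1, Finset.mem_insert_self _ _, ?_⟩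
  have hpos : ∀ (x : σ → ℝ), (∀ i, 0 ≤ x i) → ∀ r : ℝ, 0 < r →
      (∀ u ∈ insert 0 (hfin.toFinset.image z), ∑ i, (u i : ℝ) * x i ≤ D * r) → LP f r x := by
    intro x hx r hr h
    by_contra hLP
    obtain ⟨u0, hu0, hu0x⟩ := sep_P hr hLP
    obtain ⟨r', lam, hl0, _, hlx⟩ := conv_LP hf hx
    have hinj : Function.Injective (toR : (σ →₀ ℕ) → σ → ℝ) := by
      intro a b hab; ext i; have := congrFun hab i; simpa [toR] using this
    obtain ⟨u, hu1, hu2, hu3⟩ := vertex_improve (f.support.image toR) x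
      (by rw [Finset.coe_image]; exact conv_span hf)
      ⟨fun v => ∑ m ∈ f.support, if toR m = v then lam m else 0, fun v => Finset.sum_nonneg fun m _ => by
        split_ifs; exacts [hl0 m, le_rfl], by
        rw [Finset.sum_image (fun a _ b _ h => hinj h)]
        rw [hlx]
        refine Finset.sum_congr rfl fun m hm => ?_
        congr 1
        show lam m = ∑ m' ∈ f.support, if toR m' = toR m then lam m' else 0
        rw [Finset.sum_eq_single m]
        · simp
        · intro b _ hb; rw [if_neg]; exact fun h => hb (hinj h)
        · exact fun h => absurd hm h⟩ u0
      (by intro v hv; obtain ⟨m, hm, rfl⟩ := Finset.mem_image.1 hv; exact hu0 m hm)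
    have hu : u ∈ Uset := by
      refine ⟨fun m hm => hu1 _ (Finset.mem_image_of_mem _ hm), ?_⟩
      rw [← hu2]; congr 1
      ext v; constructor
      · rintro ⟨m, hm, rfl⟩
        simp only [Finset.coe_filter, Set.mem_setOf_eq] at hm
        exact ⟨Finset.mem_image_of_mem _ hm.1, hm.2⟩
      · rintro ⟨hv, h1⟩
        obtain ⟨m, hm, rfl⟩ := Finset.mem_image.1 hv
        exact ⟨m, by simpa using ⟨by simpa using hm, h1⟩, rfl⟩
    have := h (z u) (Finset.mem_insert_of_mem (Finset.mem_image_of_mem _ (hfin.mem_toFinset.2 hu)))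
    rw [hzx u hu] at this
    have := le_of_mul_le_mul_left this hDpos
    linarith
  intro x hx r
  constructor
  · rintro ⟨lam, h0, h1, hx'⟩ u hu
    have hr : 0 ≤ r := le_trans (Finset.sum_nonneg fun m _ => h0 m) h1
    rcases Finset.mem_insert.1 hu with rfl | hu
    · simp; positivity
    · obtain ⟨u, hu0, rfl⟩ := Finset.mem_image.1 hu
      have hu := hfin.mem_toFinset.1 hu0
      rw [hzx u hu]
      apply mul_le_mul_of_nonneg_left _ hDpos.le
      rw [hx', map_sum]
      refine le_trans (Finset.sum_le_sum (g := lam) fun m hm => ?_) h1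
      rw [map_smul, smul_eq_mul]
      have := hu.1 m hm
      have := h0 m
      nlinarith
  · intro h
    have hr : 0 ≤ r := by
      have := h 0 (Finset.mem_insert_self _ _)
      simp at this
      exact nonneg_of_mul_nonneg_right this hDpos
    rcases hr.lt_or_eq with hr | hr
    · exact hpos x hx r hr h
    · subst hr
      obtain ⟨K, hK, hb⟩ := LP_bound (f := f)
      have hall : ∀ e : ℝ, 0 < e → ∑ i, x i ≤ e * K := fun e he => hb _ _ (hpos x hx e he fun u hu =>
        (h u hu).trans (by simp; positivity))
      have hle : ∑ i, x i ≤ 0 := by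
        by_contra hcon
        push Not at hcon
        have := hall ((∑ i, x i) / (2 * (K + 1))) (by positivity)
        have h2 : (∑ i, x i) / (2 * (K + 1)) * K = (∑ i, x i) * (K / (2 * (K + 1))) := by ring
        have h3 : K / (2 * (K + 1)) < 1 := by rw [div_lt_one (by positivity)]; linarith
        nlinarith
      have hx0 : ∀ i, x i = 0 := fun i =>
        (Finset.sum_eq_zero_iff_of_nonneg (fun i _ => hx i)).1 (le_antisymm hle (Finset.sum_nonneg fun i _ => hx i)) i (Finset.mem_univ _)
      exact ⟨0, fun _ => le_rfl, by simp, by ext i; simp [hx0 i]⟩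

lemma nu_le_iff {f : MvPolynomial σ ℂ} {D : ℕ} {U : Finset (σ → ℤ)} (hF : FacetData f D U) (hf : Convenient f)
    {x : σ → ℝ} (hx : ∀ i, 0 ≤ x i) (r : ℝ) : nu f x ≤ r ↔ LP f r x := by
  have hDpos : (0 : ℝ) < D := by exact_mod_cast hF.hD
  constructor
  · intro h
    have hr0 : 0 ≤ r := le_trans (gauge_nonneg _) h
    have hlt : ∀ r', r < r' → LP f r' x := by
      intro r' hr'
      have hne : {r : ℝ | r ∈ Set.Ioi (0 : ℝ) ∧ x ∈ r • newtonPolytope f}.Nonempty := by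
        obtain ⟨r0, hr0⟩ := conv_LP hf hx
        have h1 : LP f (max r0 1) x := by
          obtain ⟨lam, a, b, c⟩ := hr0
          exact ⟨lam, a, b.trans (le_max_left _ _), c⟩
        exact ⟨max r0 1, Set.mem_Ioi.2 (lt_of_lt_of_le one_pos (le_max_right r0 1)),
          (mem_smul_P_iff (lt_of_lt_of_le one_pos (le_max_right _ _))).2 h1⟩
      have h2 : sInf {r : ℝ | r ∈ Set.Ioi (0 : ℝ) ∧ x ∈ r • newtonPolytope f} < r' := lt_of_le_of_lt h hr'
      obtain ⟨s, ⟨hs0, hs⟩, hsr⟩ := exists_lt_of_csInf_lt hne h2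
      obtain ⟨lam, a, b, c⟩ := (mem_smul_P_iff hs0).1 hs
      exact ⟨lam, a, b.trans hsr.le, c⟩
    rw [hF.iff x hx]
    intro u hu
    apply le_of_forall_pos_le_add
    intro e he
    have := (hF.iff x hx (r + e / D)).1 (hlt _ (by have := div_pos he hDpos; linarith)) u hu
    rw [mul_add, mul_div_cancel₀ _ hDpos.ne'] at this
    exact this
  · rintro ⟨lam, h0, h1, h2⟩
    have hr : 0 ≤ r := le_trans (Finset.sum_nonneg fun m _ => h0 m) h1
    rcases hr.lt_or_eq with hr | hr
    · exact gauge_le_of_mem hr.le ((mem_smul_P_iff hr).2 ⟨lam, h0, h1, h2⟩)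
    · subst hr
      have : ∀ m ∈ f.support, lam m = 0 :=
        (Finset.sum_eq_zero_iff_of_nonneg (fun m _ => h0 m)).1 (le_antisymm h1 (Finset.sum_nonneg fun m _ => h0 m))
      have : x = 0 := by rw [h2]; exact Finset.sum_eq_zero fun m hm => by rw [this m hm, zero_smul]
      rw [this]; simp [nu]

end Geom

end Kz
end ToricNewton

set_option linter.all false
set_option linter.unusedSectionVars false
set_option linter.unusedVariables false
namespace ToricNewton
namespace Kz

open Finset

section Setup
variable {n : ℕ}

/-- The lattice: degree and exponent. -/
abbrev MM (n : ℕ) := ℤ × (Fin n → ℤ)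
abbrev VV (n : ℕ) := ℝ × (Fin n → ℝ)

/-- Embedding of the lattice. -/
def rho : MM n →+ VV n where
  toFun m := ((m.1 : ℝ), fun i => (m.2 i : ℝ))
  map_zero' := by ext <;> simp
  map_add' := by intro a b; ext <;> simp

/-- Integral functionals. -/
def uZ (U : Finset (Fin n → ℤ)) : Fin n ⊕ U → MM n →+ ℤ
  | Sum.inl i => { toFun := fun m => m.2 i, map_zero' := rfl, map_add' := fun _ _ => rfl }
  | Sum.inr u => { toFun := fun m => m.1 - ∑ i, u.1 i * m.2 i, map_zero' := by simp
                   map_add' := fun a b => by simp [mul_add, Finset.sum_add_distrib]; ring }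

@[simp] lemma uZ_inl (U : Finset (Fin n → ℤ)) (i : Fin n) (m : MM n) : uZ U (Sum.inl i) m = m.2 i := rfl
@[simp] lemma uZ_inr (U : Finset (Fin n → ℤ)) (u : U) (m : MM n) :
    uZ U (Sum.inr u) m = m.1 - ∑ i, u.1 i * m.2 i := rfl

/-- Real functionals. -/
noncomputable def uR (U : Finset (Fin n → ℤ)) : Fin n ⊕ U → VV n →ₗ[ℝ] ℝ
  | Sum.inl i => (LinearMap.proj i).comp (LinearMap.snd ℝ ℝ (Fin n → ℝ))
  | Sum.inr u => LinearMap.fst ℝ ℝ (Fin n → ℝ) -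
      ∑ i, (u.1 i : ℝ) • (LinearMap.proj i).comp (LinearMap.snd ℝ ℝ (Fin n → ℝ))

@[simp] lemma uR_inl (U : Finset (Fin n → ℤ)) (i : Fin n) (m : VV n) : uR U (Sum.inl i) m = m.2 i := rfl
@[simp] lemma uR_inr (U : Finset (Fin n → ℤ)) (u : U) (m : VV n) :
    uR U (Sum.inr u) m = m.1 - ∑ i, (u.1 i : ℝ) * m.2 i := by
  simp [uR]

lemma uR_rho (U : Finset (Fin n → ℤ)) (j) (m : MM n) : uR U j (rho m) = (uZ U j m : ℝ) := by
  rcases j with i | u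
  · simp [rho]
  · simp [rho]

/-- exponent as integer vector -/
def vec (m : Fin n →₀ ℕ) : Fin n → ℤ := fun i => (m i : ℤ)

/-- The cone monoid. -/
def CC (U : Finset (Fin n → ℤ)) : AddSubmonoid (MM n) where
  carrier := {m | ∀ j, 0 ≤ uZ U j m}
  zero_mem' := by intro j; simp
  add_mem' := by
    intro a b ha hb j
    rw [map_add]; exact add_nonneg (ha j) (hb j)

lemma mem_CC {U : Finset (Fin n → ℤ)} {m : MM n} : m ∈ CC U ↔ ∀ j, 0 ≤ uZ U j m := Iff.rfl

lemma mem_CC' {U : Finset (Fin n → ℤ)} {m : MM n} :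
    m ∈ CC U ↔ (∀ i, 0 ≤ m.2 i) ∧ ∀ u ∈ U, ∑ i, u i * m.2 i ≤ m.1 := by
  rw [mem_CC]
  constructor
  · intro h
    refine ⟨fun i => h (Sum.inl i), fun u hu => ?_⟩
    have := h (Sum.inr ⟨u, hu⟩)
    simp at this; linarith
  · rintro ⟨h1, h2⟩ (i | u)
    · exact h1 i
    · have := h2 u.1 u.2
      simp; linarith

variable {f : MvPolynomial (Fin n) ℂ} {D : ℕ} {U : Finset (Fin n → ℤ)}

lemma FacetData.Dpos (hF : FacetData f D U) : (0 : ℝ) < D := by exact_mod_cast hF.hD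

lemma mem_CC_LP (hF : FacetData f D U) {m : MM n} :
    m ∈ CC U ↔ (∀ i, 0 ≤ m.2 i) ∧ LP f ((m.1 : ℝ) / D) (fun i => (m.2 i : ℝ)) := by
  rw [mem_CC']
  refine and_congr_right fun h => ?_
  rw [hF.iff _ (fun i => by exact_mod_cast h i), mul_div_cancel₀ _ hF.Dpos.ne']
  refine forall₂_congr fun u hu => ?_
  norm_cast

lemma CC_fst_nonneg (hF : FacetData f D U) {m : MM n} (h : m ∈ CC U) : 0 ≤ m.1 := by
  have := (mem_CC'.1 h).2 0 hF.zero
  simpa using this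

lemma s_mem_CC (hF : FacetData f D U) : ((1, 0) : MM n) ∈ CC U := by
  rw [mem_CC']; simp

lemma v_mem_CC (hF : FacetData f D U) {m : Fin n →₀ ℕ} (hm : m ∈ f.support) :
    (((D : ℤ), vec m) : MM n) ∈ CC U := by
  rw [mem_CC_LP hF]
  refine ⟨fun i => by simp [vec], ?_⟩
  have : (((D : ℤ) : ℝ)) / (D : ℝ) = 1 := by
    rw [Int.cast_natCast, div_self hF.Dpos.ne']
  rw [this, ← mem_P_iff]
  exact toR_mem_P hm

lemma CC_finite (hF : FacetData f D U) (B : ℤ) : {m : MM n | m ∈ CC U ∧ m.1 ≤ B}.Finite := by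
  obtain ⟨K, hK, hb⟩ := LP_bound (f := f)
  obtain ⟨L, hL⟩ := exists_nat_ge ((B : ℝ) / D * K)
  apply ((Set.finite_Icc (0 : ℤ) B).prod (Set.finite_Icc (0 : Fin n → ℤ) (fun _ => (L : ℤ)))).subset
  rintro m ⟨hm, hB⟩
  have h0 := CC_fst_nonneg hF hm
  have h1 := (mem_CC_LP hF).1 hm
  refine ⟨⟨h0, hB⟩, ⟨fun i => h1.1 i, fun i => ?_⟩⟩
  have h2 := hb _ _ h1.2
  have h3 : (m.2 i : ℝ) ≤ ∑ i, (m.2 i : ℝ) :=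
    Finset.single_le_sum (f := fun i => (m.2 i : ℝ)) (fun i _ => by exact_mod_cast h1.1 i) (Finset.mem_univ i)
  have h4 : (m.1 : ℝ) / D * K ≤ (B : ℝ) / D * K := by
    apply mul_le_mul_of_nonneg_right _ hK
    apply div_le_div_of_nonneg_right _ hF.Dpos.le
    exact_mod_cast hB
  have h5 : (m.2 i : ℝ) ≤ L := by linarith
  exact_mod_cast h5

lemma CC_fst_pos (hF : FacetData f D U) {m : MM n} (h : m ∈ CC U) (h0 : m ≠ 0) : 0 < m.1 := by
  rcases (CC_fst_nonneg hF h).lt_or_eq with h1 | h1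
  · exact h1
  exfalso; apply h0
  obtain ⟨K, hK, hb⟩ := LP_bound (f := f)
  have h2 := (mem_CC_LP hF).1 h
  have h3 := hb _ _ h2.2
  rw [← h1] at h3
  simp at h3
  have h4 : ∀ i, m.2 i = 0 := by
    intro i
    have h5 : ∑ i, m.2 i ≤ 0 := by exact_mod_cast h3
    exact (Finset.sum_eq_zero_iff_of_nonneg (fun i _ => h2.1 i)).1
      (le_antisymm h5 (Finset.sum_nonneg fun i _ => h2.1 i)) i (Finset.mem_univ _)
  ext i
  · exact h1.symm
  · exact h4 i

lemma CC_fg (hF : FacetData f D U) : (CC U).FG := by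
  classical
  have hfin := CC_finite hF (1 + D * (f.support.card + 1))
  refine ⟨hfin.toFinset, le_antisymm ?_ ?_⟩
  · rw [AddSubmonoid.closure_le]
    intro m hm
    simp only [Set.Finite.coe_toFinset, Set.mem_setOf_eq] at hm
    exact hm.1
  · intro m hm
    obtain ⟨h1, lam, hl0, hl1, hl2⟩ := (mem_CC_LP hF).1 hm
    set lam0 : ℝ := m.1 - D * ∑ v ∈ f.support, lam v with hlam0
    have hlam00 : 0 ≤ lam0 := by
      rw [le_div_iff₀ hF.Dpos] at hl1
      rw [hlam0]; linarith
    set big : MM n := ⌊lam0⌋₊ • ((1, 0) : MM n) + ∑ v ∈ f.support, ⌊lam v⌋₊ • (((D : ℤ), vec v) : MM n) with hbig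
    have hrho : rho m = lam0 • rho (1, 0) + ∑ v ∈ f.support, lam v • rho ((D : ℤ), vec v) := by
      have h2 : ∀ v : Fin n →₀ ℕ, lam v • rho ((D : ℤ), vec v) = (lam v * D, lam v • toR v) := by
        intro v; ext i <;> simp [rho, vec, toR]
      simp only [h2]
      apply Prod.ext
      · simp [rho, Prod.fst_sum, hlam0, ← Finset.sum_mul]; ring
      · simp only [Prod.snd_add, Prod.snd_sum, ← hl2]
        ext i; simp [rho]
    have hrest : rho (m - big) = (lam0 - ⌊lam0⌋₊) • rho (1, 0) +
        ∑ v ∈ f.support, (lam v - ⌊lam v⌋₊) • rho ((D : ℤ), vec v) := by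
      rw [map_sub, hrho, hbig, map_add, map_nsmul, map_sum]
      simp only [map_nsmul, sub_smul, Finset.sum_sub_distrib, Nat.cast_smul_eq_nsmul]
      abel
    have hfr : ∀ t : ℝ, 0 ≤ t → 0 ≤ t - ⌊t⌋₊ ∧ t - ⌊t⌋₊ ≤ 1 := fun t ht =>
      ⟨by linarith [Nat.floor_le ht], by linarith [Nat.lt_floor_add_one t]⟩
    have hrC : m - big ∈ CC U := by
      intro j
      have h3 : (0 : ℝ) ≤ uR U j (rho (m - big)) := by
        rw [hrest, map_add, map_smul, map_sum]
        apply add_nonneg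
        · apply mul_nonneg (hfr _ hlam00).1
          rw [uR_rho]; exact_mod_cast s_mem_CC hF j
        · apply Finset.sum_nonneg
          intro v hv
          rw [map_smul]
          apply mul_nonneg (hfr _ (hl0 v)).1
          rw [uR_rho]; exact_mod_cast v_mem_CC hF hv j
      rw [uR_rho] at h3
      exact_mod_cast h3
    have hrB : (m - big).1 ≤ 1 + D * (f.support.card + 1) := by
      have h4 : ((m - big).1 : ℝ) = (rho (m - big)).1 := rfl
      have h5 : (rho (m - big)).1 ≤ 1 + D * (f.support.card + 1) := by
        rw [hrest]
        simp only [Prod.fst_add, Prod.fst_sum, Prod.smul_fst, smul_eq_mul]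
        have h6 : ∑ v ∈ f.support, (lam v - ⌊lam v⌋₊) * (rho ((D : ℤ), vec v)).1 ≤ ∑ v ∈ f.support, (D : ℝ) := by
          apply Finset.sum_le_sum
          intro v hv
          have h7 : (rho ((D : ℤ), vec v)).1 = (D : ℝ) := by simp [rho]
          rw [h7]
          have := hF.Dpos
          nlinarith [(hfr _ (hl0 v)).2]
        have h8 : (rho ((1 : ℤ), (0 : Fin n → ℤ))).1 = (1 : ℝ) := by simp [rho]
        rw [h8]
        rw [Finset.sum_const, nsmul_eq_mul] at h6
        have := hF.Dpos
        nlinarith [(hfr _ hlam00).2]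
      rw [← h4] at h5
      exact_mod_cast h5
    have hgen : ∀ g : MM n, g ∈ CC U → g.1 ≤ 1 + D * (f.support.card + 1) →
        g ∈ AddSubmonoid.closure (hfin.toFinset : Set (MM n)) := fun g hg hB =>
      AddSubmonoid.subset_closure (by simpa using ⟨hg, hB⟩)
    have hDz : (0 : ℤ) < D := by exact_mod_cast hF.hD
    have hDc : (0:ℤ) ≤ (D:ℤ) * f.support.card := by positivity
    have : m = (m - big) + big := by abel
    rw [this]
    apply add_mem (hgen _ hrC hrB)
    rw [hbig]
    apply add_mem
    · apply nsmul_mem; exact hgen _ (s_mem_CC hF) (by show (1:ℤ) ≤ _; nlinarith [hDc])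
    · apply sum_mem; intro v hv; apply nsmul_mem
      exact hgen _ (v_mem_CC hF hv) (by show (D:ℤ) ≤ _; nlinarith [hDc])

/-- The generators `s, Φ_1, …, Φ_n`. -/
noncomputable def phi (f : MvPolynomial (Fin n) ℂ) (D : ℕ) : Fin (n + 1) → AddMonoidAlgebra ℂ (MM n) :=
  Fin.cons (AddMonoidAlgebra.single ((1, 0) : MM n) (1 : ℂ))
    (fun i => ∑ m ∈ f.support, AddMonoidAlgebra.single (((D : ℤ), vec m) : MM n) ((m i : ℂ) * f.coeff m))

@[simp] lemma phi_zero : phi f D 0 = AddMonoidAlgebra.single ((1, 0) : MM n) (1 : ℂ) := rfl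
@[simp] lemma phi_succ (i : Fin n) : phi f D i.succ =
    ∑ m ∈ f.support, AddMonoidAlgebra.single (((D : ℤ), vec m) : MM n) ((m i : ℂ) * f.coeff m) := rfl

lemma phi_zero_ne {g : MM n} (h : (phi f D 0).coeff g ≠ 0) : g = (1, 0) := by
  by_contra hg
  apply h
  rw [phi_zero, AddMonoidAlgebra.coeff_single, Finsupp.single_apply, if_neg (fun e => hg e.symm)]

lemma phi_succ_ne {i : Fin n} {g : MM n} (h : (phi f D i.succ).coeff g ≠ 0) :
    ∃ m ∈ f.support, g = ((D : ℤ), vec m) ∧ 1 ≤ m i := by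
  by_contra hcon
  push Not at hcon
  apply h
  rw [phi_succ, AddMonoidAlgebra.coeff_sum, Finsupp.finsetSum_apply]
  apply Finset.sum_eq_zero
  intro m hm
  rw [AddMonoidAlgebra.coeff_single, Finsupp.single_apply]
  split_ifs with he
  · have := hcon m hm he.symm
    have : m i = 0 := by omega
    simp [this]
  · rfl

lemma phi_CC (hF : FacetData f D U) (i : Fin (n + 1)) (g : MM n) (h : (phi f D i).coeff g ≠ 0) : g ∈ CC U := by
  induction i using Fin.cases with
  | zero => rw [phi_zero_ne h]; exact s_mem_CC hF
  | succ i =>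
    obtain ⟨m, hm, rfl, _⟩ := phi_succ_ne h
    exact v_mem_CC hF hm

lemma gen_pack {ι : Type*} (s : Finset ι) (c : ι → ℝ) (g : ι → MM n) (hc : ∀ i ∈ s, 0 ≤ c i)
    (hg : ∀ i ∈ s, g i ∈ CC U) {x : VV n} (hx : x = ∑ i ∈ s, c i • rho (g i)) :
    ∃ (s : Finset (MM n)) (lam : MM n → ℝ), (∀ m ∈ s, 0 ≤ lam m ∧ ∀ j, 0 ≤ uR U j (rho m)) ∧
      x = ∑ m ∈ s, lam m • rho m := by
  classical
  refine ⟨s.image g, fun m => ∑ i ∈ s with g i = m, c i, ?_, ?_⟩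
  · intro m hm
    refine ⟨Finset.sum_nonneg fun i hi => hc i (Finset.mem_filter.1 hi).1, fun j => ?_⟩
    obtain ⟨i, hi, rfl⟩ := Finset.mem_image.1 hm
    rw [uR_rho]; exact_mod_cast hg i hi j
  · rw [hx, ← Finset.sum_fiberwise_of_maps_to (t := s.image g) (g := g) (fun i hi => Finset.mem_image_of_mem _ hi)]
    refine Finset.sum_congr rfl fun m _ => ?_
    rw [Finset.sum_smul]
    refine Finset.sum_congr rfl fun i hi => ?_
    rw [(Finset.mem_filter.1 hi).2]

lemma hGen_aux (hF : FacetData f D U) (x : VV n) (hx : ∀ j, 0 ≤ uR U j x) :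
    ∃ (s : Finset (MM n)) (lam : MM n → ℝ), (∀ m ∈ s, 0 ≤ lam m ∧ ∀ j, 0 ≤ uR U j (rho m)) ∧
      x = ∑ m ∈ s, lam m • rho m := by
  have hLP : LP f (x.1 / D) x.2 := by
    rw [hF.iff x.2 (fun i => hx (Sum.inl i)), mul_div_cancel₀ _ hF.Dpos.ne']
    intro u hu
    have := hx (Sum.inr ⟨u, hu⟩)
    simp at this; linarith
  obtain ⟨lam, hl0, hl1, hl2⟩ := hLP
  refine gen_pack (U := U) (insertNone f.support)
    (fun o => o.elim (x.1 - D * ∑ v ∈ f.support, lam v) lam)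
    (fun o => o.elim (1, 0) (fun v => ((D : ℤ), vec v))) ?_ ?_ ?_
  · rintro (_ | v) hv
    · rw [le_div_iff₀ hF.Dpos] at hl1
      simp; linarith
    · exact hl0 v
  · rintro (_ | v) hv
    · exact s_mem_CC hF
    · exact v_mem_CC hF (by simpa using hv)
  · rw [Finset.sum_insertNone]
    simp only [Option.elim_none, Option.elim_some]
    have h2 : ∀ v : Fin n →₀ ℕ, lam v • rho ((D : ℤ), vec v) = (lam v * D, lam v • toR v) := by
      intro v; ext i <;> simp [rho, vec, toR]
    simp only [h2]
    apply Prod.ext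
    · simp [rho, Prod.fst_sum, ← Finset.sum_mul]; ring
    · simp only [Prod.snd_add, Prod.snd_sum, ← hl2]
      ext i; simp [rho]

/-- The nilpotence property. -/
def Nil (f : MvPolynomial (Fin n) ℂ) (D : ℕ) (U : Finset (Fin n → ℤ)) : Prop :=
  ∀ w, w ∈ CC U → w ≠ 0 → ∃ k ≥ 1, ∃ a : Fin (n+1) → AddMonoidAlgebra ℂ (MM n),
    (∀ i, SIn (CC U : Set (MM n)) (a i)) ∧
      AddMonoidAlgebra.single (k • w) (1 : ℂ) = ∑ i, a i * phi f D i

lemma sweepData (hF : FacetData f D U) (hN : Nil f D U) : SweepData (phi f D) rho (uR U) where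
  hZval := fun j m => ⟨uZ U j m, uR_rho U j m⟩
  hpt := by
    intro x hx
    have h2 : x.2 = 0 := by ext i; exact hx (Sum.inl i)
    have h1 := hx (Sum.inr ⟨0, hF.zero⟩)
    simp at h1
    exact Prod.ext h1 h2
  hφ := by
    intro i g h j
    rw [uR_rho]; exact_mod_cast phi_CC hF i g h j
  hGen := hGen_aux hF
  hnil := by
    intro w hw hw'
    have hset : {m : MM n | ∀ j, 0 ≤ uR U j (rho m)} = (CC U : Set (MM n)) := by
      ext m
      simp only [Set.mem_setOf_eq, SetLike.mem_coe, mem_CC, uR_rho]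
      norm_cast
    rw [hset]
    apply hN w
    · intro j; have := hw j; rw [uR_rho] at this; exact_mod_cast this
    · rintro rfl
      obtain ⟨j, hj⟩ := hw'
      simp at hj

end Setup

end Kz
end ToricNewton

set_option linter.all false
set_option linter.unusedSectionVars false
set_option linter.unusedVariables false
namespace ToricNewton
namespace Kz

open Finset

section Nil
variable {n : ℕ}

/-- A non-nilpotent element of a finite type algebra is detected by a complex point. -/
lemma nil_or_point {R : Type*} [CommRing R] [Algebra ℂ R] [Algebra.FiniteType ℂ R] (I : Ideal R) (a : R)
    (ha : ∀ k : ℕ, a ^ k ∉ I) : ∃ χ : R →ₐ[ℂ] ℂ, (∀ x ∈ I, χ x = 0) ∧ χ a ≠ 0 := by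
  classical
  let S := R ⧸ I
  let b : S := Ideal.Quotient.mk I a
  let L := Localization.Away b
  haveI : Algebra.FiniteType ℂ S := Algebra.FiniteType.of_surjective (Ideal.Quotient.mkₐ ℂ I) (Ideal.Quotient.mkₐ_surjective ℂ I)
  haveI hSL : Algebra.FiniteType S L := IsLocalization.finiteType_of_monoid_fg (Submonoid.powers b) L
  haveI : Algebra.FiniteType ℂ L := Algebra.FiniteType.trans (S := S) inferInstance hSL
  haveI : Nontrivial L := by
    rw [← not_subsingleton_iff_nontrivial]
    intro hsub
    have h0 : (0 : S) ∈ Submonoid.powers b := (IsLocalization.subsingleton_iff (S := L)).1 hsub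
    obtain ⟨k, hk⟩ := h0
    apply ha k
    rw [← Ideal.Quotient.eq_zero_iff_mem, map_pow]
    exact hk
  obtain ⟨m, hm⟩ := Ideal.exists_maximal L
  letI : Field (L ⧸ m) := Ideal.Quotient.field m
  haveI : Algebra.FiniteType ℂ (L ⧸ m) := Algebra.FiniteType.of_surjective (Ideal.Quotient.mkₐ ℂ m) (Ideal.Quotient.mkₐ_surjective ℂ m)
  haveI : Module.Finite ℂ (L ⧸ m) := finite_of_finite_type_of_isJacobsonRing ℂ (L ⧸ m)
  have hbij : Function.Bijective (algebraMap ℂ (L ⧸ m)) := IsAlgClosed.algebraMap_bijective_of_isIntegral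
  let e : ℂ ≃ₐ[ℂ] (L ⧸ m) := AlgEquiv.ofBijective (Algebra.ofId ℂ (L ⧸ m)) hbij
  let ψ : R →ₐ[ℂ] (L ⧸ m) := (Ideal.Quotient.mkₐ ℂ m).comp ((IsScalarTower.toAlgHom ℂ S L).comp (Ideal.Quotient.mkₐ ℂ I))
  refine ⟨(e.symm : (L ⧸ m) →ₐ[ℂ] ℂ).comp ψ, ?_, ?_⟩
  · intro x hx
    have : ψ x = 0 := by
      have h1 : Ideal.Quotient.mkₐ ℂ I x = 0 := by
        rw [Ideal.Quotient.mkₐ_eq_mk]; exact Ideal.Quotient.eq_zero_iff_mem.2 hx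
      simp only [ψ, AlgHom.comp_apply, h1, map_zero]
    simp [AlgHom.comp_apply, this]
  · have hu : IsUnit (algebraMap S L b) := IsLocalization.map_units L (⟨b, Submonoid.mem_powers b⟩ : Submonoid.powers b)
    have hu2 : IsUnit (ψ a) := hu.map (Ideal.Quotient.mkₐ ℂ m)
    simp only [AlgHom.comp_apply]
    have := hu2.ne_zero
    intro h
    exact this ((map_eq_zero_iff e.symm e.symm.injective).1 h)

noncomputable instance divUnits : DivisibleBy (Additive ℂˣ) ℤ := by
  apply divisibleByOfSMulRightSurj
  intro k hk x
  obtain ⟨y, hy⟩ : ∃ y : ℂ, y ^ k.natAbs = ((x.toMul : ℂˣ) : ℂ) :=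
    IsAlgClosed.exists_pow_nat_eq _ (Int.natAbs_pos.2 hk)
  have hy0 : y ≠ 0 := by
    rintro rfl
    rw [zero_pow (Int.natAbs_ne_zero.2 hk)] at hy
    exact (x.toMul).ne_zero hy.symm
  have hyu : (Units.mk0 y hy0) ^ k.natAbs = x.toMul := by ext; simpa using hy
  rcases Int.natAbs_eq k with h | h
  · refine ⟨Additive.ofMul (Units.mk0 y hy0), ?_⟩
    show k • Additive.ofMul (Units.mk0 y hy0) = x
    rw [h, natCast_zsmul, ← ofMul_pow, hyu]; rfl
  · refine ⟨- Additive.ofMul (Units.mk0 y hy0), ?_⟩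
    show k • (- Additive.ofMul (Units.mk0 y hy0)) = x
    rw [h, neg_smul, smul_neg, neg_neg, natCast_zsmul, ← ofMul_pow, hyu]; rfl

/-- Extend a multiplicative function on a submonoid of a group to a torus character. -/
lemma extend_char {M : Type*} [AddCommGroup M] (S : AddSubmonoid M) (h : M → ℂ) (h0 : h 0 = 1)
    (hadd : ∀ a ∈ S, ∀ b ∈ S, h (a + b) = h a * h b) (hne : ∀ a ∈ S, h a ≠ 0) :
    ∃ F : M →+ Additive ℂˣ, ∀ a ∈ S, (((F a).toMul : ℂˣ) : ℂ) = h a := by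
  classical
  let hu : M → Additive ℂˣ := fun a => if ha : h a ≠ 0 then Additive.ofMul (Units.mk0 (h a) ha) else 0
  have huv : ∀ a ∈ S, (((hu a).toMul : ℂˣ) : ℂ) = h a := by
    intro a ha; simp only [hu, dif_pos (hne a ha)]; rfl
  have huadd : ∀ a ∈ S, ∀ b ∈ S, hu (a + b) = hu a + hu b := by
    intro a ha b hb
    apply Additive.toMul.injective
    ext
    rw [huv _ (add_mem ha hb), toMul_add, Units.val_mul, huv a ha, huv b hb, hadd a ha b hb]
  let G : AddSubgroup M :=
    { carrier := {g | ∃ a ∈ S, ∃ b ∈ S, g = a - b}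
      zero_mem' := ⟨0, zero_mem _, 0, zero_mem _, by simp⟩
      add_mem' := by
        rintro _ _ ⟨a, ha, b, hb, rfl⟩ ⟨c, hc, d, hd, rfl⟩
        exact ⟨a + c, add_mem ha hc, b + d, add_mem hb hd, by abel⟩
      neg_mem' := by
        rintro _ ⟨a, ha, b, hb, rfl⟩
        exact ⟨b, hb, a, ha, by abel⟩ }
  have hG : ∀ g : G, ∃ a ∈ S, ∃ b ∈ S, (g : M) = a - b := fun g => g.2
  choose A hA B hB hAB using hG
  have wd : ∀ a ∈ S, ∀ b ∈ S, ∀ c ∈ S, ∀ d ∈ S, a - b = c - d → hu a - hu b = hu c - hu d := by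
    intro a ha b hb c hc d hd he
    have h1 : a + d = c + b := by
      have := congrArg (fun t => t + b + d) he
      have h2 : a - b + b + d = a + d := by abel
      have h3 : c - d + b + d = c + b := by abel
      exact h2.symm.trans (this.trans h3)
    have h2 := huadd a ha d hd
    have h3 := huadd c hc b hb
    rw [h1, h3] at h2
    rw [sub_eq_sub_iff_add_eq_add, ← h2]
  let F0 : G →+ Additive ℂˣ :=
    { toFun := fun g => hu (A g) - hu (B g)
      map_zero' := by
        have := wd (A 0) (hA 0) (B 0) (hB 0) 0 (zero_mem _) 0 (zero_mem _) (by rw [← hAB]; simp)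
        rw [this]; simp
      map_add' := by
        intro x y
        have := wd (A (x + y)) (hA _) (B (x + y)) (hB _) (A x + A y) (add_mem (hA _) (hA _)) (B x + B y)
          (add_mem (hB _) (hB _)) (by rw [← hAB, AddSubgroup.coe_add, hAB x, hAB y]; abel)
        rw [this, huadd _ (hA _) _ (hA _), huadd _ (hB _) _ (hB _)]; abel }
  obtain ⟨F, hF⟩ := (Module.Baer.of_divisible (Additive ℂˣ)).extension_property_addMonoidHom
    G.subtype G.subtype_injective F0
  refine ⟨F, fun a ha => ?_⟩
  have haG : a ∈ G := ⟨a, ha, 0, zero_mem _, by simp⟩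
  have h1 : F a = F0 ⟨a, haG⟩ := DFunLike.congr_fun hF ⟨a, haG⟩
  have h2 : F0 ⟨a, haG⟩ = hu a - hu 0 := wd _ (hA _) _ (hB _) a ha 0 (zero_mem _) (by rw [← hAB]; simp)
  have h3 : hu 0 = 0 := by
    have := huadd 0 (zero_mem _) 0 (zero_mem _)
    rw [add_zero] at this
    exact left_eq_add.1 this
  rw [h1, h2, h3, sub_zero, huv a ha]

variable {f : MvPolynomial (Fin n) ℂ} {D : ℕ} {U : Finset (Fin n → ℤ)}

lemma coeff_X_pderiv {σ : Type*} [Fintype σ] [DecidableEq σ] (f : MvPolynomial σ ℂ) (i : σ) (m : σ →₀ ℕ) :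
    (MvPolynomial.X i * MvPolynomial.pderiv i f).coeff m = (m i : ℂ) * f.coeff m := by
  classical
  induction f using MvPolynomial.induction_on' with
  | monomial u a =>
    rw [MvPolynomial.pderiv_monomial, MvPolynomial.X, MvPolynomial.monomial_mul, MvPolynomial.coeff_monomial, MvPolynomial.coeff_monomial]
    by_cases hu : u i = 0
    · by_cases hum : u = m
      · subst hum; simp [hu]
      · simp [hu, hum]
    · have : Finsupp.single i 1 + (u - Finsupp.single i 1) = u := by
        rw [add_comm]
        apply tsub_add_cancel_of_le
        rw [Finsupp.single_le_iff]; omega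
      rw [this]
      split_ifs with hum
      · subst hum; ring
      · simp
  | add p q hp hq => simp only [map_add, mul_add, MvPolynomial.coeff_add, hp, hq]

open Classical in
lemma eval_faceRestrict {σ : Type*} [Fintype σ] [DecidableEq σ] (f : MvPolynomial σ ℂ) (i : σ) (Δ : Set (σ → ℝ)) (x : σ → ℂ) :
    MvPolynomial.eval x (faceRestrict Δ (MvPolynomial.X i * MvPolynomial.pderiv i f)) =
      ∑ m ∈ f.support, if toR m ∈ Δ then (m i : ℂ) * f.coeff m * ∏ j, x j ^ m j else 0 := by
  have hsub : (MvPolynomial.X i * MvPolynomial.pderiv i f).support ⊆ f.support := by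
    intro m hm
    rw [MvPolynomial.mem_support_iff, coeff_X_pderiv] at hm
    rw [MvPolynomial.mem_support_iff]
    exact right_ne_zero_of_mul hm
  rw [faceRestrict, map_sum]
  rw [Finset.sum_subset hsub]
  · refine Finset.sum_congr rfl fun m hm => ?_
    split_ifs
    · rw [MvPolynomial.eval_monomial, coeff_X_pderiv, Finsupp.prod_fintype _ _ (fun i => by simp)]
    · simp
  · intro m _ hm
    rw [MvPolynomial.notMem_support_iff] at hm
    rw [hm]; simp

lemma degenerate_of_char (hF : FacetData f D U) (h : MM n → ℂ) (h0 : h 0 = 1)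
    (hadd : ∀ a ∈ CC U, ∀ b ∈ CC U, h (a + b) = h a * h b) (hs : h (1, 0) = 0)
    (hΦ : ∀ i : Fin n, ∑ m ∈ f.support, (m i : ℂ) * f.coeff m * h ((D : ℤ), vec m) = 0)
    (w0 : MM n) (hw0 : w0 ∈ CC U) (hw00 : w0 ≠ 0) (hhw0 : h w0 ≠ 0) : ¬ Nondegenerate f := by
  classical
  -- the submonoid where `h` does not vanish
  let Sg : AddSubmonoid (MM n) :=
    { carrier := {c | c ∈ CC U ∧ h c ≠ 0}
      zero_mem' := ⟨zero_mem _, by rw [h0]; exact one_ne_zero⟩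
      add_mem' := by
        rintro a b ⟨ha, ha'⟩ ⟨hb, hb'⟩
        exact ⟨add_mem ha hb, by rw [hadd a ha b hb]; exact mul_ne_zero ha' hb'⟩ }
  have hprime : ∀ a ∈ CC U, ∀ b ∈ CC U, a + b ∈ Sg → a ∈ Sg := by
    intro a ha b hb hab
    refine ⟨ha, fun h1 => hab.2 ?_⟩
    rw [hadd a ha b hb, h1, zero_mul]
  let W : Finset (Fin n →₀ ℕ) := f.support.filter (fun m => (((D : ℤ), vec m) : MM n) ∈ Sg)
  set w : MM n := w0 + ∑ m ∈ W, (((D : ℤ), vec m) : MM n) with hw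
  have hwS : w ∈ Sg := add_mem ⟨hw0, hhw0⟩ (sum_mem fun m hm => (Finset.mem_filter.1 hm).2)
  have hw1 : 0 < w.1 := by
    have h1 := CC_fst_pos hF hw0 hw00
    have h2 : 0 ≤ (∑ m ∈ W, (((D : ℤ), vec m) : MM n)).1 := by
      rw [Prod.fst_sum]; exact Finset.sum_nonneg fun m _ => by simp
    rw [hw, Prod.fst_add]; linarith
  have hwC : w ∈ CC U := hwS.1
  let Act : Finset (Fin n → ℤ) := U.filter (fun u => ∑ i, u i * w.2 i = w.1)
  have hAct : Act.Nonempty := by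
    by_contra hcon
    rw [Finset.not_nonempty_iff_eq_empty, Finset.filter_eq_empty_iff] at hcon
    have h1 : w - (1, 0) ∈ CC U := by
      rw [mem_CC']
      refine ⟨fun i => by simpa using (mem_CC'.1 hwC).1 i, fun u hu => ?_⟩
      have h2 := (mem_CC'.1 hwC).2 u hu
      have h3 := hcon hu
      have h4 : ∑ i, u i * w.2 i < w.1 := lt_of_le_of_ne h2 h3
      simp only [Prod.snd_sub, Prod.fst_sub, sub_zero]
      linarith
    have h5 := hprime _ (s_mem_CC hF) _ h1 (by rw [add_sub_cancel]; exact hwS)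
    exact h5.2 hs
  let Z : Finset (Fin n) := univ.filter (fun i => w.2 i = 0)
  let l : (Fin n → ℝ) →ₗ[ℝ] ℝ := ∑ u ∈ Act, ∑ i, (u i : ℝ) • LinearMap.proj i - ∑ i ∈ Z, LinearMap.proj i
  have hl : ∀ x, l x = ∑ u ∈ Act, ∑ i, (u i : ℝ) * x i - ∑ i ∈ Z, x i := by intro x; simp [l]
  let c : ℝ := Act.card * D
  have hPx : ∀ x ∈ newtonPolytope f, (∀ i, 0 ≤ x i) ∧ ∀ u ∈ U, ∑ i, (u i : ℝ) * x i ≤ D := by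
    intro x hx
    have hx' := mem_P_iff.1 hx
    have hx0 : ∀ i, 0 ≤ x i := by
      obtain ⟨lam, a, b, rfl⟩ := hx'
      intro i
      simp only [Finset.sum_apply, Pi.smul_apply, smul_eq_mul]
      exact Finset.sum_nonneg fun m _ => mul_nonneg (a m) (by simp [toR])
    refine ⟨hx0, ?_⟩
    have := (hF.iff x hx0 1).1 hx'
    simpa using this
  have hsum1 : ∀ x ∈ newtonPolytope f, ∑ u ∈ Act, ∑ i, (u i : ℝ) * x i ≤ c := by
    intro x hx
    have : c = ∑ u ∈ Act, (D : ℝ) := by simp [c]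
    rw [this]
    exact Finset.sum_le_sum fun u hu => (hPx x hx).2 u (Finset.mem_filter.1 hu).1
  have hsum2 : ∀ x ∈ newtonPolytope f, 0 ≤ ∑ i ∈ Z, x i := fun x hx =>
    Finset.sum_nonneg fun i _ => (hPx x hx).1 i
  have hle : ∀ x ∈ newtonPolytope f, l x ≤ c := by
    intro x hx; rw [hl]; linarith [hsum1 x hx, hsum2 x hx]
  have heq : ∀ x ∈ newtonPolytope f, l x = c ↔ (∀ u ∈ Act, ∑ i, (u i : ℝ) * x i = D) ∧ ∀ i ∈ Z, x i = 0 := by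
    intro x hx
    constructor
    · intro h1
      rw [hl] at h1
      have h2 : ∑ u ∈ Act, ∑ i, (u i : ℝ) * x i = ∑ u ∈ Act, (D : ℝ) := by
        have : c = ∑ u ∈ Act, (D : ℝ) := by simp [c]
        rw [← this]; linarith [hsum1 x hx, hsum2 x hx]
      have h3 : ∑ i ∈ Z, x i = 0 := by linarith [hsum1 x hx, hsum2 x hx]
      exact ⟨(Finset.sum_eq_sum_iff_of_le fun u hu => (hPx x hx).2 u (Finset.mem_filter.1 hu).1).1 h2,
        (Finset.sum_eq_zero_iff_of_nonneg fun i _ => (hPx x hx).1 i).1 h3⟩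
    · rintro ⟨h1, h2⟩
      rw [hl, Finset.sum_congr rfl h1, Finset.sum_eq_zero h2]
      simp [c]
  let Δ : Set (Fin n → ℝ) := {x ∈ newtonPolytope f | l x = c}
  have hcpos : 0 < c := mul_pos (by exact_mod_cast Finset.card_pos.2 hAct) hF.Dpos
  have hface : NBFace f Δ := by
    refine ⟨⟨?_, l, c, hle, rfl⟩, ?_⟩
    · have hw1r : (0 : ℝ) < w.1 := by exact_mod_cast hw1
      have hr : (0 : ℝ) < w.1 / D := div_pos hw1r hF.Dpos
      have h1 := (mem_smul_P_iff hr).2 ((mem_CC_LP hF).1 hwC).2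
      rw [Set.mem_smul_set_iff_inv_smul_mem₀ hr.ne'] at h1
      refine ⟨_, h1, ?_⟩
      rw [map_smul, hl]
      have h2 : ∀ u ∈ Act, ∑ i, (u i : ℝ) * (w.2 i : ℝ) = w.1 := by
        intro u hu
        exact_mod_cast (Finset.mem_filter.1 hu).2
      have h3 : ∀ i ∈ Z, (w.2 i : ℝ) = 0 := by
        intro i hi
        exact_mod_cast (Finset.mem_filter.1 hi).2
      rw [Finset.sum_congr rfl h2, Finset.sum_eq_zero h3]
      have := hF.Dpos.ne'
      simp [c]
      field_simp
    · rintro ⟨_, h1⟩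
      rw [map_zero] at h1
      exact hcpos.ne h1
  have hmem : ∀ m ∈ f.support, (toR m ∈ Δ ↔ (((D : ℤ), vec m) : MM n) ∈ Sg) := by
    intro m hm
    have hvC := v_mem_CC hF hm
    constructor
    · rintro ⟨hP, h1⟩
      rw [heq _ hP] at h1
      have hz : ∀ j, uZ U j w = 0 → uZ U j ((D : ℤ), vec m) = 0 := by
        rintro (i | u) hj
        · have := h1.2 i (Finset.mem_filter.2 ⟨Finset.mem_univ _, hj⟩)
          simp only [toR] at this
          simp only [uZ_inl, vec]
          exact_mod_cast this
        · simp only [uZ_inr] at hj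
          have := h1.1 u.1 (Finset.mem_filter.2 ⟨u.2, by linarith⟩)
          simp only [uZ_inr, vec]
          simp only [toR] at this
          rw [sub_eq_zero]
          exact_mod_cast this.symm
      set N : ℕ := ∑ j, (uZ U j ((D : ℤ), vec m)).toNat with hN
      have hNw : N • w - ((D : ℤ), vec m) ∈ CC U := by
        intro j
        rw [map_sub, map_nsmul, nsmul_eq_mul]
        rcases (hwC j).lt_or_eq with h2 | h2
        · have h3 : (uZ U j ((D : ℤ), vec m)).toNat ≤ N :=
            Finset.single_le_sum (f := fun j => (uZ U j ((D : ℤ), vec m)).toNat) (fun _ _ => Nat.zero_le _) (Finset.mem_univ j)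
          have h4 : uZ U j ((D : ℤ), vec m) ≤ N := by
            have := Int.self_le_toNat (uZ U j ((D : ℤ), vec m))
            have h5 : ((uZ U j ((D : ℤ), vec m)).toNat : ℤ) ≤ N := by exact_mod_cast h3
            linarith
          have h5 : (0 : ℤ) ≤ N := by positivity
          nlinarith
        · rw [hz j h2.symm, ← h2]; simp
      refine hprime _ hvC _ hNw ?_
      rw [add_sub_cancel]
      exact nsmul_mem hwS N
    · intro hS
      have hmW : m ∈ W := Finset.mem_filter.2 ⟨hm, hS⟩
      have hz : ∀ j, uZ U j w = 0 → uZ U j ((D : ℤ), vec m) = 0 := by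
        intro j hj
        rw [hw, map_add, map_sum] at hj
        have hnn : ∀ m ∈ W, 0 ≤ uZ U j ((D : ℤ), vec m) := fun m hm =>
          v_mem_CC hF (Finset.mem_filter.1 hm).1 j
        have h2 := Finset.sum_nonneg hnn
        have h3 := hw0 j
        exact (Finset.sum_eq_zero_iff_of_nonneg hnn).1 (by linarith) m hmW
      refine ⟨toR_mem_P hm, (heq _ (toR_mem_P hm)).2 ⟨fun u hu => ?_, fun i hi => ?_⟩⟩
      · have := hz (Sum.inr ⟨u, (Finset.mem_filter.1 hu).1⟩) (by
          simp only [uZ_inr]; rw [(Finset.mem_filter.1 hu).2, sub_self])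
        simp only [uZ_inr, vec] at this
        simp only [toR]
        rw [sub_eq_zero] at this
        exact_mod_cast this.symm
      · have := hz (Sum.inl i) (Finset.mem_filter.1 hi).2
        simp only [uZ_inl, vec] at this
        simp only [toR]
        exact_mod_cast this
  obtain ⟨F, hFv⟩ := extend_char Sg h h0 (fun a ha b hb => hadd a ha.1 b hb.1) (fun a ha => ha.2)
  intro hnd
  let x : Fin n → ℂ := fun i => (((F (0, Pi.single i 1)).toMul : ℂˣ) : ℂ)
  have hFm : ∀ m : Fin n →₀ ℕ, (((F ((D : ℤ), vec m)).toMul : ℂˣ) : ℂ) =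
      (((F ((D : ℤ), 0)).toMul : ℂˣ) : ℂ) * ∏ j, x j ^ m j := by
    intro m
    have h1 : (((D : ℤ), vec m) : MM n) = ((D : ℤ), 0) + ∑ j, (m j) • ((0, Pi.single j 1) : MM n) := by
      apply Prod.ext
      · simp [Prod.fst_sum]
      · simp only [Prod.snd_add, Prod.snd_sum, Prod.smul_snd, zero_add]
        ext i
        simp [vec, Finset.sum_apply, Pi.single_apply]
    rw [h1, map_add, map_sum, toMul_add, Units.val_mul, toMul_sum, Units.coe_prod]
    congr 1
    refine Finset.prod_congr rfl fun j _ => ?_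
    rw [map_nsmul, toMul_nsmul, Units.val_pow_eq_pow_val]
  apply hnd Δ hface
  refine ⟨x, fun i => Units.ne_zero _, fun i => ?_⟩
  rw [eval_faceRestrict]
  have h1 := hΦ i
  have h2 : ∑ m ∈ f.support, (m i : ℂ) * f.coeff m * h ((D : ℤ), vec m) =
      (((F ((D : ℤ), 0)).toMul : ℂˣ) : ℂ) * ∑ m ∈ f.support, if toR m ∈ Δ then (m i : ℂ) * f.coeff m * ∏ j, x j ^ m j else 0 := by
    rw [Finset.mul_sum]
    refine Finset.sum_congr rfl fun m hm => ?_
    split_ifs with hd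
    · rw [← hFv _ ((hmem m hm).1 hd), hFm]; ring
    · have : h ((D : ℤ), vec m) = 0 := by
        by_contra hne
        exact hd ((hmem m hm).2 ⟨v_mem_CC hF hm, hne⟩)
      rw [this]; simp
  rw [h1] at h2
  convert (mul_eq_zero.1 h2.symm).resolve_left (Units.ne_zero _)

theorem nil_of_nondegenerate (hF : FacetData f D U) (hnd : Nondegenerate f) : Nil f D U := by
  classical
  intro w hw hw0
  haveI : AddMonoid.FG (CC U) := (AddMonoid.fg_iff_addSubmonoid_fg _).2 (CC_fg hF)
  let φS : Fin (n + 1) → AddMonoidAlgebra ℂ (CC U) :=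
    Fin.cons (AddMonoidAlgebra.single ⟨(1, 0), s_mem_CC hF⟩ (1 : ℂ))
      (fun i => ∑ m ∈ f.support.attach, AddMonoidAlgebra.single (⟨((D : ℤ), vec m.1), v_mem_CC hF m.2⟩ : CC U)
        ((m.1 i : ℂ) * f.coeff m.1))
  let j : AddMonoidAlgebra ℂ (CC U) →+* AddMonoidAlgebra ℂ (MM n) := AddMonoidAlgebra.mapDomainRingHom ℂ (CC U).subtype
  have hjs : ∀ (c : CC U) (z : ℂ), j (AddMonoidAlgebra.single c z) = AddMonoidAlgebra.single (c : MM n) z := by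
    intro c z; simp [j]
  have hjφ : ∀ i, j (φS i) = phi f D i := by
    intro i
    induction i using Fin.cases with
    | zero => simp only [φS, Fin.cons_zero, hjs, phi_zero]
    | succ i =>
      simp only [φS, Fin.cons_succ, map_sum, hjs, phi_succ]
      rw [← Finset.sum_attach f.support]
  have hjS : ∀ a, SIn (CC U : Set (MM n)) (j a) := by
    intro a
    induction a using AddMonoidAlgebra.induction_linear with
    | zero => rw [map_zero]; exact SIn.zero _
    | add a b ha hb => rw [map_add]; exact ha.add hb
    | single c z =>
      rw [hjs]; intro m hm
      rw [AddMonoidAlgebra.coeff_single, Finsupp.single_apply] at hm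
      split_ifs at hm with he
      · rw [← he]; exact c.2
      · exact absurd rfl hm
  by_cases hk : ∃ k : ℕ, (AddMonoidAlgebra.single (⟨w, hw⟩ : CC U) (1 : ℂ)) ^ k ∈ Ideal.span (Set.range φS)
  · obtain ⟨k, hk⟩ := hk
    have hk' := Ideal.mul_mem_left _ (AddMonoidAlgebra.single (⟨w, hw⟩ : CC U) (1 : ℂ)) hk
    rw [← pow_succ'] at hk'
    obtain ⟨a, ha⟩ := Ideal.mem_span_range_iff_exists_fun.1 hk'
    refine ⟨k + 1, by omega, fun i => j (a i), fun i => hjS _, ?_⟩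
    have := congrArg j ha
    rw [map_sum, map_pow, hjs, AddMonoidAlgebra.single_pow, one_pow] at this
    rw [← this]
    refine Finset.sum_congr rfl fun i _ => ?_
    rw [map_mul, hjφ]
  · exfalso
    push Not at hk
    obtain ⟨χ, hχI, hχ⟩ := nil_or_point (Ideal.span (Set.range φS)) _ hk
    have hχφ : ∀ i, χ (φS i) = 0 := fun i => hχI _ (Ideal.subset_span ⟨i, rfl⟩)
    let h : MM n → ℂ := fun c => if hc : c ∈ CC U then χ (AddMonoidAlgebra.single ⟨c, hc⟩ 1) else 0
    refine degenerate_of_char hF h ?_ ?_ ?_ ?_ w hw hw0 ?_ hnd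
    · simp only [h, dif_pos (zero_mem (CC U))]
      exact map_one χ
    · intro a ha b hb
      simp only [h, dif_pos ha, dif_pos hb, dif_pos (add_mem ha hb)]
      rw [← map_mul, AddMonoidAlgebra.single_mul_single, one_mul]; rfl
    · simp only [h, dif_pos (s_mem_CC hF)]
      exact hχφ 0
    · intro i
      have := hχφ i.succ
      simp only [φS, Fin.cons_succ, map_sum] at this
      rw [← Finset.sum_attach f.support, ← this]
      refine Finset.sum_congr rfl fun m _ => ?_
      simp only [h, dif_pos (v_mem_CC hF m.2)]
      rw [← smul_eq_mul, ← map_smul, AddMonoidAlgebra.smul_single, smul_eq_mul, mul_one]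
    · simp only [h, dif_pos hw]; exact hχ

end Nil

end Kz
end ToricNewton

set_option linter.all false
set_option linter.unusedSectionVars false
set_option linter.unusedVariables false
namespace ToricNewton
namespace Kz

open Finset

section Blocks
variable {n : ℕ} {f : MvPolynomial (Fin n) ℂ} {D : ℕ} {U : Finset (Fin n → ℤ)}

/-- weight of a generator -/
def wtg (D : ℕ) (t : Fin (n + 1)) : ℤ := if t = 0 then 1 else D

/-- weight of a set of generators -/
def wt (D : ℕ) (I : Finset (Fin (n + 1))) : ℤ := ∑ t ∈ I, wtg D t

lemma wt_insert {i : Fin (n + 1)} {I : Finset (Fin (n + 1))} (h : i ∉ I) :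
    wt D (insert i I) = wtg D i + wt D I := by
  rw [wt, Finset.sum_insert h, wt]

lemma phi_deg {i : Fin (n + 1)} {g : MM n} (h : (phi f D i).coeff g ≠ 0) : g.1 = wtg D i := by
  induction i using Fin.cases with
  | zero => rw [phi_zero_ne h]; simp [wtg]
  | succ i =>
    obtain ⟨m, hm, rfl, _⟩ := phi_succ_ne h
    simp [wtg]

/-- The supports of the graded Koszul blocks. -/
def BB (D : ℕ) (U : Finset (Fin n → ℤ)) (κ : ℤ) (K J : Finset (Fin n)) (I : Finset (Fin (n + 1))) : Set (MM n) :=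
  {m | m ∈ CC U ∧ (∀ j ∈ J, j.succ ∉ I) ∧ (∀ j ∈ J, m.2 j = 0) ∧ (∀ l ∈ K, l.succ ∉ I → 1 ≤ m.2 l) ∧
    m.1 + wt D I = κ}

lemma CC_snd {m : MM n} (h : m ∈ CC U) (i : Fin n) : 0 ≤ m.2 i := (mem_CC'.1 h).1 i

lemma phi_succ_pos {l : Fin n} {g : MM n} (h : (phi f D l.succ).coeff g ≠ 0) : 1 ≤ g.2 l := by
  obtain ⟨m, _, rfl, h1⟩ := phi_succ_ne h
  show 1 ≤ (m l : ℤ)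
  exact_mod_cast h1

lemma lc_BB (hF : FacetData f D U) (κ : ℤ) (K J : Finset (Fin n)) : LC (phi f D) (BB D U κ K J) := by
  intro I i j hi hj hij m hm g g' hg hg' hmg
  obtain ⟨h1, h2, h3, h4, h5⟩ := hm
  obtain ⟨_, _, k3, _, k5⟩ := hmg
  have hgC := phi_CC hF _ _ hg
  have hgC' := phi_CC hF _ _ hg'
  refine ⟨add_mem h1 hgC', fun l hl hl' => h2 l hl (Finset.mem_insert_of_mem hl'), ?_, ?_, ?_⟩
  · intro l hl
    have a1 := h3 l hl
    have a2 := k3 l hl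
    have a3 := CC_snd hgC l
    have a4 := CC_snd hgC' l
    simp only [Prod.snd_add, Pi.add_apply] at a2 ⊢
    omega
  · intro l hl hl'
    have a4 := CC_snd hgC' l
    have a1 := CC_snd h1 l
    simp only [Prod.snd_add, Pi.add_apply]
    by_cases hlj : l.succ = j
    · subst hlj
      have := phi_succ_pos hg'
      omega
    · have := h4 l hl (by rw [Finset.mem_insert]; tauto)
      omega
  · rw [wt_insert (by rw [Finset.mem_insert]; tauto)] at h5
    have := phi_deg hg'
    simp only [Prod.fst_add]
    omega

lemma cl_BB (hF : FacetData f D U) (κ : ℤ) (K J : Finset (Fin n)) (k : Fin n) :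
    Cl (phi f D) (BB D U κ (insert k K) J) (BB D U κ K J) := by
  refine ⟨fun I m hm => ⟨hm.1, hm.2.1, hm.2.2.1, fun l hl => hm.2.2.2.1 l (Finset.mem_insert_of_mem hl), hm.2.2.2.2⟩, ?_⟩
  intro I i hi m hm g hg hmg
  obtain ⟨h1, h2, h3, h4, h5⟩ := hm
  obtain ⟨k1, k2, k3, k4, k5⟩ := hmg
  have hgC := phi_CC hF _ _ hg
  refine ⟨k1, k2, k3, ?_, k5⟩
  intro l hl hl'
  rcases Finset.mem_insert.1 hl with rfl | hl2
  · have a4 := CC_snd hgC l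
    have a1 := CC_snd h1 l
    simp only [Prod.snd_add, Pi.add_apply]
    by_cases hlj : l.succ = i
    · subst hlj
      have := phi_succ_pos hg
      omega
    · have := h4 l hl (by rw [Finset.mem_insert]; tauto)
      omega
  · exact k4 l hl2 hl'

lemma dif_BB (κ : ℤ) (K J : Finset (Fin n)) (k : Fin n) :
    dif (BB D U κ K J) (BB D U κ (insert k K) J) = BB D U κ K (insert k J) := by
  funext I
  ext m
  constructor
  · rintro ⟨⟨h1, h2, h3, h4, h5⟩, hn⟩
    have : k.succ ∉ I ∧ m.2 k = 0 := by
      by_contra hc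
      apply hn
      refine ⟨h1, h2, h3, ?_, h5⟩
      intro l hl hl'
      rcases Finset.mem_insert.1 hl with rfl | hl2
      · have := CC_snd h1 l
        by_contra h0
        exact hc ⟨hl', by omega⟩
      · exact h4 l hl2 hl'
    refine ⟨h1, ?_, ?_, h4, h5⟩
    · intro j hj; rcases Finset.mem_insert.1 hj with rfl | hj
      · exact this.1
      · exact h2 j hj
    · intro j hj; rcases Finset.mem_insert.1 hj with rfl | hj
      · exact this.2
      · exact h3 j hj
  · rintro ⟨h1, h2, h3, h4, h5⟩
    refine ⟨⟨h1, fun j hj => h2 j (Finset.mem_insert_of_mem hj), fun j hj => h3 j (Finset.mem_insert_of_mem hj), h4, h5⟩, ?_⟩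
    rintro ⟨_, _, _, a4, _⟩
    have := a4 k (Finset.mem_insert_self _ _) (h2 k (Finset.mem_insert_self _ _))
    rw [h3 k (Finset.mem_insert_self _ _)] at this
    omega

lemma ex_summand {M : Type*} [AddCommGroup M] {T : Type*} [LinearOrder T] [Fintype T]
    {φ : T → AddMonoidAlgebra ℂ M} {B B' : Finset T → Set M} (h : Cl φ B' B) (h' : Cl φ (dif B B') B) {p : ℕ}
    (hE : Ex φ B p) : Ex φ B' p := by
  have hdd : dif B (dif B B') = B' := by
    funext I; ext m
    constructor
    · rintro ⟨h1, h2⟩; by_contra h3; exact h2 ⟨h1, h3⟩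
    · intro h1; exact ⟨h.1 I h1, fun h2 => h2.2 h1⟩
  intro c hc hp hcc
  obtain ⟨b, hb1, hb2, hb3⟩ := hE c (hc.mono h.1) hp (by rw [td_eq_of_cl φ h hc, hcc])
  refine ⟨prB B' b, prB_inB _ _, prB_hom hb2, ?_⟩
  have := td_dif φ h' hb1
  rw [hdd] at this
  rw [this, hb3, prB_self hc]

lemma finrank_VE_ge {V : Type*} [AddCommGroup V] [Module ℝ V] [FiniteDimensional ℝ V] {J : Type*} [Fintype J]
    [DecidableEq J] (u : J → V →ₗ[ℝ] ℝ) (E : Finset J) :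
    Module.finrank ℝ V ≤ Module.finrank ℝ (VE u E) + E.card := by
  induction E using Finset.induction_on with
  | empty =>
    have : VE u ∅ = ⊤ := by ext x; simp [mem_VE]
    rw [this]; simp
  | insert j E hj ih =>
    rw [Finset.card_insert_of_notMem hj]
    have h1 := finrank_inf_ker_le (VE u E) (u j)
    have h2 : VE u (insert j E) = VE u E ⊓ LinearMap.ker (u j) := by
      ext x
      simp only [mem_VE, Submodule.mem_inf, LinearMap.mem_ker, Finset.forall_mem_insert]
      tauto
    rw [h2]; omega

lemma ex_base (hF : FacetData f D U) (hN : Nil f D U) (J : Finset (Fin n)) {p : ℕ} (hp : 1 ≤ p) :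
    Ex (phi f D) (cube (Finset.univ.filter fun t => ∀ j ∈ J, j.succ ≠ t)
      (DD rho (uR U) 0 (J.image Sum.inl))) p := by
  classical
  apply sweep (sweepData hF hN) (E0 := J.image Sum.inl) ?_ _ _ _ _ rfl subset_rfl ?_ ?_
  · intro i hi g hg
    simp only [Finset.mem_filter, Finset.mem_univ, true_and, not_forall, not_not] at hi
    obtain ⟨j, hj, rfl⟩ := hi
    refine ⟨Sum.inl j, Finset.mem_image_of_mem _ hj, ?_⟩
    rw [uR_rho, uZ_inl]
    have := phi_succ_pos hg
    exact_mod_cast (by omega : 0 < g.2 j)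
  · set y2 : Fin n → ℤ := fun i => if i ∈ J then 0 else 1 with hy2
    set y1 : ℤ := 1 + ∑ u ∈ U, |∑ i, u i * y2 i| with hy1
    refine ⟨(y1, y2), ?_, ?_⟩
    · intro j hj
      obtain ⟨i, hi, rfl⟩ := Finset.mem_image.1 hj
      rw [uR_rho, uZ_inl]; simp [hy2, hi]
    · rintro (i | u) hj
      · rw [uR_rho, uZ_inl]
        have : i ∉ J := fun h => hj (Finset.mem_image_of_mem _ h)
        simp [hy2, this]
      · rw [uR_rho, uZ_inr]
        have h1 := Finset.single_le_sum (f := fun u : Fin n → ℤ => |∑ i, u i * y2 i|) (s := U)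
          (fun u _ => abs_nonneg _) u.2
        have h2 := le_abs_self (∑ i, u.1 i * y2 i)
        have : 0 < y1 - ∑ i, u.1 i * y2 i := by rw [hy1]; linarith
        exact_mod_cast this
  · have h1 := finrank_VE_ge (uR U) (J.image Sum.inl)
    have h2 : Module.finrank ℝ (VV n) = n + 1 := by simp [VV]; ring
    have h3 : (J.image (Sum.inl : Fin n → Fin n ⊕ U)).card = J.card :=
      Finset.card_image_of_injective _ Sum.inl_injective
    have h4 : (Finset.univ.filter fun t : Fin (n+1) => ∀ j ∈ J, j.succ ≠ t) = (J.image Fin.succ)ᶜ := by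
      ext t; simp
    have h5 : (J.image Fin.succ).card = J.card := Finset.card_image_of_injective _ (Fin.succ_injective n)
    have h6 : ((J.image Fin.succ)ᶜ).card = n + 1 - J.card := by rw [Finset.card_compl, h5, Fintype.card_fin]
    rw [h4, h6]
    have : J.card ≤ n := by simpa using J.card_le_univ
    omega

lemma ex_BB_empty (hF : FacetData f D U) (hN : Nil f D U) (κ : ℤ) (J : Finset (Fin n)) {p : ℕ} (hp : 1 ≤ p) :
    Ex (phi f D) (BB D U κ ∅ J) p := by
  classical
  have key : ∀ I m, m ∈ cube (Finset.univ.filter fun t => ∀ j ∈ J, j.succ ≠ t)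
      (DD rho (uR U) 0 (J.image Sum.inl)) I ↔ m ∈ CC U ∧ (∀ j ∈ J, j.succ ∉ I) ∧ (∀ j ∈ J, m.2 j = 0) := by
    intro I m
    simp only [cube, DD, Set.mem_setOf_eq, map_zero, uR_rho]
    constructor
    · rintro ⟨h1, h2⟩
      refine ⟨fun j => by exact_mod_cast (h2 j).1, ?_, ?_⟩
      · intro j hj hjI
        have := h1 hjI
        simp only [Finset.mem_filter] at this
        exact this.2 j hj rfl
      · intro j hj
        have := (h2 (Sum.inl j)).2 (Finset.mem_image_of_mem _ hj)
        rw [uZ_inl] at this; exact_mod_cast this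
    · rintro ⟨h1, h2, h3⟩
      refine ⟨?_, ?_⟩
      · intro t ht
        simp only [Finset.mem_filter, Finset.mem_univ, true_and]
        rintro j hj rfl
        exact h2 j hj ht
      · intro j
        refine ⟨by exact_mod_cast h1 j, ?_⟩
        intro hj
        obtain ⟨i, hi, rfl⟩ := Finset.mem_image.1 hj
        rw [uZ_inl, h3 i hi]; simp
  have hdeg : ∀ (I : Finset (Fin (n+1))) i, i ∉ I → ∀ (m g : MM n), (phi f D i).coeff g ≠ 0 →
      (m + g).1 + wt D I = m.1 + wt D (insert i I) := by
    intro I i hi m g hg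
    rw [wt_insert hi, ← phi_deg hg, Prod.fst_add]; ring
  have hBB : ∀ I m, m ∈ BB D U κ ∅ J I ↔ m ∈ cube (Finset.univ.filter fun t => ∀ j ∈ J, j.succ ≠ t)
      (DD rho (uR U) 0 (J.image Sum.inl)) I ∧ m.1 + wt D I = κ := by
    intro I m
    rw [key, BB]; simp; tauto
  refine ex_summand ?_ ?_ (ex_base hF hN J hp)
  · refine ⟨fun I m hm => ((hBB I m).1 hm).1, ?_⟩
    intro I i hi m hm g hg hmg
    rw [hBB] at hm ⊢
    exact ⟨hmg, by rw [hdeg I i hi m g hg]; exact hm.2⟩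
  · refine ⟨fun I m hm => hm.1, ?_⟩
    intro I i hi m hm g hg hmg
    refine ⟨hmg, fun h => hm.2 ?_⟩
    rw [hBB] at h ⊢
    exact ⟨hm.1, by rw [← hdeg I i hi m g hg]; exact h.2⟩

theorem ex_BB (hF : FacetData f D U) (hN : Nil f D U) (κ : ℤ) (K : Finset (Fin n)) :
    ∀ (J : Finset (Fin n)) {p : ℕ}, 1 ≤ p → Ex (phi f D) (BB D U κ K J) p := by
  induction K using Finset.induction_on with
  | empty => intro J p hp; exact ex_BB_empty hF hN κ J hp
  | insert k K hk ih =>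
    intro J p hp
    refine mix_ex _ (lc_BB hF κ K J) (cl_BB hF κ K J k) (ih J hp) ?_
    rw [dif_BB]
    exact ih _ (by omega)

end Blocks

end Kz
end ToricNewton

set_option linter.all false
set_option linter.unusedSectionVars false
set_option linter.unusedVariables false
namespace ToricNewton
namespace Kz

open Finset

section Dim
variable {M : Type*} [AddCommGroup M] {T : Type*} [LinearOrder T] [Fintype T]

/-- elements supported in S -/
def suppM (S : Set M) : Submodule ℂ (AddMonoidAlgebra ℂ M) where
  carrier := {a | SIn S a}
  add_mem' := fun h h' => SIn.add h h'
  zero_mem' := SIn.zero S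
  smul_mem' := fun z _ h => SIn.smul z h

lemma mem_suppM {S : Set M} {a : AddMonoidAlgebra ℂ M} : a ∈ suppM S ↔ SIn S a := Iff.rfl

lemma suppM_eq (S : Set M) : suppM S = (Finsupp.supported ℂ ℂ S).comap
    (AddMonoidAlgebra.coeffLinearEquiv ℂ : AddMonoidAlgebra ℂ M ≃ₗ[ℂ] (M →₀ ℂ)).toLinearMap := by
  ext a
  rw [Submodule.mem_comap, Finsupp.mem_supported, mem_suppM]
  constructor
  · intro h m hm
    exact h m (by simpa using hm)
  · intro h m hm
    exact h (by simpa using hm)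

/-- the equivalence with finitely supported functions -/
noncomputable def suppM_equiv (S : Set M) : suppM S ≃ₗ[ℂ] (S →₀ ℂ) :=
  (LinearEquiv.ofEq _ _ (suppM_eq S)).trans
    (((AddMonoidAlgebra.coeffLinearEquiv ℂ : AddMonoidAlgebra ℂ M ≃ₗ[ℂ] (M →₀ ℂ)).ofSubmodule' _).trans
      (Finsupp.supportedEquivFinsupp S))

lemma finrank_suppM {S : Set M} (hS : S.Finite) : Module.finrank ℂ (suppM S) = S.ncard := by
  haveI := hS.fintype
  rw [(suppM_equiv S).finrank_eq, Module.finrank_finsupp_self, Set.ncard_eq_toFinset_card', Set.toFinset_card]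

lemma fd_suppM {S : Set M} (hS : S.Finite) : FiniteDimensional ℂ (suppM S) := by
  haveI := hS.fintype
  exact (suppM_equiv S).symm.finiteDimensional

/-- one-chains -/
def Ch1 (B : Finset T → Set M) : Submodule ℂ (Finset T → AddMonoidAlgebra ℂ M) where
  carrier := {c | InB B c ∧ Hom 1 c}
  add_mem' := fun h h' => ⟨h.1.add h'.1, h.2.add h'.2⟩
  zero_mem' := ⟨fun _ => SIn.zero _, fun _ _ => rfl⟩
  smul_mem' := fun z c h => ⟨fun I => (h.1 I).smul z, fun I hI => by simp [h.2 I hI]⟩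

/-- boundaries in degree zero -/
noncomputable def Im (φ : T → AddMonoidAlgebra ℂ M) (B : Finset T → Set M) : Submodule ℂ (AddMonoidAlgebra ℂ M) :=
  (Ch1 B).map ((LinearMap.proj ∅).comp (tdL φ B))

lemma mem_Im {φ : T → AddMonoidAlgebra ℂ M} {B : Finset T → Set M} {a : AddMonoidAlgebra ℂ M} :
    a ∈ Im φ B ↔ ∃ c, InB B c ∧ Hom 1 c ∧ td φ B c ∅ = a := by
  constructor
  · rintro ⟨c, hc, rfl⟩; exact ⟨c, hc.1, hc.2, rfl⟩
  · rintro ⟨c, h1, h2, rfl⟩; exact ⟨c, ⟨h1, h2⟩, rfl⟩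

lemma Im_le (φ : T → AddMonoidAlgebra ℂ M) (B : Finset T → Set M) : Im φ B ≤ suppM (B ∅) := by
  intro a ha
  obtain ⟨c, h1, h2, rfl⟩ := mem_Im.1 ha
  exact td_inB φ B c ∅

lemma fun_ext_hom0 {c d : Finset T → AddMonoidAlgebra ℂ M} (hc : Hom 0 c) (hd : Hom 0 d) (h : c ∅ = d ∅) : c = d := by
  funext I
  by_cases hI : I = ∅
  · subst hI; exact h
  · rw [hc I (by simpa using hI), hd I (by simpa using hI)]

lemma finrank_Im {φ : T → AddMonoidAlgebra ℂ M} {B B' : Finset T → Set M} (hB : LC φ B) (h : Cl φ B' B)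
    (hE : Ex φ (dif B B') 1) (hfin : (B ∅).Finite) :
    Module.finrank ℂ (Im φ B) = Module.finrank ℂ (Im φ B') + Module.finrank ℂ (Im φ (dif B B')) := by
  haveI := fd_suppM hfin
  haveI : FiniteDimensional ℂ (Im φ B) := Submodule.finiteDimensional_of_le (Im_le φ B)
  set R : Im φ B →ₗ[ℂ] AddMonoidAlgebra ℂ M := (resL (dif B B' ∅)).domRestrict (Im φ B) with hR
  have h1 := R.finrank_range_add_finrank_ker
  have h2 : LinearMap.range R = Im φ (dif B B') := by
    ext a
    constructor
    · rintro ⟨⟨x, hx⟩, rfl⟩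
      obtain ⟨c, hc1, hc2, rfl⟩ := mem_Im.1 hx
      rw [mem_Im]
      refine ⟨prB (dif B B') c, prB_inB _ _, prB_hom hc2, ?_⟩
      rw [td_dif φ h hc1]; rfl
    · intro ha
      obtain ⟨c, hc1, hc2, rfl⟩ := mem_Im.1 ha
      have hc1' : InB B c := hc1.mono (dif_sub B B')
      refine ⟨⟨td φ B c ∅, mem_Im.2 ⟨c, hc1', hc2, rfl⟩⟩, ?_⟩
      have := td_dif φ h hc1'
      rw [prB_self hc1] at this
      rw [this]; rfl
  have h3 : (LinearMap.ker R).map (Im φ B).subtype = Im φ B' := by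
    ext a
    constructor
    · rintro ⟨⟨x, hx⟩, hk, rfl⟩
      obtain ⟨b, hb1, hb2, rfl⟩ := mem_Im.1 hx
      have hk' : res (dif B B' ∅) (td φ B b ∅) = 0 := hk
      have hcB : InB B' (td φ B b) := by
        intro I
        by_cases hI : I = ∅
        · subst hI
          intro m hm
          by_contra hm'
          have h4 := congrArg (fun z => z.coeff m) hk'
          simp only [res_coeff] at h4
          rw [if_pos ⟨td_inB φ B b ∅ m hm, hm'⟩] at h4
          exact hm (by simpa using h4)
        · rw [td_hom φ hb2 I (by simpa using hI)]; exact SIn.zero _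
      obtain ⟨b', e1, e2, e3⟩ := les1 φ hB h hE hcB hb1 hb2 rfl
      rw [mem_Im]
      exact ⟨b', e1, e2, by rw [e3]; rfl⟩
    · intro ha
      obtain ⟨c, hc1, hc2, rfl⟩ := mem_Im.1 ha
      rw [← td_eq_of_cl φ h hc1]
      refine ⟨⟨td φ B c ∅, mem_Im.2 ⟨c, hc1.mono h.1, hc2, rfl⟩⟩, ?_, rfl⟩
      show res (dif B B' ∅) (td φ B c ∅) = 0
      rw [td_eq_of_cl φ h hc1]
      apply res_eq_zero
      intro m hm hm'
      exact hm'.2 (td_inB φ B' c ∅ m hm)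
  rw [h2, ← Submodule.finrank_map_subtype_eq (Im φ B), h3] at h1
  omega

/-- dimension of degree zero homology -/
noncomputable def h0 (φ : T → AddMonoidAlgebra ℂ M) (B : Finset T → Set M) : ℤ :=
  ((B ∅).ncard : ℤ) - Module.finrank ℂ (Im φ B)

lemma h0_add {φ : T → AddMonoidAlgebra ℂ M} {B B' : Finset T → Set M} (hB : LC φ B) (h : Cl φ B' B)
    (hE : Ex φ (dif B B') 1) (hfin : (B ∅).Finite) : h0 φ B = h0 φ B' + h0 φ (dif B B') := by
  have h1 := finrank_Im hB h hE hfin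
  have h2 : (B ∅).ncard = (B' ∅).ncard + (dif B B' ∅).ncard := by
    have := Set.ncard_sdiff_add_ncard_of_subset (h.1 ∅) hfin
    rw [← this, dif]; ring
  simp only [h0]; push_cast [h1, h2]; ring

/-- The homology dimension from a surjection. -/
lemma h0_eq_finrank {φ : T → AddMonoidAlgebra ℂ M} {B : Finset T → Set M} (hfin : (B ∅).Finite)
    {W : Type*} [AddCommGroup W] [Module ℂ W] (G : Submodule ℂ W) (ψ : AddMonoidAlgebra ℂ M →ₗ[ℂ] W)
    (h1 : (suppM (B ∅)).map ψ = G) (h2 : ∀ a, SIn (B ∅) a → (ψ a = 0 ↔ a ∈ Im φ B)) :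
    (Module.finrank ℂ G : ℤ) = h0 φ B := by
  haveI := fd_suppM hfin
  have e1 := (ψ.domRestrict (suppM (B ∅))).finrank_range_add_finrank_ker
  have e2 : LinearMap.range (ψ.domRestrict (suppM (B ∅))) = G := by
    rw [← h1]; ext w; simp [Submodule.mem_map]
  have e3 : (LinearMap.ker (ψ.domRestrict (suppM (B ∅)))).map (suppM (B ∅)).subtype = Im φ B := by
    ext a
    constructor
    · rintro ⟨⟨x, hx⟩, hk, rfl⟩
      exact (h2 x hx).1 hk
    · intro ha
      exact ⟨⟨a, Im_le φ B ha⟩, (h2 a (Im_le φ B ha)).2 ha, rfl⟩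
  rw [e2, ← Submodule.finrank_map_subtype_eq, e3, finrank_suppM hfin] at e1
  simp only [h0]; omega

end Dim

section Alt
variable {n : ℕ} {f : MvPolynomial (Fin n) ℂ} {D : ℕ} {U : Finset (Fin n → ℤ)}

lemma BB_finite (hF : FacetData f D U) (κ : ℤ) (K J : Finset (Fin n)) : (BB D U κ K J ∅).Finite := by
  apply (CC_finite hF κ).subset
  rintro m ⟨h1, _, _, _, h5⟩
  refine ⟨h1, ?_⟩
  simp [wt] at h5; omega

lemma h0_insert (hF : FacetData f D U) (hN : Nil f D U) (κ : ℤ) (K J : Finset (Fin n)) (k : Fin n) :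
    h0 (phi f D) (BB D U κ (insert k K) J) =
      h0 (phi f D) (BB D U κ K J) - h0 (phi f D) (BB D U κ K (insert k J)) := by
  have := h0_add (lc_BB hF κ K J) (cl_BB hF κ K J k) (by rw [dif_BB]; exact ex_BB hF hN κ K _ le_rfl)
    (BB_finite hF κ K J)
  rw [dif_BB] at this
  linarith

theorem h0_alt (hF : FacetData f D U) (hN : Nil f D U) (κ : ℤ) (K : Finset (Fin n)) :
    ∀ J, Disjoint K J → h0 (phi f D) (BB D U κ K J) =
      ∑ S ∈ K.powerset, (-1) ^ S.card * h0 (phi f D) (BB D U κ ∅ (S ∪ J)) := by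
  induction K using Finset.induction_on with
  | empty => intro J _; simp
  | insert k K hk ih =>
    intro J hJ
    rw [Finset.disjoint_insert_left] at hJ
    rw [h0_insert hF hN, ih J hJ.2, ih (insert k J) (by rw [Finset.disjoint_insert_right]; exact ⟨hk, hJ.2⟩),
      Finset.sum_powerset_insert hk, sub_eq_add_neg, ← Finset.sum_neg_distrib]
    congr 1
    apply Finset.sum_congr rfl
    intro S hS
    have : k ∉ S := fun h => hk (Finset.mem_powerset.1 hS h)
    rw [Finset.card_insert_of_notMem this, Finset.insert_union, Finset.union_insert]
    ring

theorem h0_alt_univ (hF : FacetData f D U) (hN : Nil f D U) (κ : ℤ) :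
    h0 (phi f D) (BB D U κ Finset.univ ∅) =
      ∑ S : Finset (Fin n), (-1) ^ S.card * h0 (phi f D) (BB D U κ ∅ S) := by
  rw [h0_alt hF hN κ Finset.univ ∅ (Finset.disjoint_empty_right _)]
  simp

end Alt

end Kz
end ToricNewton

set_option linter.all false
set_option linter.unusedSectionVars false
set_option linter.unusedVariables false
namespace ToricNewton
namespace Kz

open Finset

section Hom
variable {n : ℕ} {f : MvPolynomial (Fin n) ℂ} {D : ℕ} {U : Finset (Fin n → ℤ)}

/-- Laurent ring -/
abbrev LL (n : ℕ) := AddMonoidAlgebra ℂ (Fin n → ℤ)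
/-- homogenised Laurent ring -/
abbrev AA (n : ℕ) := AddMonoidAlgebra ℂ (MM n)

/-- dehomogenisation -/
noncomputable def dl : AA n →ₐ[ℂ] LL n :=
  AddMonoidAlgebra.mapDomainAlgHom ℂ ℂ (AddMonoidHom.snd ℤ (Fin n → ℤ))

/-- homogenisation in degree k -/
noncomputable def eta (k : ℤ) (b : LL n) : AA n := AddMonoidAlgebra.mapDomain (fun v => (k, v)) b

/-- degree k -/
def HD (k : ℤ) : Set (MM n) := {m | m.1 = k}

lemma dl_coeff {k : ℤ} {a : AA n} (ha : SIn (HD k) a) (v : Fin n → ℤ) : (dl a).coeff v = a.coeff (k, v) := by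
  have h : (dl a).coeff = Finsupp.mapDomain (fun m : MM n => m.2) a.coeff := by
    rw [← AddMonoidAlgebra.coeff_mapDomain]; rfl
  rw [h]
  exact Finsupp.mapDomain_apply' (HD k) a.coeff (f := fun m : MM n => m.2) (a := ((k, v) : MM n))
    (fun m hm => ha m (by simpa using hm))
    (fun x hx y hy hxy => Prod.ext ((show x.1 = k from hx).trans (show y.1 = k from hy).symm) hxy) rfl

lemma eta_coeff (k : ℤ) (b : LL n) (v : Fin n → ℤ) : (eta k b).coeff (k, v) = b.coeff v := by
  rw [eta, AddMonoidAlgebra.coeff_mapDomain]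
  exact Finsupp.mapDomain_apply (f := fun v : Fin n → ℤ => ((k, v) : MM n))
    (fun x y h => (Prod.ext_iff.1 h).2) b.coeff v

lemma eta_hd (k : ℤ) (b : LL n) : SIn (HD k) (eta k b) := by
  intro m hm
  by_contra h
  apply hm
  rw [eta, AddMonoidAlgebra.coeff_mapDomain]
  apply Finsupp.mapDomain_of_notMem_range
  rintro ⟨v, rfl⟩
  exact h rfl

lemma dl_eta (k : ℤ) (b : LL n) : dl (eta k b) = b := by
  apply alg_ext
  intro v
  rw [dl_coeff (eta_hd k b), eta_coeff]

lemma dl_inj {k : ℤ} {a b : AA n} (ha : SIn (HD k) a) (hb : SIn (HD k) b) (h : dl a = dl b) : a = b := by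
  apply alg_ext
  rintro ⟨k', v⟩
  by_cases hk : k' = k
  · subst hk
    rw [← dl_coeff ha, ← dl_coeff hb, h]
  · have : ∀ c : AA n, SIn (HD k) c → c.coeff (k', v) = 0 := by
      intro c hc
      by_contra h0
      exact hk (hc _ h0)
    rw [this a ha, this b hb]

lemma dl_sin {k : ℤ} {a : AA n} {S : Set (MM n)} {S' : Set (Fin n → ℤ)} (ha : SIn (HD k) a) (hS : SIn S a)
    (h : ∀ v, (k, v) ∈ S → v ∈ S') : SIn S' (dl a) := by
  intro v hv
  rw [dl_coeff ha] at hv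
  exact h v (hS _ hv)

lemma eta_sin {k : ℤ} {b : LL n} {S : Set (MM n)} {S' : Set (Fin n → ℤ)} (hb : SIn S' b)
    (h : ∀ v ∈ S', (k, v) ∈ S) : SIn S (eta k b) := by
  rintro ⟨k', v⟩ hm
  have : k' = k := eta_hd k b _ hm
  subst this
  rw [eta_coeff] at hm
  exact h v (hb v hm)

lemma dl_res {k : ℤ} {a : AA n} (ha : SIn (HD k) a) (S : Set (MM n)) :
    dl (res S a) = res {v | (k, v) ∈ S} (dl a) := by
  have h1 : SIn (HD k) (res S a) := by
    intro m hm
    rw [res_coeff] at hm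
    split_ifs at hm with h
    · exact ha m hm
    · exact absurd rfl hm
  apply alg_ext
  intro v
  rw [dl_coeff h1, res_coeff, res_coeff, dl_coeff ha]
  rfl

lemma hd_mul {k l : ℤ} {a b : AA n} (ha : SIn (HD k) a) (hb : SIn (HD l) b) : SIn (HD (k + l)) (a * b) := by
  intro m hm
  obtain ⟨x, y, hx, hy, rfl⟩ := mul_coeff_ne hm
  have h1 : x.1 = k := ha x hx
  have h2 : y.1 = l := hb y hy
  show y.1 + x.1 = k + l
  omega

lemma phi_hd (i : Fin (n + 1)) : SIn (HD (wtg D i)) (phi f D i) := fun g hg => phi_deg hg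

/-- The dehomogenised logarithmic derivatives. -/
noncomputable def FF (f : MvPolynomial (Fin n) ℂ) (i : Fin n) : LL n :=
  ∑ m ∈ f.support, AddMonoidAlgebra.single (vec m) ((m i : ℂ) * f.coeff m)

lemma dl_single (m : MM n) (z : ℂ) : dl (AddMonoidAlgebra.single m z) = AddMonoidAlgebra.single m.2 z := by
  show AddMonoidAlgebra.mapDomain _ _ = _
  rw [AddMonoidAlgebra.mapDomain_single]; rfl

lemma dl_phi_succ (i : Fin n) : dl (phi f D i.succ) = FF f i := by
  rw [phi_succ, map_sum, FF]
  simp [dl_single]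

lemma dl_phi_zero : dl (phi f D 0) = 1 := by
  rw [phi_zero, dl_single]; rfl

lemma dl_spow (j : ℤ) : dl (AddMonoidAlgebra.single ((j, 0) : MM n) (1 : ℂ)) = 1 := by
  rw [dl_single]; rfl

/-- Blocks without grading -/
def QQ (K J : Finset (Fin n)) (I : Finset (Fin (n + 1))) : Set (Fin n → ℤ) :=
  {v | (∀ i, 0 ≤ v i) ∧ (∀ j ∈ J, j.succ ∉ I) ∧ (∀ j ∈ J, v j = 0) ∧ (∀ l ∈ K, l.succ ∉ I → 1 ≤ v l)}

lemma mem_BB_iff {κ : ℤ} {K J : Finset (Fin n)} {I : Finset (Fin (n + 1))} {m : MM n} :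
    m ∈ BB D U κ K J I ↔ m ∈ CC U ∧ m.2 ∈ QQ K J I ∧ m.1 + wt D I = κ := by
  simp only [BB, QQ, Set.mem_setOf_eq]
  constructor
  · rintro ⟨h1, h2, h3, h4, h5⟩
    exact ⟨h1, ⟨CC_snd h1, h2, h3, h4⟩, h5⟩
  · rintro ⟨h1, ⟨_, h2, h3, h4⟩, h5⟩
    exact ⟨h1, h2, h3, h4, h5⟩

lemma wt_empty : wt D (∅ : Finset (Fin (n+1))) = 0 := rfl
lemma wt_single (t : Fin (n + 1)) : wt D {t} = wtg D t := by simp [wt]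
lemma wtg_zero : wtg D (0 : Fin (n+1)) = 1 := rfl
lemma wtg_succ (i : Fin n) : wtg D i.succ = D := by simp [wtg]

lemma QQ_zero (K J : Finset (Fin n)) : QQ K J {0} = QQ K J ∅ := by
  ext v; simp [QQ, Fin.succ_ne_zero]

lemma BB_hd {κ : ℤ} {K J : Finset (Fin n)} {I : Finset (Fin (n + 1))} {a : AA n} (h : SIn (BB D U κ K J I) a) :
    SIn (HD (κ - wt D I)) a := by
  intro m hm
  have := (mem_BB_iff.1 (h m hm)).2.2
  show m.1 = _
  omega

lemma mem_Im_iff {M : Type*} [AddCommGroup M] {T : Type*} [LinearOrder T] [Fintype T]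
    {φ : T → AddMonoidAlgebra ℂ M} {B : Finset T → Set M} {a : AddMonoidAlgebra ℂ M} :
    a ∈ Im φ B ↔ ∃ c : T → AddMonoidAlgebra ℂ M, (∀ t, SIn (B {t}) (c t)) ∧ a = res (B ∅) (∑ t, φ t * c t) := by
  classical
  rw [mem_Im]
  constructor
  · rintro ⟨c, h1, h2, rfl⟩
    refine ⟨fun t => c {t}, fun t => h1 _, ?_⟩
    simp [td, prB, kd, sg]
  · rintro ⟨c, h1, rfl⟩
    refine ⟨fun I => if h : ∃ t, I = {t} then c h.choose else 0, ?_, ?_, ?_⟩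
    · intro I
      by_cases h : ∃ t, I = {t}
      · simp only [dif_pos h]
        have := h1 h.choose
        rwa [← h.choose_spec] at this
      · simp only [dif_neg h]; exact SIn.zero _
    · intro I hI
      have : ¬ ∃ t, I = {t} := by rintro ⟨t, rfl⟩; simp at hI
      simp only [dif_neg this]
    · have key : ∀ t : T, (if h : ∃ t', ({t} : Finset T) = {t'} then c h.choose else 0) = c t := by
        intro t
        have h : ∃ t', ({t} : Finset T) = {t'} := ⟨t, rfl⟩
        rw [dif_pos h]
        have := h.choose_spec
        rw [Finset.singleton_inj] at this
        rw [← this]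
      simp [td, prB, kd, sg, key]

/-- image without the s-part -/
def Im' (f : MvPolynomial (Fin n) ℂ) (D : ℕ) (U : Finset (Fin n → ℤ)) (κ : ℤ) (K J : Finset (Fin n)) (a : AA n) : Prop :=
  ∃ c : Fin n → AA n, (∀ i, SIn (BB D U κ K J {i.succ}) (c i)) ∧
    a = res (BB D U κ K J ∅) (∑ i, phi f D i.succ * c i)

lemma BB_zero_iff {κ : ℤ} {K J : Finset (Fin n)} {m : MM n} :
    m ∈ BB D U (κ + 1) K J {0} ↔ m ∈ BB D U κ K J ∅ := by
  rw [mem_BB_iff, mem_BB_iff, QQ_zero, wt_single, wt_empty, wtg_zero]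
  constructor
  · rintro ⟨h1, h2, h3⟩; exact ⟨h1, h2, by omega⟩
  · rintro ⟨h1, h2, h3⟩; exact ⟨h1, h2, by omega⟩

/-- s is torsion free -/
lemma tors1 (hF : FacetData f D U) (hN : Nil f D U) {κ : ℤ} {K J : Finset (Fin n)} {a : AA n}
    (ha : SIn (BB D U κ K J ∅) a) (h : Im' f D U (κ + 1) K J (phi f D 0 * a)) : Im' f D U κ K J a := by
  classical
  obtain ⟨c, hc1, hc2⟩ := h
  set cc : Finset (Fin (n + 1)) → AA n := fun I => if I = {0} then -a else
    ∑ i : Fin n, if I = {i.succ} then c i else 0 with hcc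
  have hcc0 : cc {0} = -a := by simp [hcc]
  have hccs : ∀ i : Fin n, cc {i.succ} = c i := by
    intro i
    simp [hcc, Fin.succ_ne_zero]
  have hHom : Hom 1 cc := by
    intro I hI
    have h0 : I ≠ {0} := by rintro rfl; simp at hI
    have h1 : ∀ i : Fin n, I ≠ {i.succ} := by rintro i rfl; simp at hI
    simp [hcc, h0, h1]
  have hIn : InB (BB D U (κ + 1) K J) cc := by
    intro I
    by_cases hI : I.card = 1
    · obtain ⟨t, rfl⟩ := Finset.card_eq_one.1 hI
      induction t using Fin.cases with
      | zero =>
        rw [hcc0, ← neg_one_smul ℂ]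
        exact (ha.smul _).mono fun m hm => BB_zero_iff.2 hm
      | succ i => rw [hccs]; exact hc1 i
    · rw [hHom I hI]; exact SIn.zero _
  have htd : td (phi f D) (BB D U (κ + 1) K J) cc = 0 := by
    apply fun_ext_hom0 (td_hom _ hHom) (fun _ _ => rfl)
    have e1 : SIn (BB D U (κ + 1) K J ∅) (phi f D 0 * a) := by rw [hc2]; exact res_sin _ _
    simp only [td, prB, kd, sg]
    simp only [Finset.notMem_empty, if_false, Finset.filter_empty, Finset.card_empty, pow_zero, one_smul,
      insert_empty_eq, Fin.sum_univ_succ, hcc0, hccs]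
    rw [res_add, ← hc2, mul_neg, ← neg_one_smul ℂ, res_smul, res_eq_self e1]
    simp
  obtain ⟨b, hb1, hb2, hb3⟩ := ex_BB hF hN (κ + 1) K J le_rfl cc hIn hHom htd
  refine ⟨fun i => b (insert i.succ {0}), fun i => ?_, ?_⟩
  · refine (hb1 (insert i.succ {0})).mono fun m hm => ?_
    rw [mem_BB_iff] at hm ⊢
    rw [wt_insert (by simp [Fin.succ_ne_zero]), wt_single, wtg_zero] at hm
    rw [wt_single]
    refine ⟨hm.1, ?_, by have := hm.2.2; omega⟩
    obtain ⟨q1, q2, q3, q4⟩ := hm.2.1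
    refine ⟨q1, fun j hj hj' => q2 j hj ?_, q3, fun l hl hl' => q4 l hl ?_⟩
    · simp at hj' ⊢; tauto
    · simp [Fin.succ_ne_zero] at hl' ⊢; tauto
  · have h1 : td (phi f D) (BB D U (κ + 1) K J) b {0} = -a := by rw [hb3, hcc0]
    simp only [td, prB, kd, Fin.sum_univ_succ] at h1
    have hs : ∀ i : Fin n, sg i.succ ({0} : Finset (Fin (n+1))) = -1 := by
      intro i; simp [sg, Finset.filter_singleton]
    simp only [Finset.mem_singleton, if_true, zero_add, Fin.succ_ne_zero, if_false, hs] at h1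
    rw [← Finset.smul_sum, res_smul, neg_one_smul, neg_inj] at h1
    rw [← h1]
    congr 1
    ext m; exact BB_zero_iff

lemma torsj (hF : FacetData f D U) (hN : Nil f D U) {K J : Finset (Fin n)} (j : ℕ) :
    ∀ {κ : ℤ} {a : AA n}, SIn (BB D U κ K J ∅) a →
      Im' f D U (κ + j) K J (AddMonoidAlgebra.single (((j : ℤ), 0) : MM n) (1 : ℂ) * a) → Im' f D U κ K J a := by
  induction j with
  | zero =>
    intro κ a ha h
    have : AddMonoidAlgebra.single ((((0:ℕ) : ℤ), 0) : MM n) (1 : ℂ) = 1 := rfl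
    rw [this, one_mul] at h
    simpa using h
  | succ j ih =>
    intro κ a ha h
    apply tors1 hF hN ha
    apply ih
    · intro m hm
      rw [phi_zero, single_mul_coeff] at hm
      have := mem_BB_iff.1 (ha _ hm)
      rw [mem_BB_iff]
      have e : m = (m - (1, 0)) + (1, 0) := by abel
      refine ⟨by rw [e]; exact add_mem this.1 (s_mem_CC hF), ?_, ?_⟩
      · have h2 := this.2.1
        simpa using h2
      · have h2 := this.2.2
        simp at h2 ⊢; omega
    · rw [phi_zero, ← mul_assoc, AddMonoidAlgebra.single_mul_single]
      have e1 : (((j:ℤ), (0 : Fin n → ℤ)) + (1, 0) : MM n) = (((j + 1 : ℕ) : ℤ), 0) := by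
        ext <;> simp
      have e2 : κ + 1 + (j : ℤ) = κ + ((j + 1 : ℕ) : ℤ) := by push_cast; ring
      rw [e1, e2, mul_one]
      exact h

/-- the dehomogenised image -/
def NN (f : MvPolynomial (Fin n) ℂ) (K J : Finset (Fin n)) (x : LL n) : Prop :=
  ∃ c : Fin n → LL n, (∀ i, SIn (QQ K J {i.succ}) (c i)) ∧ x = res (QQ K J ∅) (∑ i, FF f i * c i)

/-- filtered piece -/
def FL (U : Finset (Fin n → ℤ)) (κ : ℤ) (K J : Finset (Fin n)) : Set (Fin n → ℤ) :=
  {v | v ∈ QQ K J ∅ ∧ ((κ, v) : MM n) ∈ CC U}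

lemma CC_up (hF : FacetData f D U) {k k' : ℤ} {v : Fin n → ℤ} (h : ((k, v) : MM n) ∈ CC U) (hk : k ≤ k') :
    ((k', v) : MM n) ∈ CC U := by
  rw [mem_CC'] at h ⊢
  exact ⟨h.1, fun u hu => (h.2 u hu).trans hk⟩

lemma exists_deg (c : Fin n → LL n) (hc : ∀ i v, (c i).coeff v ≠ 0 → ∀ l, 0 ≤ v l) (κ : ℤ) (D : ℤ) :
    ∃ j : ℕ, ∀ i v, (c i).coeff v ≠ 0 → ((κ + j - D, v) : MM n) ∈ CC U := by
  classical
  set b : (Fin n → ℤ) → ℤ := fun v => ∑ u ∈ U, |∑ i, u i * v i| with hb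
  have hb0 : ∀ v, 0 ≤ b v := fun v => Finset.sum_nonneg fun _ _ => abs_nonneg _
  set tot : ℤ := ∑ i, ∑ v ∈ (c i).coeff.support, b v with htot
  obtain ⟨j, hj⟩ : ∃ j : ℕ, tot + D - κ ≤ j := ⟨(tot + D - κ).toNat, Int.self_le_toNat _⟩
  refine ⟨j, fun i v hv => ?_⟩
  rw [mem_CC']
  refine ⟨hc i v hv, fun u hu => ?_⟩
  have h1 : b v ≤ ∑ v ∈ (c i).coeff.support, b v :=
    Finset.single_le_sum (fun v _ => hb0 v) (by simpa using hv)
  have h2 : ∑ v ∈ (c i).coeff.support, b v ≤ tot :=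
    Finset.single_le_sum (f := fun i => ∑ v ∈ (c i).coeff.support, b v)
      (fun i _ => Finset.sum_nonneg fun v _ => hb0 v) (Finset.mem_univ i)
  have h3 : |∑ i, u i * v i| ≤ b v :=
    Finset.single_le_sum (f := fun u : Fin n → ℤ => |∑ i, u i * v i|) (fun u _ => abs_nonneg _) hu
  have h4 := le_abs_self (∑ i, u i * v i)
  show ∑ i, u i * v i ≤ κ + j - D
  linarith

lemma BB_empty_eq (k : ℤ) (K J : Finset (Fin n)) : {v | ((k, v) : MM n) ∈ BB D U k K J ∅} = FL U k K J := by
  ext v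
  simp only [Set.mem_setOf_eq, mem_BB_iff, FL, wt_empty]
  constructor
  · rintro ⟨h1, h2, _⟩; exact ⟨h2, h1⟩
  · rintro ⟨h1, h2⟩; exact ⟨h2, h1, by simp⟩

lemma sum_hd {κ : ℤ} {K J : Finset (Fin n)} {c : Fin n → AA n} (hc : ∀ i, SIn (BB D U κ K J {i.succ}) (c i)) :
    SIn (HD κ) (∑ i, phi f D i.succ * c i) := by
  apply SIn.sum
  intro i _
  have := hd_mul (phi_hd (f := f) (D := D) i.succ) (BB_hd (hc i))
  rwa [wt_single, add_sub_cancel] at this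

lemma sum_CC (hF : FacetData f D U) {κ : ℤ} {K J : Finset (Fin n)} {c : Fin n → AA n}
    (hc : ∀ i, SIn (BB D U κ K J {i.succ}) (c i)) :
    SIn (CC U : Set (MM n)) (∑ i, phi f D i.succ * c i) := by
  apply SIn.sum
  intro i _ m hm
  obtain ⟨x, y, hx, hy, rfl⟩ := mul_coeff_ne hm
  exact add_mem (mem_BB_iff.1 (hc i y hy)).1 (phi_CC hF _ _ hx)

lemma dl_Im' (hF : FacetData f D U) {κ : ℤ} {K J : Finset (Fin n)} {c : Fin n → AA n}
    (hc : ∀ i, SIn (BB D U κ K J {i.succ}) (c i)) :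
    dl (res (BB D U κ K J ∅) (∑ i, phi f D i.succ * c i)) = res (QQ K J ∅) (∑ i, FF f i * dl (c i)) := by
  rw [dl_res (sum_hd hc), BB_empty_eq]
  have e : dl (∑ i, phi f D i.succ * c i) = ∑ i, FF f i * dl (c i) := by
    rw [map_sum]; simp only [map_mul, dl_phi_succ]
  rw [← e]
  apply alg_ext
  intro v
  rw [res_coeff, res_coeff]
  by_cases hv : (dl (∑ i, phi f D i.succ * c i)).coeff v = 0
  · rw [hv, ite_self, ite_self]
  · have : ((κ, v) : MM n) ∈ CC U := by
      rw [dl_coeff (sum_hd hc)] at hv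
      exact sum_CC hF hc _ hv
    have e3 : v ∈ FL U κ K J ↔ v ∈ QQ K J ∅ := ⟨fun h => h.1, fun h => ⟨h, this⟩⟩
    by_cases hq : v ∈ QQ K J ∅
    · rw [if_pos hq, if_pos (e3.2 hq)]
    · rw [if_neg hq, if_neg (fun h => hq (e3.1 h))]

theorem core (hF : FacetData f D U) (hN : Nil f D U) {κ : ℤ} {K J : Finset (Fin n)} {a : AA n}
    (ha : SIn (BB D U κ K J ∅) a) :
    (∃ y x, SIn (FL U (κ - 1) K J) y ∧ NN f K J x ∧ y + x = dl a) ↔ a ∈ Im (phi f D) (BB D U κ K J) := by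
  have hka : SIn (HD κ) a := by have := BB_hd ha; simpa [wt_empty] using this
  rw [mem_Im_iff]
  constructor
  · rintro ⟨y, x, hy, ⟨c, hc, rfl⟩, hyx⟩
    obtain ⟨j, hj⟩ := exists_deg (U := U) c (fun i v hv => (hc i v hv).1) κ D
    set yy := eta (κ - 1) y with hyy
    have hyB : SIn (BB D U κ K J {0}) yy := by
      apply eta_sin hy
      intro v hv
      rw [mem_BB_iff, QQ_zero, wt_single, wtg_zero]
      exact ⟨hv.2, hv.1, by simp⟩
    have hsy : SIn (BB D U κ K J ∅) (phi f D 0 * yy) := by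
      intro m hm
      obtain ⟨x, y, hx, hy, rfl⟩ := mul_coeff_ne hm
      rw [phi_zero_ne hx]
      have h1 := hyB y hy
      rw [mem_BB_iff, QQ_zero, wt_single, wtg_zero] at h1
      rw [mem_BB_iff]
      refine ⟨add_mem h1.1 (s_mem_CC hF), by simpa using h1.2.1, by simp [wt_empty]; exact h1.2.2⟩
    have hcc : ∀ i, SIn (BB D U (κ + j) K J {i.succ}) (eta (κ + j - D) (c i)) := by
      intro i
      apply eta_sin (S' := {v | (c i).coeff v ≠ 0}) (fun v hv => hv)
      intro v hv
      rw [mem_BB_iff, wt_single, wtg_succ]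
      exact ⟨hj i v hv, hc i v hv, by simp⟩
    have h1 : Im' f D U κ K J (a - phi f D 0 * yy) := by
      apply torsj hF hN j (ha.sub hsy)
      refine ⟨fun i => eta (κ + j - D) (c i), hcc, ?_⟩
      apply dl_inj (k := κ + j)
      · have e1 : SIn (HD (j : ℤ)) (AddMonoidAlgebra.single (((j : ℤ), 0) : MM n) (1 : ℂ)) := by
          intro m hm
          rw [AddMonoidAlgebra.coeff_single, Finsupp.single_apply] at hm
          split_ifs at hm with h
          · rw [← h]; rfl
          · exact absurd rfl hm
        have e2 : SIn (HD κ) (phi f D 0 * yy) := by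
          have := BB_hd hsy; simpa [wt_empty] using this
        have := hd_mul e1 (hka.sub e2)
        rwa [add_comm] at this
      · have := BB_hd (res_sin (BB D U (κ + j) K J ∅) (∑ i, phi f D i.succ * eta (κ + j - D) (c i)))
        simpa [wt_empty] using this
      · rw [dl_Im' hF hcc, map_mul, dl_spow, one_mul, map_sub, map_mul, dl_phi_zero, one_mul, hyy, dl_eta, ← hyx]
        simp only [dl_eta]
        abel
    obtain ⟨c', hc', he⟩ := h1
    refine ⟨Fin.cons yy c', ?_, ?_⟩
    · intro t
      induction t using Fin.cases with
      | zero => exact hyB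
      | succ i => exact hc' i
    · rw [Fin.sum_univ_succ, res_add]
      simp only [Fin.cons_zero, Fin.cons_succ]
      rw [← he, res_eq_self hsy]; abel
  · rintro ⟨c, hc, hae⟩
    have h0 := hc 0
    have hs : ∀ i : Fin n, SIn (BB D U κ K J {i.succ}) (c i.succ) := fun i => hc _
    have hsy : SIn (BB D U κ K J ∅) (phi f D 0 * c 0) := by
      intro m hm
      obtain ⟨x, y, hx, hy, rfl⟩ := mul_coeff_ne hm
      rw [phi_zero_ne hx]
      have h1 := h0 y hy
      rw [mem_BB_iff, QQ_zero, wt_single, wtg_zero] at h1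
      rw [mem_BB_iff]
      refine ⟨add_mem h1.1 (s_mem_CC hF), by simpa using h1.2.1, by simp [wt_empty]; exact h1.2.2⟩
    refine ⟨dl (c 0), res (QQ K J ∅) (∑ i : Fin n, FF f i * dl (c i.succ)), ?_, ?_, ?_⟩
    · have e := BB_hd h0
      rw [wt_single, wtg_zero] at e
      apply dl_sin e h0
      intro v hv
      rw [mem_BB_iff, QQ_zero] at hv
      exact ⟨hv.2.1, hv.1⟩
    · refine ⟨fun i => dl (c i.succ), fun i => ?_, rfl⟩
      apply dl_sin (BB_hd (hs i)) (hs i)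
      intro v hv
      exact (mem_BB_iff.1 hv).2.1
    · rw [hae, Fin.sum_univ_succ, res_add, map_add, dl_Im' hF hs, res_eq_self hsy, map_mul, dl_phi_zero, one_mul]

theorem gr_core (hF : FacetData f D U) (hN : Nil f D U) (κ : ℤ) (K J : Finset (Fin n)) {R : Type*} [AddCommGroup R]
    [Module ℂ R] (Fle Flt I : Submodule ℂ R) (j : R →ₗ[ℂ] LL n) (hj : Function.Injective j)
    (hle : ∀ x, (∃ g ∈ Fle, j g = x) ↔ SIn (FL U κ K J) x)
    (hlt : ∀ x, (∃ g ∈ Flt, j g = x) ↔ SIn (FL U (κ - 1) K J) x)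
    (hI : ∀ x, (∃ g ∈ I, j g = x) ↔ NN f K J x) :
    (Module.finrank ℂ (Submodule.map (Flt ⊔ I).mkQ (Fle ⊔ I)) : ℤ) = h0 (phi f D) (BB D U κ K J) := by
  obtain ⟨j', hj'⟩ := j.exists_leftInverse_of_injective (LinearMap.ker_eq_bot.2 hj)
  have hjj : ∀ g, j' (j g) = g := fun g => LinearMap.congr_fun hj' g
  have hhd : ∀ {a : AA n}, SIn (BB D U κ K J ∅) a → SIn (HD κ) a := by
    intro a ha; have := BB_hd ha; simpa [wt_empty] using this
  have hdlF : ∀ {a : AA n}, SIn (BB D U κ K J ∅) a → SIn (FL U κ K J) (dl a) := by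
    intro a ha
    apply dl_sin (hhd ha) ha
    intro v hv
    rwa [← BB_empty_eq (D := D)]
  refine h0_eq_finrank (BB_finite hF κ K J) _ ((Flt ⊔ I).mkQ ∘ₗ j' ∘ₗ dl.toLinearMap) ?_ ?_
  · have hsup : Submodule.map (Flt ⊔ I).mkQ (Fle ⊔ I) = Submodule.map (Flt ⊔ I).mkQ Fle := by
      rw [Submodule.map_sup]
      apply sup_eq_left.2
      rintro _ ⟨x, hx, rfl⟩
      have : (Flt ⊔ I).mkQ x = 0 := by
        rw [← LinearMap.mem_ker, Submodule.ker_mkQ]; exact Submodule.mem_sup_right hx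
      rw [this]; exact Submodule.zero_mem _
    rw [hsup]
    ext w
    constructor
    · rintro ⟨a, ha, rfl⟩
      obtain ⟨g, hg, hga⟩ := (hle _).2 (hdlF ha)
      refine ⟨g, hg, ?_⟩
      simp only [LinearMap.comp_apply, AlgHom.toLinearMap_apply, ← hga, hjj]
    · rintro ⟨g, hg, rfl⟩
      have h1 := (hle _).1 ⟨g, hg, rfl⟩
      refine ⟨eta κ (j g), ?_, ?_⟩
      · apply eta_sin h1
        intro v hv
        rwa [← BB_empty_eq (D := D)] at hv
      · simp only [LinearMap.comp_apply, AlgHom.toLinearMap_apply, dl_eta, hjj]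
  · intro a ha
    rw [← core hF hN ha]
    obtain ⟨g, hg, hga⟩ := (hle _).2 (hdlF ha)
    simp only [LinearMap.comp_apply, AlgHom.toLinearMap_apply, ← hga, hjj]
    rw [← LinearMap.mem_ker, Submodule.ker_mkQ, Submodule.mem_sup]
    constructor
    · rintro ⟨y, hy, x, hx, rfl⟩
      exact ⟨j y, j x, (hlt _).1 ⟨y, hy, rfl⟩, (hI _).1 ⟨x, hx, rfl⟩, (map_add j y x).symm⟩
    · rintro ⟨y, x, hy, hx, hyx⟩
      obtain ⟨y', hy', rfl⟩ := (hlt _).2 hy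
      obtain ⟨x', hx', rfl⟩ := (hI _).2 hx
      rw [← map_add] at hyx
      exact ⟨y', hy', x', hx', hj hyx⟩

end Hom

end Kz
end ToricNewton

set_option linter.all false
set_option linter.unusedSectionVars false
set_option linter.unusedVariables false
namespace ToricNewton
namespace Kz

open Finset

section JM
variable {n : ℕ} {τ : Type} [Fintype τ] [DecidableEq τ]

/-- Monomial substitution as a linear map. -/
noncomputable def jm (ι : (τ →₀ ℕ) → (Fin n → ℤ)) : MvPolynomial τ ℂ →ₗ[ℂ] LL n where
  toFun g := AddMonoidAlgebra.mapDomain ι g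
  map_add' a b := AddMonoidAlgebra.mapDomain_add ι a b
  map_smul' z a := by
    apply alg_ext
    intro v
    have h : (AddMonoidAlgebra.mapDomain ι (z • a)).coeff = z • (AddMonoidAlgebra.mapDomain ι a).coeff := by
      rw [AddMonoidAlgebra.coeff_mapDomain, AddMonoidAlgebra.coeff_mapDomain, ← Finsupp.mapDomain_smul]; rfl
    rw [h]; rfl

lemma jm_coeff {ι : (τ →₀ ℕ) → (Fin n → ℤ)} (hι : Function.Injective ι) (g : MvPolynomial τ ℂ) (m : τ →₀ ℕ) :
    (jm ι g).coeff (ι m) = g.coeff m := by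
  show (AddMonoidAlgebra.mapDomain ι g).coeff (ι m) = _
  rw [AddMonoidAlgebra.coeff_mapDomain]
  exact Finsupp.mapDomain_apply hι _ m

lemma jm_coeff_notMem {ι : (τ →₀ ℕ) → (Fin n → ℤ)} (g : MvPolynomial τ ℂ) {v : Fin n → ℤ}
    (h : v ∉ Set.range ι) : (jm ι g).coeff v = 0 := by
  show (AddMonoidAlgebra.mapDomain ι g).coeff v = _
  rw [AddMonoidAlgebra.coeff_mapDomain]
  exact Finsupp.mapDomain_of_notMem_range _ _ h

lemma jm_inj {ι : (τ →₀ ℕ) → (Fin n → ℤ)} (hι : Function.Injective ι) : Function.Injective (jm ι) := by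
  intro a b h
  apply MvPolynomial.ext
  intro m
  rw [← jm_coeff hι, h, jm_coeff hι]

lemma jm_monomial (ι : (τ →₀ ℕ) → (Fin n → ℤ)) (m : τ →₀ ℕ) (z : ℂ) :
    jm ι (MvPolynomial.monomial m z) = AddMonoidAlgebra.single (ι m) z :=
  AddMonoidAlgebra.mapDomain_single

lemma jm_mul {ι ι0 : (τ →₀ ℕ) → (Fin n → ℤ)} (h : ∀ m m', ι (m + m') = ι0 m + ι m') (a b : MvPolynomial τ ℂ) :
    jm ι (a * b) = jm ι0 a * jm ι b := by
  induction a using MvPolynomial.induction_on' with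
  | monomial u z =>
    induction b using MvPolynomial.induction_on' with
    | monomial u' z' =>
      rw [MvPolynomial.monomial_mul, jm_monomial, jm_monomial, jm_monomial, AddMonoidAlgebra.single_mul_single, h]
    | add p q hp hq => rw [mul_add, map_add, hp, hq, map_add, mul_add]
  | add p q hp hq => rw [add_mul, map_add, hp, hq, map_add, add_mul]

lemma jm_exists {ι : (τ →₀ ℕ) → (Fin n → ℤ)} (hι : Function.Injective ι) (p : (τ →₀ ℕ) → Prop) (x : LL n) :
    (∃ g : MvPolynomial τ ℂ, (∀ m ∈ g.support, p m) ∧ jm ι g = x) ↔ SIn {v | ∃ m, ι m = v ∧ p m} x := by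
  constructor
  · rintro ⟨g, hg, rfl⟩ v hv
    by_cases hr : v ∈ Set.range ι
    · obtain ⟨m, rfl⟩ := hr
      rw [jm_coeff hι] at hv
      exact ⟨m, rfl, hg m (MvPolynomial.mem_support_iff.2 hv)⟩
    · exact absurd (jm_coeff_notMem g hr) hv
  · intro hx
    set g : MvPolynomial τ ℂ := AddMonoidAlgebra.ofCoeff (Finsupp.comapDomain ι x.coeff hι.injOn) with hg
    have hgc : ∀ m, g.coeff m = x.coeff (ι m) := fun m => rfl
    refine ⟨g, ?_, ?_⟩
    · intro m hm
      rw [MvPolynomial.mem_support_iff, hgc] at hm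
      obtain ⟨m', h1, h2⟩ := hx _ hm
      rwa [← hι h1]
    · apply alg_ext
      intro v
      by_cases hr : v ∈ Set.range ι
      · obtain ⟨m, rfl⟩ := hr
        rw [jm_coeff hι, hgc]
      · rw [jm_coeff_notMem g hr]
        by_contra h0
        obtain ⟨m, h1, _⟩ := hx v (fun h => h0 h.symm)
        exact hr ⟨m, h1⟩

lemma jm_range {ι : (τ →₀ ℕ) → (Fin n → ℤ)} (hι : Function.Injective ι) (x : LL n) (hx : SIn (Set.range ι) x) :
    ∃ g : MvPolynomial τ ℂ, jm ι g = x := by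
  obtain ⟨g, _, h⟩ := (jm_exists hι (fun _ => True) x).2 (hx.mono (by rintro v ⟨m, rfl⟩; exact ⟨m, rfl, trivial⟩))
  exact ⟨g, h⟩

lemma jm_sin {ι : (τ →₀ ℕ) → (Fin n → ℤ)} (g : MvPolynomial τ ℂ) : SIn (Set.range ι) (jm ι g) := by
  intro v hv
  by_contra h
  exact hv (jm_coeff_notMem g h)

lemma vec_inj : Function.Injective (vec : (Fin n →₀ ℕ) → (Fin n → ℤ)) := by
  intro a b h
  ext i
  have := congrFun h i
  simpa [vec] using this

lemma vec_add (a b : Fin n →₀ ℕ) : vec (a + b) = vec a + vec b := by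
  ext i; simp [vec]

lemma vec_range (v : Fin n → ℤ) (hv : ∀ i, 0 ≤ v i) : ∃ m : Fin n →₀ ℕ, vec m = v :=
  ⟨Finsupp.equivFunOnFinite.symm fun i => (v i).toNat, by ext i; simp [vec, hv i]⟩

lemma FF_eq (f : MvPolynomial (Fin n) ℂ) (i : Fin n) :
    FF f i = jm vec (MvPolynomial.X i * MvPolynomial.pderiv i f) := by
  have : MvPolynomial.X i * MvPolynomial.pderiv i f =
      ∑ m ∈ f.support, MvPolynomial.monomial m ((m i : ℂ) * f.coeff m) := by
    apply MvPolynomial.ext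
    intro m
    rw [coeff_X_pderiv, MvPolynomial.coeff_sum]
    simp only [MvPolynomial.coeff_monomial]
    rw [Finset.sum_ite_eq']
    split_ifs with h
    · rfl
    · rw [MvPolynomial.notMem_support_iff.1 h, mul_zero]
  rw [this, map_sum, FF]
  simp only [jm_monomial]

variable {f : MvPolynomial (Fin n) ℂ} {D : ℕ} {U : Finset (Fin n → ℤ)}

lemma nu_le_CC (hF : FacetData f D U) {v : Fin n → ℤ} (hv : ∀ i, 0 ≤ v i) {N : ℝ}
    (hN : ∀ r, N ≤ r ↔ LP f r (fun i => (v i : ℝ))) (κ : ℤ) : N ≤ (κ : ℝ) / D ↔ ((κ, v) : MM n) ∈ CC U := by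
  rw [hN, mem_CC_LP hF]
  exact ⟨fun h => ⟨hv, h⟩, fun h => h.2⟩

lemma nu_le_all (hF : FacetData f D U) {v : Fin n → ℤ} (hv : ∀ i, 0 ≤ v i) {N : ℝ}
    (hN : ∀ r, N ≤ r ↔ LP f r (fun i => (v i : ℝ))) (r : ℝ) :
    N ≤ r ↔ ∀ u ∈ U, ((∑ i, u i * v i : ℤ) : ℝ) ≤ D * r := by
  rw [hN, hF.iff _ (fun i => by exact_mod_cast hv i)]
  push_cast; rfl

lemma nu_lt_CC (hF : FacetData f D U) {v : Fin n → ℤ} (hv : ∀ i, 0 ≤ v i) {N : ℝ}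
    (hN : ∀ r, N ≤ r ↔ LP f r (fun i => (v i : ℝ))) (κ : ℤ) :
    N < (κ : ℝ) / D ↔ ((κ - 1, v) : MM n) ∈ CC U := by
  have hD := hF.Dpos
  rw [← nu_le_CC hF hv hN]
  constructor
  · intro h
    rw [nu_le_all hF hv hN]
    intro u hu
    have := (nu_le_all hF hv hN N).1 le_rfl u hu
    rw [lt_div_iff₀ hD] at h
    have h2 : ((∑ i, u i * v i : ℤ) : ℝ) < κ := by linarith [mul_comm N (D:ℝ)]
    have h3 : (∑ i, u i * v i : ℤ) ≤ κ - 1 := by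
      have : (∑ i, u i * v i : ℤ) < κ := by exact_mod_cast h2
      omega
    rw [mul_div_cancel₀ _ hD.ne']
    exact_mod_cast h3
  · intro h
    refine lt_of_le_of_lt h ?_
    apply div_lt_div_of_pos_right _ hD
    push_cast; linarith

lemma nu_nonint (hF : FacetData f D U) {v : Fin n → ℤ} (hv : ∀ i, 0 ≤ v i) {N : ℝ}
    (hN : ∀ r, N ≤ r ↔ LP f r (fun i => (v i : ℝ))) {α : ℝ} (hα : ∀ κ : ℤ, α ≠ (κ : ℝ) / D) :
    N ≤ α ↔ N < α := by
  have hD := hF.Dpos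
  refine ⟨fun h => lt_of_le_of_lt (b := ((⌊(D : ℝ) * α⌋ : ℤ) : ℝ) / D) ?_ ?_, le_of_lt⟩
  · rw [nu_le_all hF hv hN] at h ⊢
    intro u hu
    rw [mul_div_cancel₀ _ hD.ne']
    exact_mod_cast Int.le_floor.2 (h u hu)
  · refine lt_of_le_of_ne ?_ (hα _).symm
    rw [div_le_iff₀ hD, mul_comm α]
    exact Int.floor_le _

end JM

section CaseA
variable {n : ℕ} {f : MvPolynomial (Fin n) ℂ} {D : ℕ} {U : Finset (Fin n → ℤ)}

/-- shifted exponent -/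
def vec1 (m : Fin n →₀ ℕ) : Fin n → ℤ := vec m + 1

lemma vec1_inj : Function.Injective (vec1 : (Fin n →₀ ℕ) → (Fin n → ℤ)) := by
  intro a b h
  exact vec_inj (add_right_cancel h)

lemma vec1_add (a b : Fin n →₀ ℕ) : vec1 (a + b) = vec a + vec1 b := by
  rw [vec1, vec1, vec_add, add_assoc]

lemma vec1_nonneg (m : Fin n →₀ ℕ) (i : Fin n) : 0 ≤ vec1 m i := by
  show 0 ≤ (m i : ℤ) + 1
  positivity

lemma QQ_univ_empty : QQ (Finset.univ : Finset (Fin n)) ∅ ∅ = Set.range vec1 := by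
  ext v
  constructor
  · rintro ⟨h1, _, _, h4⟩
    obtain ⟨m, hm⟩ := vec_range (v - 1) (fun i => by
      have := h4 i (Finset.mem_univ _) (by simp)
      show 0 ≤ v i - 1; omega)
    exact ⟨m, by rw [vec1, hm]; abel⟩
  · rintro ⟨m, rfl⟩
    refine ⟨vec1_nonneg m, by simp, by simp, fun l _ _ => ?_⟩
    show 1 ≤ (m l : ℤ) + 1
    linarith [Int.natCast_nonneg (m l)]

lemma nuW_LP (hF : FacetData f D U) (hf : Convenient f) (m : Fin n →₀ ℕ) (r : ℝ) :
    nu f (toR m + 1) ≤ r ↔ LP f r (fun i => (vec1 m i : ℝ)) := by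
  have : (toR m + 1 : Fin n → ℝ) = fun i => (vec1 m i : ℝ) := by
    ext i; simp [toR, vec1, vec]
  rw [this]
  exact nu_le_iff hF hf (fun i => by exact_mod_cast vec1_nonneg m i) r

lemma FL_eq_image {K J : Finset (Fin n)} {τ : Type} {ι : (τ →₀ ℕ) → (Fin n → ℤ)} (hr : QQ K J ∅ = Set.range ι)
    (κ : ℤ) : FL U κ K J = {v | ∃ m, ι m = v ∧ ((κ, ι m) : MM n) ∈ CC U} := by
  ext v
  simp only [FL, hr, Set.mem_setOf_eq, Set.mem_range]
  constructor
  · rintro ⟨⟨m, rfl⟩, h⟩; exact ⟨m, rfl, h⟩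
  · rintro ⟨m, rfl, h⟩; exact ⟨⟨m, rfl⟩, h⟩

/-- unit vector -/
noncomputable def ei (i : Fin n) : Fin n → ℤ := vec (Finsupp.single i 1)

lemma hI_A (x : LL n) : (∃ g ∈ (IIdeal f).restrictScalars ℂ, jm vec1 g = x) ↔ NN f Finset.univ ∅ x := by
  have hFF : ∀ i, FF f i = AddMonoidAlgebra.single (ei i) 1 * jm vec (MvPolynomial.pderiv i f) := by
    intro i
    rw [FF_eq, jm_mul (ι0 := vec) vec_add, MvPolynomial.X, jm_monomial]; rfl
  have hprod : ∀ i (c : LL n) h, AddMonoidAlgebra.single (ei i) 1 * c = jm vec1 h →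
      FF f i * c = jm vec1 (MvPolynomial.pderiv i f * h) := by
    intro i c h hc
    rw [hFF, jm_mul (ι0 := vec) vec1_add, ← hc]; ring
  have heis : ∀ i : Fin n, ei i i = 1 := by intro i; simp [ei, vec]
  have hein : ∀ i l : Fin n, l ≠ i → ei i l = 0 := by
    intro i l hl; simp [ei, vec, Finsupp.single_apply, Ne.symm hl]
  have hQ : ∀ (i : Fin n) (v : Fin n → ℤ), v ∈ QQ Finset.univ ∅ {i.succ} ↔ v + ei i ∈ QQ (Finset.univ : Finset (Fin n)) ∅ ∅ := by
    intro i v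
    constructor
    · rintro ⟨h1, _, _, h4⟩
      refine ⟨fun l => ?_, by simp, by simp, fun l _ _ => ?_⟩
      all_goals
        have := h1 l
        show _ ≤ v l + ei i l
        by_cases hl : l = i
        · subst hl; rw [heis]; omega
        · have h5 := h4 l (Finset.mem_univ _) (by simpa using hl)
          rw [hein i l hl]; omega
    · rintro ⟨h1, _, _, h4⟩
      have h5 : ∀ l, 1 ≤ v l + ei i l := fun l => h4 l (Finset.mem_univ _) (by simp)
      refine ⟨fun l => ?_, by simp, by simp, fun l _ hl' => ?_⟩
      · have := h5 l
        by_cases hl : l = i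
        · subst hl; rw [heis] at this; omega
        · rw [hein i l hl] at this; omega
      · have hl : l ≠ i := by rintro rfl; simp at hl'
        have := h5 l
        rw [hein i l hl] at this; omega
  constructor
  · rintro ⟨g, hg, rfl⟩
    obtain ⟨h, rfl⟩ := Ideal.mem_span_range_iff_exists_fun.1 (show g ∈ Ideal.span _ from hg)
    refine ⟨fun i => AddMonoidAlgebra.single (-ei i) 1 * jm vec1 (h i), fun i v hv => ?_, ?_⟩
    · rw [single_mul_coeff] at hv
      rw [hQ, QQ_univ_empty]
      have := jm_sin _ _ hv
      simpa using this
    · have : ∀ i, FF f i * (AddMonoidAlgebra.single (-ei i) 1 * jm vec1 (h i)) =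
          jm vec1 (MvPolynomial.pderiv i f * h i) := by
        intro i
        apply hprod
        rw [← mul_assoc, AddMonoidAlgebra.single_mul_single, add_neg_cancel, mul_one]
        exact one_mul _
      simp only [this]
      rw [← map_sum, QQ_univ_empty, res_eq_self (jm_sin _)]
      simp only [mul_comm]
  · rintro ⟨c, hc, rfl⟩
    have : ∀ i, ∃ h, jm vec1 h = AddMonoidAlgebra.single (ei i) 1 * c i := by
      intro i
      apply jm_range vec1_inj
      intro v hv
      rw [single_mul_coeff] at hv
      have := (hQ i _).1 (hc i _ hv)
      rw [QQ_univ_empty] at this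
      simpa using this
    choose h hh using this
    refine ⟨∑ i, h i * MvPolynomial.pderiv i f, ?_, ?_⟩
    · exact Ideal.mem_span_range_iff_exists_fun.2 ⟨h, rfl⟩
    · have : ∀ i, FF f i * c i = jm vec1 (h i * MvPolynomial.pderiv i f) := by
        intro i; rw [hprod i (c i) (h i) (hh i).symm, mul_comm]
      simp only [this]
      rw [← map_sum, QQ_univ_empty, res_eq_self (jm_sin _)]

theorem grW_eq (hF : FacetData f D U) (hN : Nil f D U) (hf : Convenient f) (κ : ℤ) :
    (grWDim f ((κ : ℝ) / D) : ℤ) = h0 (phi f D) (BB D U κ Finset.univ ∅) := by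
  refine gr_core hF hN κ Finset.univ ∅ _ _ _ (jm vec1) (jm_inj vec1_inj) ?_ ?_ hI_A
  · intro x
    rw [FL_eq_image QQ_univ_empty, ← jm_exists vec1_inj]
    simp only [← nu_le_CC hF (vec1_nonneg _) (nuW_LP hF hf _)]
    rfl
  · intro x
    rw [FL_eq_image QQ_univ_empty, ← jm_exists vec1_inj]
    simp only [← nu_lt_CC hF (vec1_nonneg _) (nuW_LP hF hf _)]
    rfl

lemma map_mkQ_self {R : Type*} [AddCommGroup R] [Module ℂ R] (Y : Submodule ℂ R) :
    Module.finrank ℂ (Submodule.map Y.mkQ Y) = 0 := by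
  have : Submodule.map Y.mkQ Y = ⊥ := by
    rw [Submodule.eq_bot_iff]
    rintro _ ⟨x, hx, rfl⟩
    rw [← LinearMap.mem_ker, Submodule.ker_mkQ]; exact hx
  rw [this]; simp

theorem grW_nonint (hF : FacetData f D U) (hf : Convenient f) {α : ℝ} (hα : ∀ κ : ℤ, α ≠ (κ : ℝ) / D) :
    grWDim f α = 0 := by
  have : Wle f α = Wlt f α := by
    apply SetLike.ext
    intro g
    show (∀ m ∈ g.support, nu f (toR m + 1) ≤ α) ↔ (∀ m ∈ g.support, nu f (toR m + 1) < α)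
    exact forall₂_congr fun m _ => nu_nonint hF (vec1_nonneg m) (nuW_LP hF hf m) hα
  rw [grWDim, grW, this]
  exact map_mkQ_self _

end CaseA

end Kz
end ToricNewton

set_option linter.all false
set_option linter.unusedSectionVars false
set_option linter.unusedVariables false
namespace ToricNewton
namespace Kz

open Finset

section CaseB
variable {n : ℕ} {f : MvPolynomial (Fin n) ℂ} {D : ℕ} {U : Finset (Fin n → ℤ)}
  {τ : Type} [Fintype τ] [DecidableEq τ] {e : τ → Fin n} {J : Finset (Fin n)} {g : MvPolynomial τ ℂ}

/-- `g` is the restriction of `f` to the coordinate subspace indexed by `τ`. -/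
structure IsRes (e : τ → Fin n) (J : Finset (Fin n)) (f : MvPolynomial (Fin n) ℂ) (g : MvPolynomial τ ℂ) : Prop where
  inj : Function.Injective e
  hJ : ∀ i, i ∈ J ↔ i ∉ Set.range e
  co : ∀ m : τ →₀ ℕ, g.coeff m = f.coeff (m.mapDomain e)

lemma IsRes.notMem (h : IsRes e J f g) (t : τ) : e t ∉ J := by
  rw [h.hJ]; simp

lemma IsRes.app (h : IsRes e J f g) (m : τ →₀ ℕ) (t : τ) : m.mapDomain e (e t) = m t :=
  Finsupp.mapDomain_apply h.inj m t

lemma IsRes.appJ (h : IsRes e J f g) (m : τ →₀ ℕ) {i : Fin n} (hi : i ∈ J) : m.mapDomain e i = 0 :=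
  Finsupp.mapDomain_of_notMem_range m i ((h.hJ i).1 hi)

lemma IsRes.cases (h : IsRes e J f g) (i : Fin n) : i ∈ J ∨ ∃ t, e t = i := by
  by_cases hi : i ∈ J
  · exact Or.inl hi
  · rw [h.hJ] at hi; push Not at hi; exact Or.inr hi

lemma IsRes.range (h : IsRes e J f g) (m : Fin n →₀ ℕ) (hm : ∀ j ∈ J, m j = 0) :
    ∃ m' : τ →₀ ℕ, m'.mapDomain e = m := by
  refine ⟨Finsupp.equivFunOnFinite.symm fun t => m (e t), ?_⟩
  ext i
  rcases h.cases i with hi | ⟨t, rfl⟩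
  · rw [h.appJ _ hi, hm i hi]
  · rw [h.app]; rfl

lemma IsRes.mem (h : IsRes e J f g) (m : τ →₀ ℕ) : m ∈ g.support ↔ m.mapDomain e ∈ f.support := by
  rw [MvPolynomial.mem_support_iff, MvPolynomial.mem_support_iff, h.co]

lemma IsRes.LP_iff (h : IsRes e J f g) (r : ℝ) {x : Fin n → ℝ} {y : τ → ℝ} (hxy : ∀ t, x (e t) = y t)
    (hx : ∀ i ∈ J, x i = 0) : LP g r y ↔ LP f r x := by
  classical
  have hinj : Function.Injective (fun m : τ →₀ ℕ => m.mapDomain e) := Finsupp.mapDomain_injective h.inj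
  constructor
  · rintro ⟨lam, h1, h2, h3⟩
    set lam' : (Fin n →₀ ℕ) → ℝ := fun m => if H : ∃ m' : τ →₀ ℕ, m'.mapDomain e = m then lam H.choose else 0 with hl
    have hl1 : ∀ m', lam' (m'.mapDomain e) = lam m' := by
      intro m'
      have H : ∃ m'' : τ →₀ ℕ, m''.mapDomain e = m'.mapDomain e := ⟨m', rfl⟩
      rw [hl]; simp only
      rw [dif_pos H, hinj H.choose_spec]
    have hl0 : ∀ m ∈ f.support, m ∉ (fun m : τ →₀ ℕ => m.mapDomain e) '' (g.support : Set (τ →₀ ℕ)) → lam' m = 0 := by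
      intro m hm hm'
      rw [hl]; simp only
      rw [dif_neg]
      rintro ⟨m', rfl⟩
      exact hm' ⟨m', (h.mem m').2 hm, rfl⟩
    have hs : ∀ F : (Fin n →₀ ℕ) → ℝ, ∑ m ∈ g.support, lam m * F (m.mapDomain e) = ∑ m ∈ f.support, lam' m * F m := by
      intro F
      refine Finset.sum_of_injOn (fun m : τ →₀ ℕ => m.mapDomain e) hinj.injOn (fun m hm => (h.mem m).1 hm) ?_ ?_
      · intro m hm hm'; rw [hl0 m hm hm', zero_mul]
      · intro m hm; rw [hl1]
    refine ⟨lam', fun m => ?_, ?_, ?_⟩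
    · rw [hl]; simp only; split_ifs
      · exact h1 _
      · exact le_rfl
    · have := hs (fun _ => 1)
      simp only [mul_one] at this
      rwa [← this]
    · ext i
      have h4 := hs (fun m => (m i : ℝ))
      have h5 : (∑ m ∈ f.support, lam' m • toR m) i = ∑ m ∈ f.support, lam' m * (m i : ℝ) := by
        rw [Finset.sum_apply]; rfl
      rw [h5, ← h4]
      rcases h.cases i with hi | ⟨t, rfl⟩
      · rw [hx i hi]; symm
        apply Finset.sum_eq_zero; intro m _; rw [h.appJ _ hi]; simp
      · rw [hxy, h3, Finset.sum_apply]
        refine Finset.sum_congr rfl fun m _ => ?_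
        rw [h.app]; rfl
  · rintro ⟨lam, h1, h2, h3⟩
    have hz : ∀ m ∈ f.support, m ∉ (fun m : τ →₀ ℕ => m.mapDomain e) '' (g.support : Set (τ →₀ ℕ)) → lam m = 0 := by
      intro m hm hm'
      have : ∃ j ∈ J, m j ≠ 0 := by
        by_contra hcon
        push Not at hcon
        obtain ⟨m', rfl⟩ := h.range m hcon
        exact hm' ⟨m', (h.mem m').2 hm, rfl⟩
      obtain ⟨j, hj, hmj⟩ := this
      have h5 := congrFun h3 j
      rw [hx j hj, Finset.sum_apply] at h5
      have h6 := (Finset.sum_eq_zero_iff_of_nonneg (s := f.support) (f := fun m => (lam m • toR m) j)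
        (fun m _ => mul_nonneg (h1 m) (by simp [toR]))).1 h5.symm m hm
      have h7 : lam m * (m j : ℝ) = 0 := h6
      rcases mul_eq_zero.1 h7 with h8 | h8
      · exact h8
      · exact absurd (by exact_mod_cast h8) hmj
    have hs : ∀ F : (Fin n →₀ ℕ) → ℝ, ∑ m ∈ g.support, lam (m.mapDomain e) * F (m.mapDomain e) = ∑ m ∈ f.support, lam m * F m := by
      intro F
      refine Finset.sum_of_injOn (fun m : τ →₀ ℕ => m.mapDomain e) hinj.injOn (fun m hm => (h.mem m).1 hm) ?_ ?_
      · intro m hm hm'; rw [hz m hm hm', zero_mul]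
      · intro m hm; rfl
    refine ⟨fun m => lam (m.mapDomain e), fun m => h1 _, ?_, ?_⟩
    · have := hs (fun _ => 1)
      simp only [mul_one] at this
      rwa [this]
    · ext t
      have h4 := hs (fun m => (m (e t) : ℝ))
      rw [← hxy, h3, Finset.sum_apply, Finset.sum_apply]
      simp only [h.app] at h4
      exact h4.symm

/-- exponents of the restricted polynomial -/
noncomputable def iota (e : τ → Fin n) (m : τ →₀ ℕ) : Fin n → ℤ := vec (m.mapDomain e)

lemma IsRes.iota_inj (h : IsRes e J f g) : Function.Injective (iota e) :=
  fun _ _ hh => Finsupp.mapDomain_injective h.inj (vec_inj hh)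

lemma iota_add (e : τ → Fin n) (a b : τ →₀ ℕ) : iota e (a + b) = iota e a + iota e b := by
  rw [iota, Finsupp.mapDomain_add, vec_add]; rfl

lemma iota_nonneg (m : τ →₀ ℕ) (i : Fin n) : 0 ≤ iota e m i := Int.natCast_nonneg _

lemma IsRes.QQ_range (h : IsRes e J f g) : QQ ∅ J ∅ = Set.range (iota e) := by
  ext v
  constructor
  · rintro ⟨h1, _, h3, _⟩
    obtain ⟨m, rfl⟩ := vec_range v h1
    obtain ⟨m', rfl⟩ := h.range m (fun j hj => by have := h3 j hj; simpa [vec] using this)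
    exact ⟨m', rfl⟩
  · rintro ⟨m, rfl⟩
    refine ⟨iota_nonneg m, by simp, fun j hj => ?_, by simp⟩
    show ((m.mapDomain e j : ℕ) : ℤ) = 0
    rw [h.appJ m hj]; rfl

lemma IsRes.nu_LP (h : IsRes e J f g) (hg : Convenient g) (m : τ →₀ ℕ) (r : ℝ) :
    nu g (toR m) ≤ r ↔ LP f r (fun i => (iota e m i : ℝ)) := by
  obtain ⟨D', U', hF'⟩ := exists_facetData hg
  rw [nu_le_iff hF' hg (fun i => by simp [toR])]
  apply h.LP_iff
  · intro t; simp [iota, vec, h.app, toR]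
  · intro i hi; simp [iota, vec, h.appJ m hi]

lemma IsRes.res_FF (h : IsRes e J f g) (t : τ) :
    res (QQ ∅ J ∅) (FF f (e t)) = jm (iota e) (MvPolynomial.X t * MvPolynomial.pderiv t g) := by
  classical
  apply alg_ext
  intro v
  rw [res_coeff, h.QQ_range]
  split_ifs with hv
  · obtain ⟨m, rfl⟩ := hv
    rw [jm_coeff h.iota_inj, coeff_X_pderiv, FF_eq, iota, jm_coeff vec_inj, coeff_X_pderiv, h.app, h.co]
  · rw [jm_coeff_notMem _ hv]

lemma IsRes.res_mul (h : IsRes e J f g) (t : τ) (p : MvPolynomial τ ℂ) :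
    res (QQ ∅ J ∅) (FF f (e t) * jm (iota e) p)
      = jm (iota e) (p * (MvPolynomial.X t * MvPolynomial.pderiv t g)) := by
  rw [mul_comm, ← res_mul_res (S := QQ ∅ J ∅), h.res_FF, ← jm_mul (ι0 := iota e) (iota_add e)]
  · apply res_eq_self
    rw [h.QQ_range]
    exact jm_sin _
  · intro m hm hmQ w hw hmw
    apply hmQ
    rw [FF_eq] at hm
    obtain ⟨m', rfl⟩ := jm_sin _ _ hm
    obtain ⟨w', rfl⟩ := jm_sin _ _ hw
    refine ⟨fun i => Int.natCast_nonneg _, by simp, fun j hj => ?_, by simp⟩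
    have h1 : vec m' j + iota e w' j = 0 := hmw.2.2.1 j hj
    have h2 := iota_nonneg (e := e) w' j
    have h3 : 0 ≤ vec m' j := Int.natCast_nonneg _
    omega

lemma IsRes.hI_B (h : IsRes e J f g) (x : LL n) :
    (∃ p ∈ (LIdeal g).restrictScalars ℂ, jm (iota e) p = x) ↔ NN f ∅ J x := by
  classical
  have hQt : ∀ t, QQ ∅ J {(e t).succ} = Set.range (iota e) := by
    intro t
    rw [← h.QQ_range]
    ext v
    simp only [QQ, Set.mem_setOf_eq, Finset.mem_singleton, Fin.succ_inj]
    constructor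
    · rintro ⟨h1, _, h3, _⟩; exact ⟨h1, by simp, h3, by simp⟩
    · rintro ⟨h1, _, h3, _⟩
      exact ⟨h1, fun j hj hh => h.notMem t (hh ▸ hj), h3, by simp⟩
  have hsum : ∀ F : Fin n → LL n, (∀ i ∈ J, F i = 0) → ∑ i, F i = ∑ t, F (e t) := by
    intro F hF
    symm
    refine Finset.sum_of_injOn e h.inj.injOn (fun _ _ => by simp) ?_ (fun _ _ => rfl)
    intro i _ hi
    exact hF i ((h.hJ i).2 (by simpa using hi))
  constructor
  · rintro ⟨p, hp, rfl⟩
    obtain ⟨q, rfl⟩ := Ideal.mem_span_range_iff_exists_fun.1 (show p ∈ Ideal.span _ from hp)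
    set c : Fin n → LL n := fun i => if H : ∃ t, e t = i then jm (iota e) (q H.choose) else 0 with hc
    have hct : ∀ t, c (e t) = jm (iota e) (q t) := by
      intro t
      have H : ∃ t', e t' = e t := ⟨t, rfl⟩
      rw [hc]; simp only
      rw [dif_pos H, h.inj H.choose_spec]
    have hcJ : ∀ i ∈ J, c i = 0 := by
      intro i hi
      rw [hc]; simp only
      rw [dif_neg]
      exact (h.hJ i).1 hi
    refine ⟨c, fun i => ?_, ?_⟩
    · rcases h.cases i with hi | ⟨t, rfl⟩
      · rw [hcJ i hi]; exact SIn.zero _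
      · rw [hct, hQt]; exact jm_sin _
    · rw [hsum _ (fun i hi => by rw [hcJ i hi, mul_zero]), res_sum, map_sum]
      refine Finset.sum_congr rfl fun t _ => ?_
      rw [hct, h.res_mul]
  · rintro ⟨c, hc, rfl⟩
    have hcJ : ∀ i ∈ J, c i = 0 := by
      intro i hi
      apply alg_ext; intro v
      by_contra hv
      exact (hc i v hv).2.1 i hi (by simp)
    have : ∀ t, ∃ q, jm (iota e) q = c (e t) := by
      intro t
      apply jm_range h.iota_inj
      rw [← hQt t]; exact hc _
    choose q hq using this
    refine ⟨∑ t, q t * (MvPolynomial.X t * MvPolynomial.pderiv t g),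
      Ideal.mem_span_range_iff_exists_fun.2 ⟨q, rfl⟩, ?_⟩
    rw [hsum _ (fun i hi => by rw [hcJ i hi, mul_zero]), res_sum, map_sum]
    refine Finset.sum_congr rfl fun t _ => ?_
    rw [← hq, h.res_mul]

theorem IsRes.grN_eq (h : IsRes e J f g) (hF : FacetData f D U) (hN : Nil f D U) (hg : Convenient g) (κ : ℤ) :
    (grDim g ((κ : ℝ) / D) : ℤ) = h0 (phi f D) (BB D U κ ∅ J) := by
  refine gr_core hF hN κ ∅ J _ _ _ (jm (iota e)) (jm_inj h.iota_inj) ?_ ?_ h.hI_B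
  · intro x
    rw [FL_eq_image h.QQ_range, ← jm_exists h.iota_inj]
    simp only [← nu_le_CC hF (iota_nonneg _) (h.nu_LP hg _)]
    rfl
  · intro x
    rw [FL_eq_image h.QQ_range, ← jm_exists h.iota_inj]
    simp only [← nu_lt_CC hF (iota_nonneg _) (h.nu_LP hg _)]
    rfl

theorem IsRes.grN_nonint (h : IsRes e J f g) (hF : FacetData f D U) (hg : Convenient g) {α : ℝ}
    (hα : ∀ κ : ℤ, α ≠ (κ : ℝ) / D) : grDim g α = 0 := by
  have : Nle g α = Nlt g α := by
    apply SetLike.ext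
    intro q
    show (∀ m ∈ q.support, nu g (toR m) ≤ α) ↔ (∀ m ∈ q.support, nu g (toR m) < α)
    exact forall₂_congr fun m _ => nu_nonint hF (iota_nonneg m) (h.nu_LP hg m) hα
  rw [grDim, grN, this]
  exact map_mkQ_self _

lemma isRes_id (f : MvPolynomial (Fin n) ℂ) : IsRes id ∅ f f :=
  ⟨Function.injective_id, by simp, by simp [Finsupp.mapDomain_id]⟩

lemma isRes_restrict (S : Finset (Fin n)) (f : MvPolynomial (Fin n) ℂ) :
    IsRes (Subtype.val : {j : Fin n // j ∉ S} → Fin n) S f (restrictZero S f) := by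
  refine ⟨Subtype.val_injective, by simp, fun m => ?_⟩
  classical
  have hinj : Function.Injective (fun m : {j : Fin n // j ∉ S} →₀ ℕ => m.mapDomain Subtype.val) :=
    Finsupp.mapDomain_injective Subtype.val_injective
  rw [restrictZero]
  induction f using MvPolynomial.induction_on' with
  | add p q hp hq => rw [map_add, MvPolynomial.coeff_add, MvPolynomial.coeff_add, hp, hq]
  | monomial u z =>
    rw [MvPolynomial.aeval_monomial, MvPolynomial.coeff_monomial, MvPolynomial.algebraMap_eq]
    by_cases hu : ∃ u' : {j : Fin n // j ∉ S} →₀ ℕ, u'.mapDomain Subtype.val = u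
    · obtain ⟨u', rfl⟩ := hu
      rw [Finsupp.prod_mapDomain_index_inj Subtype.val_injective]
      have : (u'.prod fun a m => (if h : (a : Fin n) ∉ S then MvPolynomial.X (⟨a, h⟩ : {j : Fin n // j ∉ S})
          else (0 : MvPolynomial {j : Fin n // j ∉ S} ℂ)) ^ m) = u'.prod fun a m => MvPolynomial.X a ^ m := by
        refine Finsupp.prod_congr fun a _ => ?_
        rw [dif_pos a.2]
      rw [this, ← MvPolynomial.monomial_eq, MvPolynomial.coeff_monomial]
      simp only [hinj.eq_iff]
    · rw [if_neg (fun hh => hu ⟨m, hh.symm⟩)]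
      have : ∃ j ∈ S, u j ≠ 0 := by
        by_contra hcon
        push Not at hcon
        apply hu
        refine ⟨Finsupp.equivFunOnFinite.symm fun t => u t.1, ?_⟩
        ext i
        by_cases hi : i ∈ S
        · rw [hcon i hi]
          apply Finsupp.mapDomain_of_notMem_range
          simpa using hi
        · exact Finsupp.mapDomain_apply Subtype.val_injective _ (⟨i, hi⟩ : {j : Fin n // j ∉ S})
      obtain ⟨j, hj, hju⟩ := this
      rw [Finsupp.prod, Finset.prod_eq_zero (i := j) (Finsupp.mem_support_iff.2 hju)]
      · simp
      · rw [dif_neg (by simpa using hj), zero_pow hju]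

lemma IsRes.convenient (h : IsRes e J f g) (hf : Convenient f) : Convenient g := by
  intro t
  obtain ⟨k, hk, hc⟩ := hf (e t)
  refine ⟨k, hk, ?_⟩
  rw [h.co, Finsupp.mapDomain_single]; exact hc

/-- The contribution of the origin. -/
lemma h0_univ (hF : FacetData f D U) (κ : ℤ) :
    h0 (phi f D) (BB D U κ ∅ Finset.univ) = if κ = 0 then 1 else 0 := by
  have hC : ∀ k : ℤ, ((k, 0) : MM n) ∈ CC U ↔ 0 ≤ k := by
    intro k
    constructor
    · intro h; exact CC_fst_nonneg hF h
    · intro hk; rw [mem_CC']; exact ⟨fun i => le_rfl, fun u _ => by simpa using hk⟩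
  have hB : ∀ m : MM n, m ∈ BB D U κ ∅ Finset.univ ∅ ↔ m = (κ, 0) ∧ 0 ≤ κ := by
    intro m
    rw [mem_BB_iff, wt_empty]
    constructor
    · rintro ⟨h1, h2, h3⟩
      have : m = (κ, 0) := by
        refine Prod.ext (by simpa using h3) ?_
        funext i; exact h2.2.2.1 i (Finset.mem_univ _)
      refine ⟨this, ?_⟩
      rw [this] at h1; exact (hC κ).1 h1
    · rintro ⟨rfl, hk⟩
      exact ⟨(hC κ).2 hk, ⟨fun i => le_rfl, by simp, fun _ _ => rfl, by simp⟩, by simp⟩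
  have hB0 : ∀ m : MM n, m ∈ BB D U κ ∅ Finset.univ {0} ↔ m = (κ - 1, 0) ∧ 1 ≤ κ := by
    intro m
    rw [mem_BB_iff, wt_single, wtg_zero]
    constructor
    · rintro ⟨h1, h2, h3⟩
      have : m = (κ - 1, 0) := by
        refine Prod.ext (by simp; omega) ?_
        funext i; exact h2.2.2.1 i (Finset.mem_univ _)
      refine ⟨this, ?_⟩
      rw [this] at h1; have := (hC _).1 h1; omega
    · rintro ⟨rfl, hk⟩
      refine ⟨(hC _).2 (by omega), ⟨fun i => le_rfl, ?_, fun _ _ => rfl, by simp⟩, by simp⟩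
      intro j _ hj; simp at hj
  have hBs : ∀ (i : Fin n) (m : MM n), m ∉ BB D U κ ∅ Finset.univ {i.succ} := by
    intro i m hm
    rw [mem_BB_iff] at hm
    exact hm.2.1.2.1 i (Finset.mem_univ _) (by simp)
  rw [h0]
  rcases lt_trichotomy κ 0 with hk | hk | hk
  · have h1 : BB D U κ ∅ Finset.univ ∅ = ∅ := by
      ext m; rw [hB]; simp; intro _; omega
    have h2 : Im (phi f D) (BB D U κ ∅ Finset.univ) = ⊥ := by
      rw [Submodule.eq_bot_iff]
      intro a ha
      have := Im_le _ _ ha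
      rw [h1] at this
      apply alg_ext; intro m
      by_contra hm
      exact this m hm
    rw [h1, h2, if_neg hk.ne]; simp
  · subst hk
    have h1 : BB D U 0 ∅ Finset.univ ∅ = {((0, 0) : MM n)} := by
      ext m; rw [hB]; simp
    have h2 : Im (phi f D) (BB D U 0 ∅ Finset.univ) = ⊥ := by
      rw [Submodule.eq_bot_iff]
      intro a ha
      obtain ⟨c, hc, rfl⟩ := mem_Im_iff.1 ha
      have : ∀ t, c t = 0 := by
        intro t
        apply alg_ext; intro m
        by_contra hm
        have h3 := hc t m hm
        refine Fin.cases (fun h3 => ?_) (fun i h3 => ?_) t h3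
        · have := ((hB0 m).1 h3).2; omega
        · exact hBs i m h3
      simp only [this, mul_zero, Finset.sum_const_zero]
      exact res_zero _
    rw [h2, h1, if_pos rfl]; simp
  · have h1 : BB D U κ ∅ Finset.univ ∅ = {((κ, 0) : MM n)} := by
      ext m; rw [hB]; simp; intro _; omega
    have h2 : Im (phi f D) (BB D U κ ∅ Finset.univ) = suppM (BB D U κ ∅ Finset.univ ∅) := by
      apply le_antisymm (Im_le _ _)
      intro a ha
      have ha' : SIn (BB D U κ ∅ Finset.univ ∅) a := ha
      rw [mem_Im_iff]
      refine ⟨fun t => if t = 0 then AddMonoidAlgebra.single ((-1, 0) : MM n) 1 * a else 0, ?_, ?_⟩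
      · intro t
        simp only
        split_ifs with ht
        · subst ht
          intro m hm
          rw [single_mul_coeff] at hm
          have h3 := (hB _).1 (ha' _ hm)
          rw [hB0]
          refine ⟨?_, by omega⟩
          rw [← sub_add_cancel m ((-1, 0) : MM n), h3.1]; simp; ring
        · exact SIn.zero _
      · rw [Finset.sum_eq_single (0 : Fin (n + 1))]
        · simp only
          rw [if_pos trivial, phi_zero, ← mul_assoc, AddMonoidAlgebra.single_mul_single]
          have : ((1, 0) : MM n) + (-1, 0) = 0 := by simp [Prod.ext_iff]
          rw [this, mul_one]
          have h4 : AddMonoidAlgebra.single (0 : MM n) (1 : ℂ) * a = a := one_mul a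
          rw [h4, res_eq_self ha']
        · intro t _ ht; simp only; rw [if_neg ht, mul_zero]
        · intro h; exact absurd (Finset.mem_univ _) h
    rw [h2, finrank_suppM (BB_finite hF _ _ _), if_neg hk.ne']; simp
end CaseB

end Kz
end ToricNewton

set_option linter.all false
set_option linter.unusedSectionVars false
set_option linter.unusedVariables false
namespace ToricNewton
namespace Kz

open Finset

section Final
variable {n : ℕ} {f : MvPolynomial (Fin n) ℂ} {D : ℕ} {U : Finset (Fin n → ℤ)}
  {τ : Type} [Fintype τ] [DecidableEq τ] {e : τ → Fin n} {J : Finset (Fin n)} {g : MvPolynomial τ ℂ}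

lemma IsRes.nondegenerate (h : IsRes e J f g) (hnd : Nondegenerate f) : Nondegenerate g := by
  classical
  rintro Δ ⟨⟨⟨x0, hx0⟩, l, c, hlc, rfl⟩, h0Δ⟩ ⟨y, hy0, hy⟩
  have hc : 0 < c := by
    have h1 := hlc 0 (zero_mem_P g)
    rw [map_zero] at h1
    refine lt_of_le_of_ne h1 fun h2 => h0Δ ⟨zero_mem_P g, ?_⟩
    rw [map_zero]; exact h2
  set pr : (Fin n → ℝ) →ₗ[ℝ] (τ → ℝ) := LinearMap.funLeft ℝ ℝ e with hpr
  have hpra : ∀ x t, pr x t = x (e t) := fun x t => rfl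
  set B : ℝ := 1 + ∑ m ∈ f.support, |l (pr (toR m))| with hB
  set l' : (Fin n → ℝ) →ₗ[ℝ] ℝ := l.comp pr - B • ∑ j ∈ J, LinearMap.proj j with hl'
  have hl'a : ∀ x, l' x = l (pr x) - B * ∑ j ∈ J, x j := by
    intro x
    simp [hl', LinearMap.sum_apply]
  have hprm : ∀ m : τ →₀ ℕ, pr (toR (m.mapDomain e)) = toR m := by
    intro m; funext t; rw [hpra]; simp only [toR]; rw [h.app]
  have hlim : ∀ m : τ →₀ ℕ, l' (toR (m.mapDomain e)) = l (toR m) := by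
    intro m
    rw [hl'a, hprm, Finset.sum_eq_zero, mul_zero, sub_zero]
    intro j hj; simp only [toR]; rw [h.appJ m hj]; simp
  have hlneg : ∀ m ∈ f.support, (∃ j ∈ J, m j ≠ 0) → l' (toR m) < c := by
    rintro m hm ⟨j, hj, hmj⟩
    have h1 : (1 : ℝ) ≤ ∑ j ∈ J, toR m j := by
      have h2 : toR m j ≤ ∑ j ∈ J, toR m j :=
        Finset.single_le_sum (f := fun j => toR m j) (fun i _ => by simp [toR]) hj
      have h3 : (1 : ℝ) ≤ toR m j := by
        simp only [toR]; exact_mod_cast Nat.one_le_iff_ne_zero.2 hmj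
      linarith
    have h4 : |l (pr (toR m))| ≤ ∑ m ∈ f.support, |l (pr (toR m))| :=
      Finset.single_le_sum (f := fun m => |l (pr (toR m))|) (fun i _ => abs_nonneg _) hm
    have h5 := le_abs_self (l (pr (toR m)))
    have h6 : 0 ≤ B := by linarith [abs_nonneg (l (pr (toR m)))]
    rw [hl'a]
    nlinarith
  have hcase : ∀ m : Fin n →₀ ℕ, (∃ j ∈ J, m j ≠ 0) ∨ ∃ m' : τ →₀ ℕ, m'.mapDomain e = m := by
    intro m
    by_cases hm : ∃ j ∈ J, m j ≠ 0
    · exact Or.inl hm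
    · push Not at hm
      exact Or.inr (h.range m hm)
  have hle : ∀ m ∈ f.support, l' (toR m) ≤ c := by
    intro m hm
    rcases hcase m with h1 | ⟨m', rfl⟩
    · exact (hlneg m hm h1).le
    · rw [hlim]; exact hlc _ (toR_mem_P ((h.mem m').2 hm))
  have hface : NBFace f {x ∈ newtonPolytope f | l' x = c} := by
    refine ⟨⟨?_, l', c, ?_, rfl⟩, ?_⟩
    · set x1 : Fin n → ℝ := fun i => if H : ∃ t, e t = i then x0 H.choose else 0 with hx1
      have hx1t : ∀ t, x1 (e t) = x0 t := by
        intro t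
        have H : ∃ t', e t' = e t := ⟨t, rfl⟩
        rw [hx1]; simp only
        rw [dif_pos H, h.inj H.choose_spec]
      have hx1J : ∀ i ∈ J, x1 i = 0 := by
        intro i hi
        rw [hx1]; simp only
        rw [dif_neg]
        exact (h.hJ i).1 hi
      refine ⟨x1, ?_, ?_⟩
      · rw [mem_P_iff, ← h.LP_iff 1 hx1t hx1J, ← mem_P_iff]; exact hx0.1
      · rw [hl'a, Finset.sum_eq_zero hx1J, mul_zero, sub_zero]
        have : pr x1 = x0 := by funext t; exact hx1t t
        rw [this]; exact hx0.2
    · intro x hx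
      obtain ⟨lam, h1, h2, h3⟩ := mem_P_iff.1 hx
      rw [h3, map_sum]
      calc ∑ m ∈ f.support, l' (lam m • toR m) ≤ ∑ m ∈ f.support, lam m * c := by
            refine Finset.sum_le_sum fun m hm => ?_
            rw [map_smul, smul_eq_mul]
            exact mul_le_mul_of_nonneg_left (hle m hm) (h1 m)
        _ = (∑ m ∈ f.support, lam m) * c := by rw [Finset.sum_mul]
        _ ≤ 1 * c := mul_le_mul_of_nonneg_right h2 hc.le
        _ = c := one_mul c
    · rintro ⟨_, h2⟩
      rw [map_zero] at h2; exact hc.ne h2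
  set x : Fin n → ℂ := fun i => if H : ∃ t, e t = i then y H.choose else 1 with hx
  have hxt : ∀ t, x (e t) = y t := by
    intro t
    have H : ∃ t', e t' = e t := ⟨t, rfl⟩
    rw [hx]; simp only
    rw [dif_pos H, h.inj H.choose_spec]
  have hprod : ∀ m : τ →₀ ℕ, ∏ i, x i ^ (m.mapDomain e) i = ∏ t, y t ^ m t := by
    intro m
    symm
    refine Finset.prod_of_injOn e h.inj.injOn (fun _ _ => by simp) ?_ ?_
    · intro i _ hi
      rw [h.appJ m ((h.hJ i).2 (by simpa using hi)), pow_zero]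
    · intro t _; rw [hxt, h.app]
  apply hnd _ hface
  refine ⟨x, fun i => ?_, fun i => ?_⟩
  · rw [hx]; simp only
    split_ifs
    · exact hy0 _
    · exact one_ne_zero
  · rw [eval_faceRestrict]
    have hnot : ∀ m ∈ f.support, (∃ j ∈ J, m j ≠ 0) → toR m ∉ {x ∈ newtonPolytope f | l' x = c} := by
      rintro m hm hj ⟨_, h2⟩
      exact (hlneg m hm hj).ne h2
    rcases h.cases i with hi | ⟨t, rfl⟩
    · apply Finset.sum_eq_zero
      intro m hm
      rcases hcase m with h1 | ⟨m', rfl⟩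
      · rw [if_neg (hnot m hm h1)]
      · rw [h.appJ m' hi]; simp
    · refine Eq.trans ?_ (hy t)
      rw [eval_faceRestrict]
      symm
      refine Finset.sum_of_injOn (fun m : τ →₀ ℕ => m.mapDomain e)
        (Finsupp.mapDomain_injective h.inj).injOn (fun m hm => (h.mem m).1 hm) ?_ ?_
      · intro m hm hm'
        rcases hcase m with h1 | ⟨m', rfl⟩
        · rw [if_neg (hnot m hm h1)]
        · exact absurd ⟨m', (h.mem m').2 hm, rfl⟩ hm'
      · intro m hm
        have hiff : toR m ∈ {x ∈ newtonPolytope g | l x = c} ↔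
            toR (m.mapDomain e) ∈ {x ∈ newtonPolytope f | l' x = c} := by
          constructor
          · rintro ⟨_, h2⟩
            exact ⟨toR_mem_P ((h.mem m).1 hm), by rw [hlim]; exact h2⟩
          · rintro ⟨_, h2⟩
            exact ⟨toR_mem_P hm, by rw [← hlim]; exact h2⟩
        simp only [hiff, hprod, h.app, h.co]

lemma sum_by_card (hn : 1 ≤ n) (G : Finset (Fin n) → ℤ) :
    ∑ S : Finset (Fin n), (-1) ^ S.card * G S =
      G ∅ + (∑ p ∈ Finset.Icc 1 (n - 1), (-1 : ℤ) ^ p *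
        ∑ S ∈ Finset.univ.filter (fun S : Finset (Fin n) => S.card = p), G S) + (-1) ^ n * G Finset.univ := by
  have h1 : ∑ S : Finset (Fin n), (-1) ^ S.card * G S = ∑ p ∈ Finset.range (n + 1), (-1 : ℤ) ^ p *
        ∑ S ∈ Finset.univ.filter (fun S : Finset (Fin n) => S.card = p), G S := by
    rw [← Finset.sum_fiberwise_of_maps_to (s := Finset.univ) (t := Finset.range (n + 1))
      (g := fun S : Finset (Fin n) => S.card)]
    · refine Finset.sum_congr rfl fun p _ => ?_
      rw [Finset.mul_sum]
      refine Finset.sum_congr rfl fun S hS => ?_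
      rw [(Finset.mem_filter.1 hS).2]
    · intro S _
      have := Finset.card_le_univ S
      rw [Fintype.card_fin] at this
      simp; omega
  obtain ⟨k, rfl⟩ : ∃ k, n = k + 1 := ⟨n - 1, by omega⟩
  have h2 : Finset.univ.filter (fun S : Finset (Fin (k + 1)) => S.card = 0) = {∅} := by
    ext S; simp
  have h3 : Finset.univ.filter (fun S : Finset (Fin (k + 1)) => S.card = k + 1) = {Finset.univ} := by
    ext S
    simp only [Finset.mem_filter, Finset.mem_univ, true_and, Finset.mem_singleton]
    rw [← Finset.card_eq_iff_eq_univ, Fintype.card_fin]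
  rw [h1, Finset.sum_range_succ, h3, Finset.sum_singleton, Finset.range_eq_Ico,
    Finset.sum_eq_sum_Ico_succ_bot (by omega), h2, Finset.sum_singleton, pow_zero, one_mul]
  rfl

end Final

end Kz
end ToricNewton

open ToricNewton in
/-- the Newton spectrum (dimensions of `gr^W(ℬ/ℐ)`) is computed from
the toric Newton spectra of `f` and of its restrictions to the coordinate
subspaces by inclusion–exclusion. -/
theorem newton_spectrum_from_toric_spectra {n : ℕ} (hn : 1 ≤ n)
    (f : MvPolynomial (Fin n) ℂ) (hconv : Convenient f) (hnd : Nondegenerate f) :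
    (∀ S : Finset (Fin n), 1 ≤ S.card → S.card ≤ n - 1 →
      Convenient (restrictZero S f) ∧ Nondegenerate (restrictZero S f)) ∧
    (∀ α : ℚ,
      (grWDim f (α : ℝ) : ℤ) =
        (grDim f (α : ℝ) : ℤ)
          + (∑ p ∈ Finset.Icc 1 (n - 1), (-1 : ℤ) ^ p *
              ∑ S ∈ Finset.univ.filter (fun S : Finset (Fin n) => S.card = p),
                (grDim (restrictZero S f) (α : ℝ) : ℤ))
          + (-1 : ℤ) ^ n * (if α = 0 then 1 else 0)) := by
  refine ⟨fun S _ _ => ⟨(Kz.isRes_restrict S f).convenient hconv, (Kz.isRes_restrict S f).nondegenerate hnd⟩,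
    fun α => ?_⟩
  obtain ⟨D, U, hF⟩ := Kz.exists_facetData hconv
  have hN := Kz.nil_of_nondegenerate hF hnd
  have hD := hF.Dpos
  by_cases hα : ∃ κ : ℤ, (α : ℝ) = (κ : ℝ) / D
  · obtain ⟨κ, hκ⟩ := hα
    have h0 : α = 0 ↔ κ = 0 := by
      rw [← Rat.cast_eq_zero (α := ℝ), hκ, div_eq_zero_iff]
      simp [hD.ne']
    rw [hκ, Kz.grW_eq hF hN hconv, Kz.h0_alt_univ hF hN, Kz.sum_by_card hn,
      (Kz.isRes_id f).grN_eq hF hN hconv, Kz.h0_univ hF]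
    simp only [h0]
    congr 2
    refine Finset.sum_congr rfl fun p _ => ?_
    congr 1
    refine Finset.sum_congr rfl fun S _ => ?_
    exact ((Kz.isRes_restrict S f).grN_eq hF hN ((Kz.isRes_restrict S f).convenient hconv) κ).symm
  · push Not at hα
    have h0 : α ≠ 0 := by
      rintro rfl
      exact hα 0 (by simp)
    rw [Kz.grW_nonint hF hconv hα, (Kz.isRes_id f).grN_nonint hF hconv hα, if_neg h0]
    simp only [fun S => (Kz.isRes_restrict S f).grN_nonint hF ((Kz.isRes_restrict S f).convenient hconv) hα]
    simp
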